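/- For every prime p and every v ∈ ℚ_p, the set of u ∈ ℝ such that (u,v) does not satisfy condition (1.2) is a countable union of sets each of which has upper box dimension zero. -/

import Mathlib

/-- Condition (1.2): `liminf_{|q|,|q₀| → ∞} |q|·|qu − q₀|·|qv − q₀|_p = 0`. -/
def Cond12 (p : ℕ) [Fact p.Prime] (u : ℝ) (v : ℚ_[p]) : Prop :=
  ∀ ε : ℝ, 0 < ε → ∀ N : ℕ, ∃ q q₀ : ℤ,
    (N : ℤ) ≤ |q| ∧ (N : ℤ) ≤ |q₀| ∧
    (|q| : ℝ) * |(q : ℝ) * u - (q₀ : ℝ)| * ‖(q : ℚ_[p]) * v - (q₀ : ℚ_[p])‖ < ε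

/-- `F` is a `δ`-separated finite set for the distance function `d`. -/
def IsSepIn {Z : Type*} (d : Z → Z → ℝ) (δ : ℝ) (F : Finset Z) : Prop :=
  ∀ x ∈ F, ∀ y ∈ F, x ≠ y → δ < d x y

/-- `sepNum d δ E` is the maximal cardinality of a `δ`-separated subset of `E`. -/
noncomputable def sepNum {Z : Type*} (d : Z → Z → ℝ) (δ : ℝ) (E : Set Z) : ℕ :=
  sSup {n : ℕ | ∃ F : Finset Z, ↑F ⊆ E ∧ IsSepIn d δ F ∧ F.card = n}

/-- The upper box dimension of `E`: `limsup_{δ → 0⁺} log s_δ(E) / |log δ|`. -/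
noncomputable def upperBoxDim {Z : Type*} (d : Z → Z → ℝ) (E : Set Z) : ℝ :=
  Filter.limsup (fun δ : ℝ => Real.log (sepNum d δ E) / |Real.log δ|)
    (nhdsWithin 0 (Set.Ioi 0))

namespace PadicLittlewood

open MeasureTheory Filter Set Topology ProbabilityTheory
open scoped ENNReal

section MaximalInequality

/-- The points at which some forward average of the indicator of `E` along `T` exceeds `δ`. -/
def maxBad {Ω : Type*} (T : Ω → Ω) (E : Set Ω) (δ : ℝ) : Set Ω :=
  {ω | ∃ n : ℕ, δ * n < ∑ i ∈ Finset.range n, E.indicator (fun _ => (1 : ℝ)) (T^[i] ω)}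

section Maximal

variable {Ω : Type*}

/-- `maxSum T f n ω` is the maximum of the Birkhoff sums of `f` of length at most `n`. -/
noncomputable def maxSum (T : Ω → Ω) (f : Ω → ℝ) : ℕ → Ω → ℝ
  | 0, _ => 0
  | n + 1, ω => max 0 (f ω + maxSum T f n (T ω))

lemma maxSum_nonneg (T : Ω → Ω) (f : Ω → ℝ) (n : ℕ) (ω : Ω) : 0 ≤ maxSum T f n ω := by
  cases n with
  | zero => exact le_rfl
  | succ n => exact le_max_left _ _

lemma maxSum_le_succ (T : Ω → Ω) (f : Ω → ℝ) (n : ℕ) (ω : Ω) :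
    maxSum T f n ω ≤ maxSum T f (n + 1) ω := by
  induction n generalizing ω with
  | zero => exact maxSum_nonneg T f 1 ω
  | succ n ih =>
    change max 0 (f ω + maxSum T f n (T ω)) ≤ max 0 (f ω + maxSum T f (n + 1) (T ω))
    have := ih (T ω)
    gcongr

lemma sum_le_maxSum (T : Ω → Ω) (f : Ω → ℝ) (n : ℕ) (ω : Ω) :
    ∑ i ∈ Finset.range n, f (T^[i] ω) ≤ maxSum T f n ω := by
  induction n generalizing ω with
  | zero => simp [maxSum]
  | succ n ih =>
    rw [Finset.sum_range_succ']
    have := ih (T ω)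
    simp only [Function.iterate_succ, Function.comp, Function.iterate_zero, id] at *
    rw [maxSum]
    exact le_max_of_le_right (by linarith)

lemma maxSum_le {T : Ω → Ω} {f : Ω → ℝ} {c : ℝ} (hc : 0 ≤ c) (hf : ∀ ω, f ω ≤ c) (n : ℕ) (ω : Ω) :
    maxSum T f n ω ≤ c * n := by
  induction n generalizing ω with
  | zero => simp [maxSum]
  | succ n ih =>
    rw [maxSum]
    have := ih (T ω)
    have := hf ω
    push_cast
    exact max_le (by positivity) (by linarith)

variable [MeasurableSpace Ω]

lemma measurable_maxSum {T : Ω → Ω} {f : Ω → ℝ} (hT : Measurable T) (hf : Measurable f) (n : ℕ) :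
    Measurable (maxSum T f n) := by
  induction n with
  | zero => exact measurable_const
  | succ n ih => exact measurable_const.max (hf.add (ih.comp hT))

/-- The maximal ergodic inequality for indicator functions. -/
theorem measure_maxBad_le {μ : Measure Ω} [IsProbabilityMeasure μ] {T : Ω → Ω}
    (hT : MeasurePreserving T μ μ) {E : Set Ω} (hE : MeasurableSet E) {δ : ℝ} (hδ : 0 < δ) :
    μ (maxBad T E δ) ≤ ENNReal.ofReal (μ.real E / δ) := by
  set f : Ω → ℝ := fun ω => E.indicator (fun _ => (1 : ℝ)) ω - δ with hf
  have hfm : Measurable f := (measurable_const.indicator hE).sub measurable_const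
  have hf1 : ∀ ω, f ω ≤ 1 := fun ω => by
    have : E.indicator (fun _ => (1 : ℝ)) ω ≤ 1 := Set.indicator_le_self' (by simp) ω
    simp only [hf]; linarith
  have hfi : Integrable f μ :=
    ((integrable_const (1 : ℝ)).indicator hE).sub (integrable_const δ)
  have hMi : ∀ n, Integrable (maxSum T f n) μ := fun n =>
    Integrable.of_bound (measurable_maxSum hT.measurable hfm n).aestronglyMeasurable (1 * n)
      (ae_of_all _ fun ω => by
        rw [Real.norm_of_nonneg (maxSum_nonneg _ _ _ _)]
        exact maxSum_le zero_le_one hf1 n ω)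
  have key : ∀ n, μ {ω | 0 < maxSum T f n ω} ≤ ENNReal.ofReal (μ.real E / δ) := by
    intro n
    set A := {ω | 0 < maxSum T f n ω} with hA
    have hAm : MeasurableSet A :=
      measurableSet_lt measurable_const (measurable_maxSum hT.measurable hfm n)
    have h1 : ∀ ω ∈ A, maxSum T f n ω - maxSum T f n (T ω) ≤ f ω := by
      intro ω hω
      have h := maxSum_le_succ T f n ω
      have hpos : 0 < maxSum T f n ω := hω
      rw [maxSum] at h
      rcases le_max_iff.1 h with h | h <;> linarith
    have h2 : ∫ ω, (maxSum T f n ω - maxSum T f n (T ω)) ∂μ = 0 := by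
      have hcomp : ∫ ω, maxSum T f n (T ω) ∂μ = ∫ ω, maxSum T f n ω ∂μ := by
        conv_rhs => rw [← hT.map_eq]
        rw [integral_map hT.measurable.aemeasurable
          (by rw [hT.map_eq]; exact (hMi n).aestronglyMeasurable)]
      have hi : Integrable (fun ω => maxSum T f n (T ω)) μ :=
        hT.integrable_comp_of_integrable (hMi n)
      rw [integral_sub (hMi n) hi, hcomp, sub_self]
    have h3 : 0 ≤ ∫ ω in A, f ω ∂μ := by
      rw [← integral_indicator hAm, ← h2]
      refine integral_mono ((hMi n).sub (hT.integrable_comp_of_integrable (hMi n)))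
        (hfi.indicator hAm) fun ω => ?_
      by_cases hω : ω ∈ A
      · simpa [Set.indicator_of_mem hω] using h1 ω hω
      · have h0 : maxSum T f n ω ≤ 0 := not_lt.1 hω
        have := maxSum_nonneg T f n (T ω)
        simp only [Set.indicator_of_notMem hω]
        linarith
    have h4 : ∫ ω in A, f ω ∂μ ≤ μ.real E - δ * μ.real A := by
      rw [integral_sub ((integrable_const (1 : ℝ)).indicator hE).integrableOn
        (integrable_const δ).integrableOn]
      rw [integral_indicator hE, setIntegral_const, setIntegral_const]
      simp only [measureReal_restrict_apply hE, smul_eq_mul, mul_one]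
      have : μ.real (E ∩ A) ≤ μ.real E := measureReal_mono inter_subset_left
      linarith [mul_comm δ (μ.real A)]
    rw [← ofReal_measureReal]
    apply ENNReal.ofReal_le_ofReal
    rw [le_div_iff₀ hδ]
    linarith
  have hsub : maxBad T E δ ⊆ ⋃ n, {ω | 0 < maxSum T f n ω} := by
    rintro ω ⟨n, hn⟩
    refine mem_iUnion.2 ⟨n, ?_⟩
    refine lt_of_lt_of_le ?_ (sum_le_maxSum T f n ω)
    simp only [hf, Finset.sum_sub_distrib, Finset.sum_const, Finset.card_range, nsmul_eq_mul]
    linarith [mul_comm δ (n : ℝ)]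
  refine (measure_mono hsub).trans ?_
  have hmono : Monotone fun n => {ω | 0 < maxSum T f n ω} :=
    monotone_nat_of_le_succ fun n ω hω => lt_of_lt_of_le hω (maxSum_le_succ T f n ω)
  rw [hmono.measure_iUnion]
  exact iSup_le key

lemma measurableSet_maxBad {T : Ω → Ω} (hT : Measurable T) {E : Set Ω} (hE : MeasurableSet E)
    (δ : ℝ) : MeasurableSet (maxBad T E δ) := by
  have : maxBad T E δ = ⋃ n : ℕ,
      {ω | δ * n < ∑ i ∈ Finset.range n, E.indicator (fun _ => (1 : ℝ)) (T^[i] ω)} := by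
    ext ω; simp [maxBad]
  rw [this]
  exact MeasurableSet.iUnion fun n => measurableSet_lt measurable_const
    (Finset.measurable_fun_sum _ fun i _ => (measurable_const.indicator hE).comp (hT.iterate i))

end Maximal

end MaximalInequality

section SkewShift

/-- Sequences of base four digits. -/
abbrev Digits := ℕ → Fin 4

/-- The left shift. -/
def shift (f : Digits) : Digits := fun k => f (k + 1)

/-- Prepending a digit. -/
def cons (d : Fin 4) (f : Digits) : Digits
  | 0 => d
  | k + 1 => f k

@[simp] lemma cons_zero (d : Fin 4) (f : Digits) : cons d f 0 = d := rfl

@[simp] lemma shift_cons (d : Fin 4) (f : Digits) : shift (cons d f) = f := rfl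

@[simp] lemma cons_shift (f : Digits) : cons (f 0) (shift f) = f := by
  funext k; cases k <;> rfl

lemma continuous_shift : Continuous shift := continuous_pi fun k => continuous_apply (k + 1)

lemma continuous_cons : Continuous fun q : Fin 4 × Digits => cons q.1 q.2 := by
  refine continuous_pi fun k => ?_
  cases k with
  | zero => exact continuous_fst
  | succ k => exact (continuous_apply k).comp continuous_snd

/-- The integer with base four digits `f 0, …, f (n - 1)`, most significant digit first. -/
def idx : ℕ → Digits → ℕ
  | 0, _ => 0
  | n + 1, f => (f 0 : ℕ) * 4 ^ n + idx n (shift f)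

lemma idx_lt (n : ℕ) (f : Digits) : idx n f < 4 ^ n := by
  induction n generalizing f with
  | zero => simp [idx]
  | succ n ih =>
    have h1 := ih (shift f)
    have h2 : (f 0 : ℕ) ≤ 3 := by omega
    have h3 : (f 0 : ℕ) * 4 ^ n ≤ 3 * 4 ^ n := Nat.mul_le_mul_right _ h2
    rw [idx, pow_succ]; omega

lemma idx_succ_eq_iff (n : ℕ) (f g : Digits) :
    idx (n + 1) g = idx (n + 1) f ↔ g 0 = f 0 ∧ idx n (shift g) = idx n (shift f) := by
  refine ⟨fun h => ?_, fun ⟨h1, h2⟩ => by rw [idx, idx, h1, h2]⟩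
  have hf := idx_lt n (shift f)
  have hg := idx_lt n (shift g)
  rw [idx, idx] at h
  have h0 : (g 0 : ℕ) = f 0 := by
    have := congrArg (· / 4 ^ n) h
    simpa [Nat.mul_add_div, Nat.add_div_of_dvd_right, Nat.div_eq_of_lt hf, Nat.div_eq_of_lt hg,
      mul_comm] using this
  refine ⟨Fin.ext h0, ?_⟩
  rw [h0] at h; omega

lemma idx_eq_of_succ (n : ℕ) (f g : Digits) (h : idx (n + 1) g = idx (n + 1) f) :
    idx n g = idx n f := by
  induction n generalizing f g with
  | zero => rfl
  | succ n ih =>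
    rw [idx_succ_eq_iff] at h ⊢
    exact ⟨h.1, ih _ _ h.2⟩

lemma measurable_shift : Measurable shift := continuous_shift.measurable

lemma measurable_idx (n : ℕ) : Measurable (idx n) := by
  induction n with
  | zero => exact measurable_const
  | succ n ih =>
    have h0 : Measurable fun f : Digits => (f 0 : ℕ) :=
      (Measurable.of_discrete (f := fun d : Fin 4 => (d : ℕ))).comp (measurable_pi_apply 0)
    exact (h0.mul_const _).add (ih.comp measurable_shift)

variable {Y : Type*}

/-- The invertible skew shift on `Y × Digits` induced by an identification `Fin 4 × Y ≃ Y`: the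
first digit of the future is moved into the first coordinate. -/
def skew (e : Fin 4 × Y ≃ Y) : Equiv.Perm (Y × Digits) where
  toFun ω := (e (ω.2 0, ω.1), shift ω.2)
  invFun ω := ((e.symm ω.1).2, cons (e.symm ω.1).1 ω.2)
  left_inv ω := by simp
  right_inv ω := by simp

/-- The permutation of `Y × Digits` acting by `τ` on the first coordinate. -/
def base (τ : Equiv.Perm Y) : Equiv.Perm (Y × Digits) := τ.prodCongr (Equiv.refl _)

lemma skew_apply (e : Fin 4 × Y ≃ Y) (y : Y) (f : Digits) :
    skew e (y, f) = (e (f 0, y), shift f) := rfl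

lemma base_apply (τ : Equiv.Perm Y) (y : Y) (f : Digits) : base τ (y, f) = (τ y, f) := rfl

lemma base_pow_apply (τ : Equiv.Perm Y) (k : ℕ) (ω : Y × Digits) :
    (base τ ^ k) ω = ((τ ^ k) ω.1, ω.2) := by
  induction k with
  | zero => rfl
  | succ k ih => rw [pow_succ', Equiv.Perm.mul_apply, ih, base_apply, pow_succ']; rfl

lemma commute_skew_base {e : Fin 4 × Y ≃ Y} {τ : Equiv.Perm Y}
    (h : ∀ d y, e (d, τ y) = τ (e (d, y))) : Commute (skew e) (base τ) := by
  ext1 ⟨y, f⟩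
  simp [skew_apply, base_apply, h]

section Measure

variable [MeasurableSpace Y] {e : Fin 4 × Y ≃ Y} {τ : Equiv.Perm Y}

lemma measurable_skew (he : Measurable e) : Measurable (skew e) :=
  (he.comp (((measurable_pi_apply 0).comp measurable_snd).prodMk measurable_fst)).prodMk
    (measurable_shift.comp measurable_snd)

lemma measurable_skew_inv (he : Measurable e.symm) :
    Measurable ((skew e)⁻¹ : Equiv.Perm (Y × Digits)) :=
  (measurable_snd.comp (he.comp measurable_fst)).prodMk
    (continuous_cons.measurable.comp ((measurable_fst.comp (he.comp measurable_fst)).prodMk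
      measurable_snd))

lemma measurable_base (hτ : Measurable τ) : Measurable (base τ) :=
  (hτ.comp measurable_fst).prodMk measurable_snd

variable {P : Measure (Y × Digits)}

lemma ae_of_ae_fst {q : Y → Prop} (h : ∀ᵐ y ∂P.fst, q y) : ∀ᵐ ω ∂P, q ω.1 :=
  ae_of_ae_map measurable_fst.aemeasurable h

variable [IsProbabilityMeasure P]

lemma measure_eq_lintegral_condKernel {S : Set (Y × Digits)} (hS : MeasurableSet S) :
    P S = ∫⁻ y, P.condKernel y (Prod.mk y ⁻¹' S) ∂P.fst := by
  conv_lhs => rw [← P.disintegrate P.condKernel]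
  exact Measure.compProd_apply hS

lemma lintegral_eq_lintegral_condKernel {g : Y × Digits → ℝ≥0∞} (hg : Measurable g) :
    ∫⁻ ω, g ω ∂P = ∫⁻ y, ∫⁻ f, g (y, f) ∂P.condKernel y ∂P.fst := by
  conv_lhs => rw [← P.disintegrate P.condKernel]
  exact Measure.lintegral_compProd hg

lemma ae_condKernel_of_ae {q : Y × Digits → Prop} (h : ∀ᵐ ω ∂P, q ω) :
    ∀ᵐ y ∂P.fst, ∀ᵐ f ∂P.condKernel y, q (y, f) := by
  rw [← P.disintegrate P.condKernel] at h
  exact Measure.ae_ae_of_ae_compProd h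

lemma ae_of_ae_ae_condKernel {q : Y × Digits → Prop} (hq : MeasurableSet {ω | q ω})
    (h : ∀ᵐ y ∂P.fst, ∀ᵐ f ∂P.condKernel y, q (y, f)) : ∀ᵐ ω ∂P, q ω := by
  rw [← P.disintegrate P.condKernel]
  exact Measure.ae_compProd_of_ae_ae hq h

/-- The conditional measures of a skew-shift invariant measure are consistent along the tree of
futures. -/
theorem condKernel_cons (he : Measurable e) (hes : Measurable e.symm)
    (hT : MeasurePreserving (skew e) P P) (d : Fin 4) {B : Set Digits} (hB : MeasurableSet B) :
    ∀ᵐ y ∂P.fst, P.condKernel y {f | f 0 = d ∧ shift f ∈ B} =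
      P.condKernel y {f | f 0 = d} * P.condKernel (e (d, y)) B := by
  have hd : MeasurableSet {f : Digits | f 0 = d} :=
    measurableSet_eq_fun (measurable_pi_apply 0) measurable_const
  have hdB : MeasurableSet {f : Digits | f 0 = d ∧ shift f ∈ B} :=
    hd.inter (measurable_shift hB)
  have hed : Measurable fun y => e (d, y) := he.comp (measurable_const.prodMk measurable_id)
  have hh : Measurable fun y => P.condKernel y B := P.condKernel.measurable_coe hB
  refine ae_eq_of_forall_setLIntegral_eq_of_sigmaFinite (P.condKernel.measurable_coe hdB)
    ((P.condKernel.measurable_coe hd).mul (hh.comp hed)) fun E hE _ => ?_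
  set Q : Set Y := {y | (e.symm y).1 = d ∧ (e.symm y).2 ∈ E} with hQ
  have hQm : MeasurableSet Q :=
    ((measurable_fst.comp hes) (measurableSet_singleton d)).inter ((measurable_snd.comp hes) hE)
  have h1 : ∫⁻ y in E, P.condKernel y {f | f 0 = d ∧ shift f ∈ B} ∂P.fst =
      P (Q ×ˢ B) := by
    rw [← hT.measure_preimage (hQm.prod hB).nullMeasurableSet,
      measure_eq_lintegral_condKernel ((measurable_skew he) (hQm.prod hB)),
      ← lintegral_indicator hE]
    refine lintegral_congr fun y => ?_
    by_cases hy : y ∈ E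
    · rw [indicator_of_mem hy]
      congr 1
      ext f
      simp [skew_apply, hQ, hy]
    · rw [indicator_of_notMem hy]
      have : Prod.mk y ⁻¹' (skew e ⁻¹' Q ×ˢ B) = ∅ := by
        ext f; simp [skew_apply, hQ, hy]
      rw [this, measure_empty]
  have h2 : P (Q ×ˢ B) = ∫⁻ y, Q.indicator (fun y => P.condKernel y B) y ∂P.fst := by
    rw [measure_eq_lintegral_condKernel (hQm.prod hB)]
    refine lintegral_congr fun y => ?_
    by_cases hy : y ∈ Q
    · rw [indicator_of_mem hy, mk_preimage_prod_right hy]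
    · rw [indicator_of_notMem hy, mk_preimage_prod_right_eq_empty hy, measure_empty]
  have hGm : Measurable (Q.indicator fun y => P.condKernel y B) := hh.indicator hQm
  have h3 : ∫⁻ y, Q.indicator (fun y => P.condKernel y B) y ∂P.fst =
      ∫⁻ ω, Q.indicator (fun y => P.condKernel y B) (skew e ω).1 ∂P := by
    rw [Measure.fst, lintegral_map hGm measurable_fst]
    exact (hT.lintegral_comp (hGm.comp measurable_fst)).symm
  have hGT : Measurable fun ω => Q.indicator (fun y => P.condKernel y B) (skew e ω).1 :=
    hGm.comp (measurable_fst.comp (measurable_skew he))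
  rw [h1, h2, h3, lintegral_eq_lintegral_condKernel hGT, ← lintegral_indicator hE]
  refine lintegral_congr fun y => ?_
  have h4 : ∀ f : Digits, Q.indicator (fun y => P.condKernel y B) (skew e (y, f)).1 =
      {f : Digits | f 0 = d}.indicator
        (fun _ => E.indicator (fun y => P.condKernel (e (d, y)) B) y) f := by
    intro f
    by_cases hf : f 0 = d <;> by_cases hy : y ∈ E <;> simp [indicator, skew_apply, hQ, hf, hy]
  simp_rw [h4]
  rw [lintegral_indicator_const hd]
  by_cases hy : y ∈ E <;> simp [hy, mul_comm]

/-- The conditional measures are unchanged by a measure preserving map acting on the base only. -/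
theorem condKernel_base (hτ : Measurable τ) (hτs : Measurable τ.symm)
    (hP : MeasurePreserving (base τ) P P) :
    ∀ᵐ y ∂P.fst, P.condKernel (τ y) = P.condKernel y := by
  have hfst : MeasurePreserving τ P.fst P.fst := by
    refine ⟨hτ, ?_⟩
    conv_rhs => rw [← hP.map_eq]
    rw [Measure.fst, Measure.fst, Measure.map_map hτ measurable_fst,
      Measure.map_map measurable_fst hP.measurable]
    rfl
  have h : P = P.fst ⊗ₘ (P.condKernel.comap τ hτ) := by
    ext S hS
    rw [Measure.compProd_apply hS]
    have hS' : MeasurableSet (base τ.symm ⁻¹' S) := (measurable_base hτs) hS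
    have h1 : P S = P (base τ.symm ⁻¹' S) := by
      rw [← hP.measure_preimage hS'.nullMeasurableSet]
      congr 1
      ext ⟨y, f⟩
      simp [base_apply]
    rw [h1, measure_eq_lintegral_condKernel hS', ← hfst.lintegral_comp]
    · refine lintegral_congr fun y => ?_
      rw [Kernel.comap_apply]
      congr 1
      ext f
      simp [base_apply]
    · exact Kernel.measurable_kernel_prodMk_left hS'
  filter_upwards [eq_condKernel_of_measure_eq_compProd (P.condKernel.comap τ hτ) h] with y hy
  rwa [Kernel.comap_apply] at hy

end Measure

end SkewShift

section ConditionalAtoms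

variable {Y : Type*} [MeasurableSpace Y]

/-- The first digit of the future is almost surely determined by the base point. -/
def Predictable (P : Measure (Y × Digits)) : Prop :=
  ∃ Q : Fin 4 → Set Y, (∀ d, MeasurableSet (Q d)) ∧ Pairwise (Function.onFun Disjoint Q) ∧
    ∀ᵐ ω ∂P, ω.1 ∈ Q (ω.2 0)

/-- The conditional mass of the cylinder of length `n` around a future. -/
noncomputable def cylMass (P : Measure (Y × Digits)) [IsFiniteMeasure P] (n : ℕ)
    (ω : Y × Digits) : ℝ≥0∞ :=
  P.condKernel ω.1 {g | idx n g = idx n ω.2}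

/-- The limit of the conditional masses of the cylinders around a future. -/
noncomputable def atomMass (P : Measure (Y × Digits)) [IsFiniteMeasure P] (ω : Y × Digits) :
    ℝ≥0∞ :=
  ⨅ n, cylMass P n ω

/-- The base points whose conditional measure gives mass at most `1/16` to every cylinder of
length `n`. -/
def spread (P : Measure (Y × Digits)) [IsFiniteMeasure P] (n : ℕ) : Set Y :=
  {y | ∀ j, P.condKernel y {g | idx n g = j} ≤ 1 / 16}

variable {P : Measure (Y × Digits)} [IsProbabilityMeasure P]

lemma measurableSet_idx_eq (n j : ℕ) : MeasurableSet {g : Digits | idx n g = j} :=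
  measurableSet_eq_fun (measurable_idx n) measurable_const

lemma measurable_cylMass (n : ℕ) : Measurable (cylMass P n) := by
  have : Measurable fun q : Y × ℕ => P.condKernel q.1 {g | idx n g = q.2} :=
    measurable_from_prod_countable_left fun j => P.condKernel.measurable_coe
      (measurableSet_idx_eq n j)
  exact this.comp (measurable_fst.prodMk ((measurable_idx n).comp measurable_snd))

lemma measurable_atomMass : Measurable (atomMass P) :=
  Measurable.iInf fun n => measurable_cylMass n

lemma cylMass_succ_le (n : ℕ) (ω : Y × Digits) : cylMass P (n + 1) ω ≤ cylMass P n ω :=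
  measure_mono fun g hg => idx_eq_of_succ n ω.2 g hg

lemma antitone_cylMass (ω : Y × Digits) : Antitone fun n => cylMass P n ω :=
  antitone_nat_of_succ_le fun n => cylMass_succ_le n ω

lemma cylMass_le_one (n : ℕ) (ω : Y × Digits) : cylMass P n ω ≤ 1 := prob_le_one

lemma atomMass_le_one (ω : Y × Digits) : atomMass P ω ≤ 1 :=
  (iInf_le _ 0).trans (cylMass_le_one 0 ω)

lemma measurableSet_spread (n : ℕ) : MeasurableSet (spread P n) := by
  have : spread P n = ⋂ j, {y | P.condKernel y {g | idx n g = j} ≤ 1 / 16} := by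
    ext y; simp [spread]
  rw [this]
  exact MeasurableSet.iInter fun j =>
    measurableSet_le (P.condKernel.measurable_coe (measurableSet_idx_eq n j)) measurable_const

lemma monotone_spread : Monotone (spread P) := by
  refine monotone_nat_of_le_succ fun n y hy j => ?_
  by_cases h : ∃ f, idx (n + 1) f = j
  · obtain ⟨f, rfl⟩ := h
    exact (measure_mono fun g hg => idx_eq_of_succ n f g hg).trans (hy (idx n f))
  · have : {g | idx (n + 1) g = j} = ∅ := by
      ext g; simp only [mem_ofPred_eq, mem_empty_iff_false, iff_false]; exact fun hg => h ⟨g, hg⟩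
    rw [this, measure_empty]; exact zero_le

variable {e : Fin 4 × Y ≃ Y}

lemma cylMass_succ (he : Measurable e) (hes : Measurable e.symm)
    (hT : MeasurePreserving (skew e) P P) :
    ∀ᵐ ω ∂P, ∀ n, cylMass P (n + 1) ω = cylMass P 1 ω * cylMass P n (skew e ω) := by
  have h : ∀ᵐ y ∂P.fst, ∀ (n : ℕ) (j : ℕ) (d : Fin 4),
      P.condKernel y {f | f 0 = d ∧ shift f ∈ {g | idx n g = j}} =
      P.condKernel y {f | f 0 = d} * P.condKernel (e (d, y)) {g | idx n g = j} := by
    simp_rw [ae_all_iff]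
    exact fun n j d => condKernel_cons he hes hT d (measurableSet_idx_eq n j)
  filter_upwards [ae_of_ae_fst h] with ω hω n
  have h1 := hω n (idx n (shift ω.2)) (ω.2 0)
  simp only [cylMass, idx_succ_eq_iff]
  rw [show skew e ω = (e (ω.2 0, ω.1), shift ω.2) from rfl]
  simpa [idx] using h1

lemma atomMass_skew (he : Measurable e) (hes : Measurable e.symm)
    (hT : MeasurePreserving (skew e) P P) :
    ∀ᵐ ω ∂P, atomMass P (skew e ω) = atomMass P ω := by
  have hle : ∀ᵐ ω ∂P, atomMass P ω ≤ atomMass P (skew e ω) := by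
    filter_upwards [cylMass_succ he hes hT] with ω hω
    refine le_iInf fun n => (iInf_le _ (n + 1)).trans ?_
    rw [hω n]
    exact mul_le_of_le_one_left zero_le (cylMass_le_one 1 ω)
  have hfin : ∫⁻ ω, atomMass P ω ∂P ≠ ∞ := by
    refine ne_top_of_le_ne_top ENNReal.one_ne_top ?_
    calc ∫⁻ ω, atomMass P ω ∂P ≤ ∫⁻ _, 1 ∂P := lintegral_mono atomMass_le_one
      _ = 1 := by simp
  have := ae_eq_of_ae_le_of_lintegral_le hle hfin
    (measurable_atomMass.comp (measurable_skew he)).aemeasurable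
    (hT.lintegral_comp measurable_atomMass).le
  filter_upwards [this] with ω hω using hω.symm

lemma cylMass_eq_one (he : Measurable e) (hes : Measurable e.symm)
    (hT : MeasurePreserving (skew e) P P) :
    ∀ᵐ ω ∂P, atomMass P ω ≠ 0 → ∀ n, cylMass P n ω = 1 := by
  have h1 : ∀ᵐ ω ∂P, atomMass P ω ≠ 0 → cylMass P 1 ω = 1 := by
    filter_upwards [cylMass_succ he hes hT, atomMass_skew he hes hT] with ω hω hinv h0
    refine le_antisymm (cylMass_le_one 1 ω) ?_
    have hle : atomMass P ω ≤ cylMass P 1 ω * atomMass P ω := by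
      conv_rhs => rw [← hinv, atomMass]
      rw [ENNReal.mul_iInf_of_ne]
      · exact le_iInf fun n => (iInf_le _ (n + 1)).trans (hω n).le
      · exact fun h => h0 (le_antisymm ((iInf_le _ 1).trans h.le) zero_le)
      · exact ne_top_of_le_ne_top ENNReal.one_ne_top (cylMass_le_one 1 ω)
    have htop : atomMass P ω ≠ ∞ := ne_top_of_le_ne_top ENNReal.one_ne_top (atomMass_le_one ω)
    by_contra hlt
    have := ENNReal.mul_lt_mul_left h0 htop (not_le.1 hlt)
    rw [one_mul] at this
    exact absurd hle (not_le.2 this)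
  have h : ∀ n, ∀ᵐ ω ∂P, atomMass P ω ≠ 0 → cylMass P n ω = 1 := by
    intro n
    induction n with
    | zero => exact ae_of_all _ fun ω _ => by simp [cylMass, idx]
    | succ n ih =>
      filter_upwards [cylMass_succ he hes hT, atomMass_skew he hes hT, h1,
        hT.quasiMeasurePreserving.ae ih] with ω h1 h2 h3 h4 h0
      rw [h1 n, h3 h0, h4 (h2 ▸ h0), one_mul]
  filter_upwards [ae_all_iff.2 h] with ω hω h0 n using hω n h0

lemma measure_atomMass_eq_zero_pos (he : Measurable e) (hes : Measurable e.symm)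
    (hT : MeasurePreserving (skew e) P P) (hP : ¬ Predictable P) :
    P {ω | atomMass P ω = 0} ≠ 0 := by
  intro h0
  apply hP
  have hm : ∀ d : Fin 4, MeasurableSet {g : Digits | g 0 = d} := fun d =>
    measurableSet_eq_fun (measurable_pi_apply 0) measurable_const
  refine ⟨fun d => {y | P.condKernel y {g | g 0 = d} = 1}, fun d =>
    measurableSet_eq_fun (P.condKernel.measurable_coe (hm d)) measurable_const, ?_, ?_⟩
  · intro d d' hdd
    refine Set.disjoint_left.2 fun y hy hy' => ?_
    have hdisj : Disjoint {g : Digits | g 0 = d} {g | g 0 = d'} :=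
      Set.disjoint_left.2 fun g hg hg' => hdd (hg.symm.trans hg')
    have := measure_union (μ := P.condKernel y) hdisj (hm d')
    simp only [mem_ofPred_eq] at hy hy'
    rw [hy, hy'] at this
    have hle : P.condKernel y ({g | g 0 = d} ∪ {g | g 0 = d'}) ≤ 1 := prob_le_one
    rw [this] at hle
    norm_num at hle
  · have h0' : ∀ᵐ ω ∂P, atomMass P ω ≠ 0 := by rw [ae_iff]; simpa using h0
    filter_upwards [h0', cylMass_eq_one he hes hT] with ω h1 h2
    have := h2 h1 1
    simp only [cylMass, idx_succ_eq_iff] at this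
    simpa [idx] using this

lemma exists_mem_spread {y : Y}
    (h : ∀ᵐ f ∂P.condKernel y, atomMass P (y, f) = 0) : ∃ n, y ∈ spread P n := by
  have hlim : Tendsto (fun n => ∫⁻ f, cylMass P n (y, f) ∂P.condKernel y) atTop (𝓝 0) := by
    have h1 : Tendsto (fun n => ∫⁻ f, cylMass P n (y, f) ∂P.condKernel y) atTop
        (𝓝 (∫⁻ f, atomMass P (y, f) ∂P.condKernel y)) := by
      refine tendsto_lintegral_of_dominated_convergence (fun _ => 1)
        (fun n => (measurable_cylMass n).comp measurable_prodMk_left)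
        (fun n => ae_of_all _ fun f => cylMass_le_one n _) (by simp)
        (ae_of_all _ fun f => tendsto_atTop_iInf (antitone_cylMass _))
    rwa [lintegral_congr_ae h, lintegral_zero] at h1
  obtain ⟨n, hn⟩ := (hlim.eventually (gt_mem_nhds
    (show (0 : ℝ≥0∞) < 1 / 16 * (1 / 16) by simp))).exists
  refine ⟨n, fun j => ?_⟩
  by_contra hj
  have hj : 1 / 16 < P.condKernel y {g | idx n g = j} := not_le.1 hj
  refine absurd hn (not_lt.2 ?_)
  calc (1 / 16 * (1 / 16) : ℝ≥0∞)
      ≤ P.condKernel y {g | idx n g = j} * P.condKernel y {g | idx n g = j} := by gcongr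
    _ = ∫⁻ _ in {g | idx n g = j}, P.condKernel y {g | idx n g = j} ∂P.condKernel y := by
        rw [setLIntegral_const]
    _ = ∫⁻ f in {g | idx n g = j}, cylMass P n (y, f) ∂P.condKernel y := by
        refine setLIntegral_congr_fun (measurableSet_idx_eq n j) fun f hf => ?_
        simp only [mem_ofPred_eq] at hf
        simp only [cylMass, hf]
    _ ≤ ∫⁻ f, cylMass P n (y, f) ∂P.condKernel y := setLIntegral_le_lintegral _ _

lemma ae_exists_mem_spread (he : Measurable e) (hes : Measurable e.symm)
    (hT : MeasurePreserving (skew e) P P) :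
    ∀ᵐ ω ∂P, atomMass P ω = 0 → ∃ n, ω.1 ∈ spread P n := by
  have hset : MeasurableSet {ω : Y × Digits | atomMass P ω = 0 → ∃ n, ω.1 ∈ spread P n} := by
    have : {ω : Y × Digits | atomMass P ω = 0 → ∃ n, ω.1 ∈ spread P n} =
        {ω | atomMass P ω = 0}ᶜ ∪ Prod.fst ⁻¹' (⋃ n, spread P n) := by
      ext ω; simp [imp_iff_not_or]
    rw [this]
    exact (measurableSet_eq_fun measurable_atomMass measurable_const).compl.union
      (measurable_fst (MeasurableSet.iUnion fun n => measurableSet_spread n))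
  refine ae_of_ae_ae_condKernel hset ?_
  filter_upwards [ae_condKernel_of_ae (cylMass_eq_one he hes hT)] with y hy
  by_cases h : ∀ᵐ f ∂P.condKernel y, atomMass P (y, f) = 0
  · exact ae_of_all _ fun f _ => exists_mem_spread h
  · obtain ⟨g, hg0, hg⟩ : ∃ g, atomMass P (y, g) ≠ 0 ∧ ∀ n, cylMass P n (y, g) = 1 := by
      by_contra hno
      push Not at hno
      apply h
      filter_upwards [hy] with f hf
      by_contra hf0
      obtain ⟨n, hn⟩ := hno f hf0
      exact hn (hf hf0 n)
    have hall : ∀ᵐ f ∂P.condKernel y, ∀ n, idx n f = idx n g := by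
      refine ae_all_iff.2 fun n => ?_
      have := hg n
      rw [cylMass] at this
      exact (prob_compl_eq_zero_iff (measurableSet_idx_eq n _)).2 this
    filter_upwards [hall] with f hf h0
    refine absurd ?_ hg0
    rw [← h0]
    simp only [atomMass, cylMass, hf]

/-- An invariant measure which is not predictable has, on an almost invariant set of positive
measure, conditional measures which are uniformly spread up to small measure. -/
theorem exists_spread (he : Measurable e) (hes : Measurable e.symm)
    (hT : MeasurePreserving (skew e) P P) (hP : ¬ Predictable P) :
    ∃ N : Set (Y × Digits), MeasurableSet N ∧ P N ≠ 0 ∧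
      (∀ᵐ ω ∂P, skew e ω ∈ N → ω ∈ N) ∧
      ∀ η : ℝ≥0∞, 0 < η → ∃ n, P (N \ Prod.fst ⁻¹' spread P n) ≤ η := by
  have hN : MeasurableSet {ω | atomMass P ω = 0} :=
    measurableSet_eq_fun measurable_atomMass measurable_const
  refine ⟨{ω | atomMass P ω = 0}, hN, measure_atomMass_eq_zero_pos he hes hT hP, ?_, ?_⟩
  · filter_upwards [atomMass_skew he hes hT] with ω hω h
    rwa [hω] at h
  · intro η hη
    have hlim : Tendsto (fun n => P ({ω | atomMass P ω = 0} \ Prod.fst ⁻¹' spread P n)) atTop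
        (𝓝 (P (⋂ n, {ω | atomMass P ω = 0} \ Prod.fst ⁻¹' spread P n))) := by
      refine tendsto_measure_iInter_atTop
        (fun n => (hN.diff (measurable_fst (measurableSet_spread n))).nullMeasurableSet) ?_
        ⟨0, measure_ne_top _ _⟩
      exact fun n m hnm => sdiff_subset_sdiff_right (preimage_mono (monotone_spread hnm))
    have h0 : P (⋂ n, {ω | atomMass P ω = 0} \ Prod.fst ⁻¹' spread P n) = 0 := by
      refine measure_mono_null (fun ω hω => ?_) (ae_iff.1 (ae_exists_mem_spread he hes hT))
      simp only [mem_iInter, Set.mem_sdiff, mem_preimage, mem_ofPred_eq] at hω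
      simp only [mem_ofPred_eq]
      push Not
      exact ⟨(hω 0).1, fun n => (hω n).2⟩
    rw [h0] at hlim
    exact (hlim.eventually (ge_mem_nhds hη)).exists

end ConditionalAtoms

section Ancestors

variable {Y : Type*}

/-- Removing the most recent digit from the base point. -/
def back (e : Fin 4 × Y ≃ Y) (y : Y) : Y := (e.symm y).2

lemma fst_skew_inv_pow (e : Fin 4 × Y ≃ Y) (m : ℕ) (ω : Y × Digits) :
    (((skew e)⁻¹ ^ m) ω).1 = (back e)^[m] ω.1 := by
  induction m generalizing ω with
  | zero => rfl
  | succ m ih => rw [pow_succ, Equiv.Perm.mul_apply, ih, Function.iterate_succ_apply]; rfl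

lemma back_iterate_skew_pow (e : Fin 4 × Y ≃ Y) (m : ℕ) (ω : Y × Digits) :
    (back e)^[m] (((skew e) ^ m) ω).1 = ω.1 := by
  rw [← fst_skew_inv_pow, ← Equiv.Perm.mul_apply, inv_pow, inv_mul_cancel, Equiv.Perm.one_apply]

lemma back_iterate_comm {e : Fin 4 × Y ≃ Y} {τ : Equiv.Perm Y}
    (h : ∀ d y, e (d, τ y) = τ (e (d, y))) (k m : ℕ) (y : Y) :
    (back e)^[m] ((τ ^ k) y) = (τ ^ k) ((back e)^[m] y) := by
  have h1 : ∀ y, back e (τ y) = τ (back e y) := by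
    intro y
    have := h (e.symm y).1 (e.symm y).2
    rw [Prod.mk.eta, Equiv.apply_symm_apply] at this
    rw [back, ← this, Equiv.symm_apply_apply, back]
  have h2 : Function.Commute (back e) τ := h1
  have := (h2.iterate_left m).iterate_right k
  rw [← Equiv.Perm.iterate_eq_pow]
  exact this y

section Doob

variable [MeasurableSpace Y] {e : Fin 4 × Y ≃ Y}

lemma measurePreserving_skew_pow {P : Measure (Y × Digits)}
    (hT : MeasurePreserving (skew e) P P) (m : ℕ) :
    MeasurePreserving ⇑(skew e ^ m) P P := by
  rw [← Equiv.Perm.iterate_eq_pow]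
  exact hT.iterate m

variable {P : Measure (Y × Digits)} [IsProbabilityMeasure P] {Z : Set (Y × Digits)}

/-- The base points from which at least one eighth of the futures leave `Z` at time `m`. -/
def treeBad (P : Measure (Y × Digits)) [IsFiniteMeasure P] (e : Fin 4 × Y ≃ Y)
    (Z : Set (Y × Digits)) (m : ℕ) : Set Y :=
  {y | 1 / 8 < P.condKernel y {f | (skew e ^ m) (y, f) ∉ Z}}

/-- The base points for which some ancestor has too many descendants outside `Z`. -/
def ancestorBad (P : Measure (Y × Digits)) [IsFiniteMeasure P] (e : Fin 4 × Y ≃ Y)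
    (Z : Set (Y × Digits)) : Set Y :=
  {y | ∃ m, (back e)^[m] y ∈ treeBad P e Z m}

lemma measurable_skew_pow (he : Measurable e) (m : ℕ) : Measurable ⇑(skew e ^ m) := by
  rw [← Equiv.Perm.iterate_eq_pow]
  exact (measurable_skew he).iterate m

lemma measurable_back (hes : Measurable e.symm) : Measurable (back e) := measurable_snd.comp hes

lemma measurableSet_treeBad (he : Measurable e) (hZ : MeasurableSet Z) (m : ℕ) :
    MeasurableSet (treeBad P e Z m) :=
  measurableSet_lt measurable_const
    (Kernel.measurable_kernel_prodMk_left ((measurable_skew_pow he m) hZ.compl))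

lemma measurableSet_ancestorBad (he : Measurable e) (hes : Measurable e.symm)
    (hZ : MeasurableSet Z) : MeasurableSet (ancestorBad P e Z) := by
  have : ancestorBad P e Z = ⋃ m, (back e)^[m] ⁻¹' treeBad P e Z m := by
    ext y; simp [ancestorBad]
  rw [this]
  exact MeasurableSet.iUnion fun m => ((measurable_back hes).iterate m)
    (measurableSet_treeBad he hZ m)

/-- The maximal inequality along the ancestors of a point. -/
theorem measure_ancestorBad_le (he : Measurable e) (hes : Measurable e.symm)
    (hT : MeasurePreserving (skew e) P P) (hZ : MeasurableSet Z) :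
    P (Prod.fst ⁻¹' ancestorBad P e Z) ≤ 8 * P Zᶜ := by
  have key : ∀ M : ℕ,
      P (Prod.fst ⁻¹' {y | ∃ m ≤ M, (back e)^[m] y ∈ treeBad P e Z m}) ≤ 8 * P Zᶜ := by
    intro M
    set H : ℕ → Set Y := fun m => {y | y ∈ treeBad P e Z m ∧
      ∀ k, m < k → k ≤ M → (back e)^[k - m] y ∉ treeBad P e Z k} with hH
    have hHm : ∀ m, MeasurableSet (H m) := by
      intro m
      have : H m = treeBad P e Z m ∩ ⋂ k, ⋂ (_ : m < k), ⋂ (_ : k ≤ M),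
          ((back e)^[k - m] ⁻¹' treeBad P e Z k)ᶜ := by
        ext y; simp [hH]
      rw [this]
      refine (measurableSet_treeBad he hZ m).inter (MeasurableSet.iInter fun k =>
        MeasurableSet.iInter fun _ => MeasurableSet.iInter fun _ => ?_)
      exact (((measurable_back hes).iterate _) (measurableSet_treeBad he hZ k)).compl
    set E : ℕ → Set (Y × Digits) := fun m => {ω | (back e)^[m] ω.1 ∈ H m} with hE
    have hEm : ∀ m, MeasurableSet (E m) := fun m =>
      (((measurable_back hes).iterate m).comp measurable_fst) (hHm m)
    have hEZ : ∀ m, P (E m) ≤ 8 * P (E m ∩ Zᶜ) := by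
      intro m
      have h1 : P (E m) = ∫⁻ y, (H m).indicator 1 y ∂P.fst := by
        rw [← (measurePreserving_skew_pow hT m).measure_preimage (hEm m).nullMeasurableSet,
          lintegral_indicator_one (hHm m), Measure.fst_apply (hHm m)]
        congr 1
        ext ω
        simp only [hE, mem_preimage, mem_ofPred_eq, back_iterate_skew_pow]
      have hm2 := (hEm m).inter hZ.compl
      rw [h1, ← (measurePreserving_skew_pow hT m).measure_preimage hm2.nullMeasurableSet,
        measure_eq_lintegral_condKernel (measurable_skew_pow he m hm2),
        ← lintegral_const_mul _ (Kernel.measurable_kernel_prodMk_left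
          (measurable_skew_pow he m hm2))]
      refine lintegral_mono fun y => ?_
      by_cases hy : y ∈ H m
      · rw [indicator_of_mem hy, Pi.one_apply]
        have hsub : Prod.mk y ⁻¹' (⇑(skew e ^ m) ⁻¹' (E m ∩ Zᶜ)) =
            {f | (skew e ^ m) (y, f) ∉ Z} := by
          ext f
          simp only [hE, mem_preimage, mem_inter_iff, mem_ofPred_eq, back_iterate_skew_pow, hy,
            true_and, mem_compl_iff]
        rw [hsub]
        have h8 : (1 / 8 : ℝ≥0∞) ≤ P.condKernel y {f | (skew e ^ m) (y, f) ∉ Z} := hy.1.le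
        calc (1 : ℝ≥0∞) = 8 * (1 / 8) := by
              rw [one_div, ENNReal.mul_inv_cancel (by norm_num) (by norm_num)]
          _ ≤ _ := by gcongr
      · rw [indicator_of_notMem hy]; exact zero_le
    have hdisj : Set.PairwiseDisjoint (↑(Finset.range (M + 1))) fun m => E m ∩ Zᶜ := by
      have aux : ∀ m k, m < k → k ≤ M → Disjoint (E m ∩ Zᶜ) (E k ∩ Zᶜ) := by
        intro m k hmk hk
        refine Set.disjoint_left.2 fun ω h1 h2 => ?_
        have h3 := h1.1.2 k hmk hk
        rw [← Function.iterate_add_apply, Nat.sub_add_cancel hmk.le] at h3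
        exact h3 h2.1.1
      intro m hm k hk hmk
      simp only [Finset.coe_range, mem_Iio] at hm hk
      rcases lt_or_gt_of_ne hmk with h | h
      · exact aux m k h (by omega)
      · exact (aux k m h (by omega)).symm
    have hcover : Prod.fst ⁻¹' {y | ∃ m ≤ M, (back e)^[m] y ∈ treeBad P e Z m} ⊆
        ⋃ m ∈ Finset.range (M + 1), E m := by
      rintro ω ⟨m, hm, hmb⟩
      classical
      obtain ⟨l, hl, hmax⟩ := Finset.exists_max_image
        ((Finset.range (M + 1)).filter fun m => (back e)^[m] ω.1 ∈ treeBad P e Z m) id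
        ⟨m, by simp [hmb]; omega⟩
      simp only [Finset.mem_filter, Finset.mem_range, id] at hl hmax
      refine mem_biUnion (Finset.mem_coe.2 (Finset.mem_range.2 hl.1)) ⟨hl.2, fun k hlk hk hkb => ?_⟩
      rw [← Function.iterate_add_apply, Nat.sub_add_cancel hlk.le] at hkb
      exact absurd (hmax k ⟨by omega, hkb⟩) (not_le.2 hlk)
    calc _ ≤ P (⋃ m ∈ Finset.range (M + 1), E m) := measure_mono hcover
      _ ≤ ∑ m ∈ Finset.range (M + 1), P (E m) := measure_biUnion_finset_le _ _
      _ ≤ ∑ m ∈ Finset.range (M + 1), 8 * P (E m ∩ Zᶜ) := Finset.sum_le_sum fun m _ => hEZ m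
      _ = 8 * P (⋃ m ∈ Finset.range (M + 1), (E m ∩ Zᶜ)) := by
          rw [← Finset.mul_sum, measure_biUnion_finset hdisj fun m _ => (hEm m).inter hZ.compl]
      _ ≤ 8 * P Zᶜ := by
          gcongr
          exact iUnion₂_subset fun m _ => inter_subset_right
  have hU : (Prod.fst ⁻¹' ancestorBad P e Z : Set (Y × Digits)) =
      ⋃ M : ℕ, Prod.fst ⁻¹' {y | ∃ m ≤ M, (back e)^[m] y ∈ treeBad P e Z m} := by
    ext ω
    simp only [ancestorBad, mem_preimage, mem_ofPred_eq, mem_iUnion]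
    exact ⟨fun ⟨m, hm⟩ => ⟨m, m, le_rfl, hm⟩, fun ⟨_, m, _, hm⟩ => ⟨m, hm⟩⟩
  rw [hU, Monotone.measure_iUnion]
  · exact iSup_le key
  · exact fun M M' h ω ⟨m, hm, hb⟩ => ⟨m, hm.trans h, hb⟩

end Doob

end Ancestors

section Branching

open Classical in
lemma card_filter_le_of_notMem_maxBad {Ω : Type*} {T : Ω → Ω} {E : Set Ω} {δ : ℝ} {ω : Ω}
    (h : ω ∉ maxBad T E δ) (n : ℕ) :
    (((Finset.range n).filter fun i => T^[i] ω ∈ E).card : ℝ) ≤ δ * n := by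
  simp only [maxBad, mem_ofPred_eq, not_exists, not_lt] at h
  refine le_trans (le_of_eq ?_) (h n)
  rw [Finset.card_filter]
  push_cast
  exact Finset.sum_congr rfl fun i _ => by simp [indicator]

open Classical in
/-- A point outside the exceptional sets of the two maximal inequalities visits `E` rarely along
any injective family of times in a window around zero. -/
lemma card_filter_zpow_le {Ω : Type*} {T : Equiv.Perm Ω} {E : Set Ω} {δ : ℝ} {ω : Ω}
    (h1 : ω ∉ maxBad T E δ) (h2 : ω ∉ maxBad (T⁻¹ : Equiv.Perm Ω) E δ) {I : Finset ℕ} {t : ℕ → ℤ}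
    (ht : InjOn t I) {a b : ℕ} (hta : ∀ m ∈ I, -(a : ℤ) ≤ t m) (htb : ∀ m ∈ I, t m ≤ b) :
    ((I.filter fun m => (T ^ t m) ω ∈ E).card : ℝ) ≤ δ * (a + b + 2) := by
  have c1 := card_filter_le_of_notMem_maxBad h1 (b + 1)
  have c2 := card_filter_le_of_notMem_maxBad h2 (a + 1)
  set A := (Finset.range (b + 1)).filter fun i => T^[i] ω ∈ E
  set B := (Finset.range (a + 1)).filter fun i => (T⁻¹ : Equiv.Perm Ω)^[i] ω ∈ E
  have hcard : (I.filter fun m => (T ^ t m) ω ∈ E).card ≤ A.card + B.card := by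
    rw [← Finset.card_image_of_injOn
      (s := I.filter fun m => (T ^ t m) ω ∈ E) (f := t)
      (ht.mono (Finset.coe_subset.2 (Finset.filter_subset _ _)))]
    have hsub : (I.filter fun m => (T ^ t m) ω ∈ E).image t ⊆
        A.image (fun i : ℕ => (i : ℤ)) ∪ B.image fun i : ℕ => -(i : ℤ) := by
      intro z hz
      obtain ⟨m, hm, rfl⟩ := Finset.mem_image.1 hz
      rw [Finset.mem_filter] at hm
      have ha := hta m hm.1
      have hb := htb m hm.1
      rw [Finset.mem_union, Finset.mem_image, Finset.mem_image]
      rcases le_total 0 (t m) with h0 | h0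
      · left
        refine ⟨(t m).toNat, ?_, Int.toNat_of_nonneg h0⟩
        simp only [A, Finset.mem_filter, Finset.mem_range]
        refine ⟨by omega, ?_⟩
        rw [Equiv.Perm.iterate_eq_pow, ← zpow_natCast, Int.toNat_of_nonneg h0]
        exact hm.2
      · right
        have h0' : 0 ≤ -t m := by omega
        refine ⟨(-t m).toNat, ?_, by rw [Int.toNat_of_nonneg h0', neg_neg]⟩
        simp only [B, Finset.mem_filter, Finset.mem_range]
        refine ⟨by omega, ?_⟩
        rw [Equiv.Perm.iterate_eq_pow, ← zpow_natCast, Int.toNat_of_nonneg h0', inv_zpow',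
          neg_neg]
        exact hm.2
    calc _ ≤ _ := Finset.card_le_card hsub
      _ ≤ _ := Finset.card_union_le _ _
      _ ≤ _ := add_le_add Finset.card_image_le Finset.card_image_le
  have : ((I.filter fun m => (T ^ t m) ω ∈ E).card : ℝ) ≤ A.card + B.card := by
    exact_mod_cast hcard
  push_cast at c1 c2
  linarith

/-- If a probability measure gives mass at most `1/16` to every cylinder of length `n`, then a set
of mass at least `3/4` contains three points in well separated cylinders. -/
lemma exists_three_separated (μ : Measure Digits) [IsProbabilityMeasure μ] {n : ℕ}
    (h : ∀ j, μ {g | idx n g = j} ≤ 1 / 16) {B : Set Digits} (hB : μ B ≤ 1 / 4) :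
    ∃ f : Fin 3 → Digits, (∀ i, f i ∉ B) ∧
      ∀ i j, i ≠ j → 2 ≤ |(idx n (f i) : ℤ) - idx n (f j)| := by
  set near : Digits → Set Digits := fun f => {g | |(idx n g : ℤ) - idx n f| ≤ 1} with hnear
  have hn : ∀ f, μ (near f) ≤ 3 / 16 := by
    intro f
    have hsub : near f ⊆ {g | idx n g = idx n f - 1} ∪ {g | idx n g = idx n f} ∪
        {g | idx n g = idx n f + 1} := by
      intro g hg
      simp only [hnear, mem_ofPred_eq, abs_le] at hg
      simp only [mem_union, mem_ofPred_eq]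
      omega
    calc μ (near f) ≤ _ := measure_mono hsub
      _ ≤ μ {g | idx n g = idx n f - 1} + μ {g | idx n g = idx n f} +
          μ {g | idx n g = idx n f + 1} :=
          (measure_union_le _ _).trans (add_le_add_left (measure_union_le _ _) _)
      _ ≤ 1 / 16 + 1 / 16 + 1 / 16 := by gcongr <;> exact h _
      _ = 3 / 16 := by
          rw [← ENNReal.add_div, ← ENNReal.add_div]; norm_num
  have pick : ∀ S : Set Digits, μ S < 1 → ∃ f, f ∉ S := by
    intro S hS
    by_contra hno
    push Not at hno
    rw [eq_univ_of_forall hno, measure_univ] at hS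
    exact lt_irrefl _ hS
  have num : (1 / 4 + 3 / 16 + 3 / 16 : ℝ≥0∞) < 1 := by
    rw [show (1 / 4 : ℝ≥0∞) = 4 / 16 by
      rw [ENNReal.div_eq_div_iff] <;> norm_num, ← ENNReal.add_div, ← ENNReal.add_div]
    apply ENNReal.div_lt_of_lt_mul
    norm_num
  have h1 : μ (B ∪ ∅ ∪ ∅) < 1 := by
    rw [union_empty, union_empty]
    exact lt_of_le_of_lt (hB.trans (by rw [add_assoc]; exact le_self_add)) num
  obtain ⟨f, hf⟩ := pick _ h1
  have h2 : μ (B ∪ near f ∪ ∅) < 1 := by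
    rw [union_empty]
    refine lt_of_le_of_lt ((measure_union_le _ _).trans (add_le_add hB (hn f))) ?_
    exact lt_of_le_of_lt le_self_add num
  obtain ⟨g, hg⟩ := pick _ h2
  have h3 : μ (B ∪ near f ∪ near g) < 1 :=
    lt_of_le_of_lt ((measure_union_le _ _).trans
      (add_le_add ((measure_union_le _ _).trans (add_le_add hB (hn f))) (hn g))) num
  obtain ⟨l, hl⟩ := pick _ h3
  simp only [mem_union, not_or, mem_empty_iff_false, not_false_eq_true, and_true, hnear,
    mem_ofPred_eq, not_le] at hf hg hl
  refine ⟨![f, g, l], fun i => ?_, fun i j hij => ?_⟩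
  · fin_cases i
    exacts [hf, hg.1, hl.1.1]
  · have e1 := abs_sub_comm (idx n g : ℤ) (idx n f)
    have e2 := abs_sub_comm (idx n l : ℤ) (idx n f)
    have e3 := abs_sub_comm (idx n l : ℤ) (idx n g)
    fin_cases i <;> fin_cases j <;> simp at hij ⊢ <;> omega

variable {Y : Type*} [MeasurableSpace Y] {P : Measure (Y × Digits)}
  {e : Fin 4 × Y ≃ Y} {τ : Equiv.Perm Y}

lemma measurePreserving_skew_inv (hes : Measurable e.symm)
    (hT : MeasurePreserving (skew e) P P) :
    MeasurePreserving ⇑((skew e)⁻¹ : Equiv.Perm (Y × Digits)) P P := by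
  refine ⟨measurable_skew_inv hes, ?_⟩
  conv_lhs => rw [← hT.map_eq]
  rw [Measure.map_map (measurable_skew_inv hes) hT.measurable]
  have : ⇑((skew e)⁻¹ : Equiv.Perm (Y × Digits)) ∘ ⇑(skew e) = id := by
    funext ω; simp
  rw [this, Measure.map_id]

variable [IsProbabilityMeasure P]

lemma ae_condKernel_base_pow (hes : Measurable e.symm) (hτ : Measurable τ)
    (hτs : Measurable τ.symm) (hT : MeasurePreserving (skew e) P P)
    (hP : MeasurePreserving (base τ) P P) :
    ∀ᵐ ω ∂P, ∀ m k : ℕ, P.condKernel ((τ ^ k) ((back e)^[m] ω.1)) =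
      P.condKernel ((back e)^[m] ω.1) := by
  have h0 : ∀ᵐ ω ∂P, P.condKernel (τ ω.1) = P.condKernel ω.1 :=
    ae_of_ae_fst (condKernel_base hτ hτs hP)
  have h1 : ∀ᵐ ω ∂P, ∀ k : ℕ, P.condKernel ((τ ^ k) ω.1) = P.condKernel ω.1 := by
    have : ∀ᵐ ω ∂P, ∀ k : ℕ, P.condKernel (τ ((τ ^ k) ω.1)) = P.condKernel ((τ ^ k) ω.1) := by
      refine ae_all_iff.2 fun k => ?_
      have hk : MeasurePreserving ⇑(base τ ^ k) P P := by
        rw [← Equiv.Perm.iterate_eq_pow]; exact hP.iterate k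
      filter_upwards [hk.quasiMeasurePreserving.ae h0] with ω hω
      rwa [base_pow_apply] at hω
    filter_upwards [this] with ω hω k
    induction k with
    | zero => rfl
    | succ k ih => rw [pow_succ', Equiv.Perm.mul_apply, hω, ih]
  refine ae_all_iff.2 fun m => ?_
  have hm : MeasurePreserving ⇑((skew e)⁻¹ ^ m : Equiv.Perm (Y × Digits)) P P := by
    rw [← Equiv.Perm.iterate_eq_pow]; exact (measurePreserving_skew_inv hes hT).iterate m
  filter_upwards [hm.quasiMeasurePreserving.ae h1] with ω hω k
  rw [← fst_skew_inv_pow]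
  exact hω k

/-- The conclusion of the ergodic argument at a point `ω` which returns after `k` steps of `τ`:
at some scale `m` of any admissible family of times there are three well separated futures which
are simultaneously good for the ancestor of `ω` and for its image. -/
def HasSeparatedFutures (e : Fin 4 × Y ≃ Y) (τ : Equiv.Perm Y) (Z : Set (Y × Digits)) (n k : ℕ)
    (ω : Y × Digits) : Prop :=
  ∀ (m₀ t₀ : ℕ) (t : ℕ → ℤ), 1 ≤ t₀ → InjOn t (Icc m₀ (2 * m₀ + t₀ / 2)) →
    (∀ m ∈ Icc m₀ (2 * m₀ + t₀ / 2), -(2 * m₀ : ℤ) ≤ t m ∧ t m ≤ t₀ ∧ 0 ≤ t m + m) →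
    ∃ m ∈ Icc m₀ (2 * m₀ + t₀ / 2), ∃ f : Fin 3 → Digits,
      (∀ i j, i ≠ j → 2 ≤ |(idx n (f i) : ℤ) - idx n (f j)|) ∧
      ∀ i, (skew e ^ (t m + m).toNat) ((back e)^[m] ω.1, f i) ∈ Z ∧
        (skew e ^ (t m + m).toNat) ((τ ^ k) ((back e)^[m] ω.1), f i) ∈ Z

lemma not_mem_treeBad_of_zpow {Z : Set (Y × Digits)} {ω : Y × Digits} {t : ℤ} {m : ℕ}
    (htm : 0 ≤ t + m) (h : ((skew e ^ t) ω).1 ∉ ancestorBad P e Z) :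
    (back e)^[m] ω.1 ∉ treeBad P e Z (t + m).toNat := by
  intro hb
  refine h ⟨(t + m).toNat, ?_⟩
  have : (back e)^[(t + m).toNat] ((skew e ^ t) ω).1 = (back e)^[m] ω.1 := by
    rw [← fst_skew_inv_pow, ← fst_skew_inv_pow, ← Equiv.Perm.mul_apply]
    congr 2
    rw [← zpow_natCast, ← zpow_natCast, Int.toNat_of_nonneg htm, inv_zpow', inv_zpow', ← zpow_add]
    congr 1
    ring
  rwa [this]

theorem hasSeparatedFutures {Z : Set (Y × Digits)} {n k : ℕ}
    (hcomm : ∀ d y, e (d, τ y) = τ (e (d, y))) {N : Set (Y × Digits)} {ω : Y × Digits}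
    (hN : ∀ m : ℕ, ((skew e)⁻¹ ^ m) ω ∈ N)
    (hker : ∀ m k : ℕ, P.condKernel ((τ ^ k) ((back e)^[m] ω.1)) =
      P.condKernel ((back e)^[m] ω.1))
    (h1 : ω ∉ maxBad (skew e) (Prod.fst ⁻¹' ancestorBad P e Z) (1 / 20))
    (h2 : ω ∉ maxBad ((skew e)⁻¹ : Equiv.Perm (Y × Digits))
      (Prod.fst ⁻¹' ancestorBad P e Z) (1 / 20))
    (h3 : ω ∉ maxBad ((skew e)⁻¹ : Equiv.Perm (Y × Digits))
      (N \ Prod.fst ⁻¹' spread P n) (1 / 20))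
    (h4 : (base τ ^ k) ω ∉ maxBad (skew e) (Prod.fst ⁻¹' ancestorBad P e Z) (1 / 20))
    (h5 : (base τ ^ k) ω ∉ maxBad ((skew e)⁻¹ : Equiv.Perm (Y × Digits))
      (Prod.fst ⁻¹' ancestorBad P e Z) (1 / 20)) :
    HasSeparatedFutures e τ Z n k ω := by
  classical
  intro m₀ t₀ t ht₀ hinj ht
  set M := 2 * m₀ + t₀ / 2 with hM
  set I := Finset.Icc m₀ M with hI
  have hIc : (I : Set ℕ) = Icc m₀ M := Finset.coe_Icc _ _
  have hmI : ∀ m, m ∈ I ↔ m ∈ Icc m₀ M := fun m => by rw [hI, Finset.mem_Icc, mem_Icc]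
  rw [← hIc] at hinj
  have hta : ∀ m ∈ I, -((2 * m₀ : ℕ) : ℤ) ≤ t m := fun m hm => by
    have := (ht m ((hmI m).1 hm)).1; push_cast; exact this
  have htb : ∀ m ∈ I, t m ≤ (t₀ : ℤ) := fun m hm => (ht m ((hmI m).1 hm)).2.1
  have c1 := card_filter_zpow_le h1 h2 hinj hta htb
  have c2 := card_filter_zpow_le h4 h5 hinj hta htb
  have c3 := card_filter_le_of_notMem_maxBad h3 (M + 1)
  have c3' : ((I.filter fun m => (back e)^[m] ω.1 ∉ spread P n).card : ℝ) ≤ 1 / 20 * (M + 1) := by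
    push_cast at c3
    refine le_trans ?_ c3
    norm_cast
    refine Finset.card_le_card fun m hm => ?_
    rw [Finset.mem_filter] at hm ⊢
    have hm1 := (hmI m).1 hm.1
    refine ⟨Finset.mem_range.2 (Nat.lt_succ_of_le hm1.2), ?_⟩
    refine ⟨hN m, ?_⟩
    rw [mem_preimage, fst_skew_inv_pow]
    exact hm.2
  obtain ⟨m, hm, hms, hm1, hm2⟩ : ∃ m ∈ I, (back e)^[m] ω.1 ∈ spread P n ∧
      (skew e ^ t m) ω ∉ Prod.fst ⁻¹' ancestorBad P e Z ∧
      (skew e ^ t m) ((base τ ^ k) ω) ∉ Prod.fst ⁻¹' ancestorBad P e Z := by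
    by_contra hno
    push Not at hno
    have hsub : I ⊆ (I.filter fun m => (back e)^[m] ω.1 ∉ spread P n) ∪
        ((I.filter fun m => (skew e ^ t m) ω ∈ Prod.fst ⁻¹' ancestorBad P e Z) ∪
        I.filter fun m => (skew e ^ t m) ((base τ ^ k) ω) ∈ Prod.fst ⁻¹' ancestorBad P e Z) := by
      intro m hm
      simp only [Finset.mem_union, Finset.mem_filter]
      have := hno m hm
      tauto
    have hc := (Finset.card_le_card hsub).trans ((Finset.card_union_le _ _).trans
      (Nat.add_le_add_left (Finset.card_union_le _ _) _))
    have hIcard : I.card = M + 1 - m₀ := Nat.card_Icc _ _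
    have hIcard' : (I.card : ℝ) = M + 1 - m₀ := by
      rw [hIcard, Nat.cast_sub (by omega)]; push_cast; ring
    have hMr : (t₀ : ℝ) - 1 ≤ 2 * (M - 2 * m₀) := by
      have : t₀ ≤ 2 * (t₀ / 2) + 1 := by omega
      have h' : (t₀ : ℝ) ≤ 2 * ((t₀ / 2 : ℕ) : ℝ) + 1 := by exact_mod_cast this
      rw [hM]; push_cast at h' ⊢; linarith
    have hcr : (I.card : ℝ) ≤ _ := Nat.cast_le.2 hc
    push_cast at hcr c1 c2
    have hm0 : (0 : ℝ) ≤ m₀ := Nat.cast_nonneg _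
    have ht1 : (1 : ℝ) ≤ t₀ := by exact_mod_cast ht₀
    rw [hIcard'] at hcr
    linarith
  have hmI' := (hmI m).1 hm
  have htm := (ht m hmI').2.2
  have b1 := not_mem_treeBad_of_zpow htm hm1
  have b2 := not_mem_treeBad_of_zpow htm hm2
  rw [base_pow_apply, back_iterate_comm hcomm] at b2
  simp only [treeBad, mem_ofPred_eq, not_lt] at b1 b2
  rw [hker m k] at b2
  obtain ⟨f, hf, hsep⟩ := exists_three_separated (P.condKernel ((back e)^[m] ω.1)) hms
    (B := {f | (skew e ^ (t m + m).toNat) ((back e)^[m] ω.1, f) ∉ Z} ∪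
      {f | (skew e ^ (t m + m).toNat) ((τ ^ k) ((back e)^[m] ω.1), f) ∉ Z}) (by
      refine (measure_union_le _ _).trans ((add_le_add b1 b2).trans (le_of_eq ?_))
      rw [← ENNReal.add_div, ENNReal.div_eq_div_iff] <;> norm_num)
  refine ⟨m, hmI', f, hsep, fun i => ?_⟩
  have := hf i
  simp only [mem_union, mem_ofPred_eq, not_or, not_not] at this
  exact this

/-- For an unpredictable measure invariant under the skew shift and under a commuting map of the
base, a set of positive measure consists of points with separated futures in any prescribed set
`Z` of sufficiently large measure. -/
theorem exists_hasSeparatedFutures (he : Measurable e) (hes : Measurable e.symm)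
    (hτ : Measurable τ) (hτs : Measurable τ.symm) (hcomm : ∀ d y, e (d, τ y) = τ (e (d, y)))
    (hT : MeasurePreserving (skew e) P P) (hTp : MeasurePreserving (base τ) P P)
    (hP : ¬ Predictable P) :
    ∃ η : ℝ, 0 < η ∧ ∃ n : ℕ, ∀ Z : Set (Y × Digits), MeasurableSet Z → P.real Zᶜ ≤ η →
      ∃ W : Set (Y × Digits), MeasurableSet W ∧ P W ≠ 0 ∧
        ∀ ω ∈ W, ∀ k : ℕ, (base τ ^ k) ω ∈ W → HasSeparatedFutures e τ Z n k ω := by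
  obtain ⟨N, hNm, hN0, hNinv, hNs⟩ := exists_spread he hes hT hP
  have hν : 0 < P.real N := ENNReal.toReal_pos hN0 (measure_ne_top _ _)
  refine ⟨P.real N / 1000, by positivity, ?_⟩
  obtain ⟨n, hn⟩ := hNs (ENNReal.ofReal (P.real N / 1000)) (by simpa using by positivity)
  refine ⟨n, fun Z hZ hZη => ?_⟩
  have hTi := measurePreserving_skew_inv hes hT
  set A : Set (Y × Digits) := Prod.fst ⁻¹' ancestorBad P e Z with hA
  have hAm : MeasurableSet A := measurable_fst (measurableSet_ancestorBad he hes hZ)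
  have hAle : P.real A ≤ 8 * P.real Zᶜ := by
    have := measure_ancestorBad_le he hes hT hZ
    have h' := ENNReal.toReal_mono (ENNReal.mul_ne_top (by norm_num) (measure_ne_top _ _)) this
    rwa [ENNReal.toReal_mul, ENNReal.toReal_ofNat] at h'
  set C := N \ Prod.fst ⁻¹' spread P n with hC
  have hCm : MeasurableSet C := hNm.diff (measurable_fst (measurableSet_spread n))
  have hCle : P.real C ≤ P.real N / 1000 := by
    have h' := ENNReal.toReal_mono ENNReal.ofReal_ne_top hn
    rwa [ENNReal.toReal_ofReal (by positivity)] at h'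
  have hmax : ∀ {S : Y × Digits → Y × Digits} (_ : MeasurePreserving S P P) {E : Set (Y × Digits)}
      (_ : MeasurableSet E), P.real (maxBad S E (1 / 20)) ≤ 20 * P.real E := by
    intro S hS E hE
    have := ENNReal.toReal_mono ENNReal.ofReal_ne_top
      (measure_maxBad_le hS hE (δ := 1 / 20) (by norm_num))
    rw [ENNReal.toReal_ofReal (by positivity)] at this
    refine this.trans (le_of_eq ?_)
    field_simp
  set B := maxBad (skew e) A (1 / 20) ∪
    (maxBad ((skew e)⁻¹ : Equiv.Perm (Y × Digits)) A (1 / 20) ∪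
    maxBad ((skew e)⁻¹ : Equiv.Perm (Y × Digits)) C (1 / 20)) with hB
  have hBle : P.real B < P.real N := by
    have h1 := hmax hT hAm
    have h2 := hmax hTi hAm
    have h3 := hmax hTi hCm
    have h4 := (measureReal_union_le (μ := P) (maxBad (skew e) A (1 / 20))
      (maxBad ((skew e)⁻¹ : Equiv.Perm (Y × Digits)) A (1 / 20) ∪
      maxBad ((skew e)⁻¹ : Equiv.Perm (Y × Digits)) C (1 / 20)))
    have h5 := (measureReal_union_le (μ := P)
      (maxBad ((skew e)⁻¹ : Equiv.Perm (Y × Digits)) A (1 / 20))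
      (maxBad ((skew e)⁻¹ : Equiv.Perm (Y × Digits)) C (1 / 20)))
    linarith
  have hBm : MeasurableSet B := (measurableSet_maxBad hT.measurable hAm _).union
    ((measurableSet_maxBad hTi.measurable hAm _).union
      (measurableSet_maxBad hTi.measurable hCm _))
  have hNback : ∀ᵐ ω ∂P, ω ∈ N → ∀ m : ℕ, ((skew e)⁻¹ ^ m) ω ∈ N := by
    have h1 : ∀ᵐ ω ∂P, ω ∈ N → (skew e)⁻¹ ω ∈ N := by
      filter_upwards [hTi.quasiMeasurePreserving.ae hNinv] with ω hω h
      refine hω ?_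
      rwa [← Equiv.Perm.mul_apply, mul_inv_cancel, Equiv.Perm.one_apply]
    have h2 : ∀ᵐ ω ∂P, ∀ m : ℕ, ((skew e)⁻¹ ^ m) ω ∈ N → (skew e)⁻¹ (((skew e)⁻¹ ^ m) ω) ∈ N := by
      refine ae_all_iff.2 fun m => ?_
      have hm : MeasurePreserving ⇑((skew e)⁻¹ ^ m : Equiv.Perm (Y × Digits)) P P := by
        rw [← Equiv.Perm.iterate_eq_pow]; exact hTi.iterate m
      exact hm.quasiMeasurePreserving.ae h1
    filter_upwards [h2] with ω hω h0 m
    induction m with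
    | zero => exact h0
    | succ m ih => rw [pow_succ', Equiv.Perm.mul_apply]; exact hω m ih
  have hgood := hNback.and (ae_condKernel_base_pow hes hτ hτs hT hTp)
  obtain ⟨D, hDsub, hDm, hD0⟩ := exists_measurable_superset_of_null (ae_iff.1 hgood)
  refine ⟨(N \ B) \ D, (hNm.diff hBm).diff hDm, ?_, ?_⟩
  · rw [measure_sdiff_null hD0]
    intro h0
    have := measureReal_mono (μ := P) (show N ⊆ (N \ B) ∪ B from fun x hx => by
      by_cases h : x ∈ B
      · exact Or.inr h
      · exact Or.inl ⟨hx, h⟩)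
    have h' := measureReal_union_le (μ := P) (N \ B) B
    rw [measureReal_def, measureReal_def, h0, ENNReal.toReal_zero] at h'
    simp only [measureReal_def] at *
    linarith
  · rintro ω ⟨⟨hωN, hωB⟩, hωD⟩ k ⟨⟨_, hkB⟩, _⟩
    have hg : (ω ∈ N → ∀ m : ℕ, ((skew e)⁻¹ ^ m) ω ∈ N) ∧ ∀ m k : ℕ,
        P.condKernel ((τ ^ k) ((back e)^[m] ω.1)) = P.condKernel ((back e)^[m] ω.1) := by
      by_contra hno
      exact hωD (hDsub hno)
    simp only [hB, mem_union, not_or] at hωB hkB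
    exact hasSeparatedFutures hcomm (hg.1 hωN) hg.2 hωB.1 hωB.2.1 hωB.2.2 hkB.1 hkB.2.1

end Branching

section Prediction

variable {Y : Type*} (e : Fin 4 × Y ≃ Y)

/-- The points whose first future digit is not predicted by the family `O`. -/
def missSet (O : Fin 4 → Set Y) : Set (Y × Digits) := {ω | ω.1 ∉ O (ω.2 0)}

/-- The number of wrong predictions in the first `T` steps of an orbit of the skew shift. -/
noncomputable def missCount (O : Fin 4 → Set Y) (T : ℕ) (ω : Y × Digits) : ℝ :=
  ∑ t ∈ Finset.range T, (missSet O).indicator 1 ((skew e ^ t) ω)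

lemma missCount_succ (O : Fin 4 → Set Y) (T : ℕ) (ω : Y × Digits) :
    missCount e O (T + 1) ω =
      (missSet O).indicator 1 ω + missCount e O T (skew e ω) := by
  rw [missCount, Finset.sum_range_succ', add_comm, missCount]
  simp [pow_succ]

lemma sum_exp_neg_indicator_missSet_le {O : Fin 4 → Set Y}
    (hO : Pairwise (Function.onFun Disjoint O)) {c : ℝ} (hc : 0 ≤ c) (y : Y) (f : Fin 4 → Digits)
    (hf : ∀ d, f d 0 = d) :
    ∑ d, Real.exp (-c * (missSet O).indicator 1 (y, f d)) ≤ 1 + 3 * Real.exp (-c) := by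
  classical
  have hle : Real.exp (-c) ≤ 1 := Real.exp_le_one_iff.2 (by linarith)
  have hval : ∀ d, Real.exp (-c * (missSet O).indicator 1 (y, f d)) =
      if y ∈ O d then 1 else Real.exp (-c) := fun d => by
    by_cases h : y ∈ O d
    · have : (y, f d) ∉ missSet O := by simpa [missSet, hf d] using h
      simp [this, h]
    · have : (y, f d) ∈ missSet O := by simpa [missSet, hf d] using h
      simp [this, h]
  simp_rw [hval]
  by_cases hy : ∃ d, y ∈ O d
  · obtain ⟨d, hd⟩ := hy
    have hne : ∀ d', d' ≠ d → y ∉ O d' := fun d' hd' h' =>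
      Set.disjoint_left.1 (hO hd') h' hd
    rw [← Finset.add_sum_erase _ _ (Finset.mem_univ d), if_pos hd,
      Finset.sum_congr rfl (fun d' hd' => if_neg (hne d' (Finset.ne_of_mem_erase hd')))]
    simp
  · push Not at hy
    simp only [hy, if_false]
    simp
    linarith

theorem sum_exp_neg_missCount_le {O : Fin 4 → Set Y}
    (hO : Pairwise (Function.onFun Disjoint O)) {c : ℝ} (hc : 0 ≤ c) (T : ℕ) (y : Y)
    (F : Finset Digits) (hF : InjOn (idx T) F) :
    ∑ f ∈ F, Real.exp (-c * missCount e O T (y, f)) ≤ (1 + 3 * Real.exp (-c)) ^ T := by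
  classical
  induction T generalizing y F with
  | zero =>
    have : F.card ≤ 1 := Finset.card_le_one.2 fun a ha b hb => hF ha hb rfl
    simpa [missCount] using (by exact_mod_cast this : (F.card : ℝ) ≤ 1)
  | succ T ih =>
    have h0 : ∀ d : Fin 4, ∑ f ∈ F with f 0 = d, Real.exp (-c * missCount e O (T + 1) (y, f)) ≤
        Real.exp (-c * (missSet O).indicator 1 (y, cons d 0)) *
          (1 + 3 * Real.exp (-c)) ^ T := by
      intro d
      have hinj : InjOn shift (F.filter fun f => f 0 = d : Finset Digits) := by
        intro f hf g hg h
        simp only [Finset.coe_filter, mem_ofPred_eq] at hf hg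
        exact hF hf.1 hg.1 ((idx_succ_eq_iff _ _ _).2 ⟨hf.2.trans hg.2.symm, by rw [h]⟩)
      have := ih (e (d, y)) ((F.filter fun f => f 0 = d).image shift) (by
        rintro _ hf _ hg h
        simp only [Finset.coe_image, Finset.coe_filter, mem_image, mem_ofPred_eq] at hf hg
        obtain ⟨f, hf, rfl⟩ := hf
        obtain ⟨g, hg, rfl⟩ := hg
        rw [hF hf.1 hg.1 ((idx_succ_eq_iff _ _ _).2 ⟨hf.2.trans hg.2.symm, h⟩)])
      rw [Finset.sum_image hinj] at this
      refine le_trans (le_of_eq ?_) (mul_le_mul_of_nonneg_left this (Real.exp_pos _).le)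
      rw [Finset.mul_sum]
      refine Finset.sum_congr rfl fun f hf => ?_
      have hfd : f 0 = d := (Finset.mem_filter.1 hf).2
      rw [missCount_succ, skew_apply, hfd, mul_add, Real.exp_add]
      congr 3
      by_cases h : y ∈ O d
      · rw [indicator_of_notMem, indicator_of_notMem] <;> simpa [missSet, hfd] using h
      · rw [indicator_of_mem, indicator_of_mem] <;> simp [missSet, hfd, h]
    calc ∑ f ∈ F, Real.exp (-c * missCount e O (T + 1) (y, f))
        = ∑ d, ∑ f ∈ F with f 0 = d, Real.exp (-c * missCount e O (T + 1) (y, f)) :=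
          (Finset.sum_fiberwise _ _ _).symm
      _ ≤ ∑ d, Real.exp (-c * (missSet O).indicator 1 (y, cons d 0)) *
            (1 + 3 * Real.exp (-c)) ^ T := Finset.sum_le_sum fun d _ => h0 d
      _ ≤ _ := by
          rw [← Finset.sum_mul, pow_succ']
          exact mul_le_mul_of_nonneg_right
            (sum_exp_neg_indicator_missSet_le hO hc y (fun d => cons d 0) fun d => rfl)
            (by positivity)

lemma card_mul_exp_neg_le {ι : Type*} (I : Finset ι) (x : ι → ℝ) {a : ℝ}
    (h : ∑ i ∈ I, x i ≤ I.card * a) :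
    I.card * Real.exp (-a) ≤ ∑ i ∈ I, Real.exp (-x i) := by
  have h1 : ∀ i, Real.exp (-a) * (1 + (a - x i)) ≤ Real.exp (-x i) := fun i => by
    have := Real.add_one_le_exp (a - x i)
    calc Real.exp (-a) * (1 + (a - x i)) ≤ Real.exp (-a) * Real.exp (a - x i) := by
          gcongr; linarith
      _ = Real.exp (-x i) := by rw [← Real.exp_add]; ring_nf
  calc I.card * Real.exp (-a) ≤ ∑ i ∈ I, Real.exp (-a) * (1 + (a - x i)) := by
        rw [← Finset.mul_sum, Finset.sum_add_distrib, Finset.sum_sub_distrib]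
        simp only [Finset.sum_const, nsmul_eq_mul, mul_one]
        nlinarith [Real.exp_pos (-a)]
    _ ≤ _ := Finset.sum_le_sum fun i _ => h1 i

/-- Many words cannot be predicted too well: a family of words of length `T` that is exponentially
large has, on average, a positive proportion of wrong predictions. -/
theorem card_mul_le_sum_missCount {O : Fin 4 → Set Y}
    (hO : Pairwise (Function.onFun Disjoint O)) {c h : ℝ} (hc : 0 < c)
    (hch : 3 * Real.exp (-c) ≤ h / 4) {T : ℕ} {J : Finset ℕ} (hJ : J.Nonempty) (y : ℕ → Y)
    {F : Finset Digits} (hF : InjOn (idx T) F) (hcard : Real.exp (h * T) ≤ F.card) :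
    J.card * F.card * (3 * h / (4 * c) * T) ≤
      ∑ i ∈ J ×ˢ F, missCount e O T (y i.1, i.2) := by
  have hJpos : (0 : ℝ) < J.card := by exact_mod_cast hJ.card_pos
  have hFpos : (0 : ℝ) < F.card := (Real.exp_pos _).trans_le hcard
  set M := ∑ i ∈ J ×ˢ F, missCount e O T (y i.1, i.2) with hM
  set a := c * M / (J.card * F.card) with ha
  have h1 := card_mul_exp_neg_le (J ×ˢ F) (fun i => c * missCount e O T (y i.1, i.2)) (a := a) (by
    rw [← Finset.mul_sum, ← hM, Finset.card_product, ha]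
    push_cast
    field_simp
    exact le_rfl)
  have h2 : ∑ i ∈ J ×ˢ F, Real.exp (-(c * missCount e O T (y i.1, i.2))) ≤
      J.card * (1 + 3 * Real.exp (-c)) ^ T := by
    rw [Finset.sum_product]
    refine (Finset.sum_le_card_nsmul J _ _ fun j _ => ?_).trans_eq (nsmul_eq_mul _ _)
    simpa only [neg_mul] using sum_exp_neg_missCount_le e hO hc.le T (y j) F hF
  have h3 : (1 + 3 * Real.exp (-c)) ^ T ≤ Real.exp (h / 4 * T) := by
    rw [mul_comm (h / 4), Real.exp_nat_mul]
    gcongr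
    linarith [Real.add_one_le_exp (h / 4)]
  have h4 : Real.exp (h * T + -a) ≤ Real.exp (h / 4 * T) := by
    rw [Real.exp_add]
    rw [Finset.card_product] at h1
    push_cast at h1
    have h5 := h1.trans h2
    rw [mul_assoc] at h5
    refine le_trans ?_ ((le_of_mul_le_mul_left h5 hJpos).trans h3)
    gcongr
  rw [Real.exp_le_exp, ha] at h4
  have h6 : 3 * h / 4 * T ≤ c * M / (J.card * F.card) := by linarith
  rw [le_div_iff₀ (by positivity)] at h6
  have : 3 * h / (4 * c) * T = 3 * h / 4 * T / c := by field_simp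
  rw [this, mul_div_assoc', div_le_iff₀ hc]
  linarith

end Prediction

section WeakLimits

section Limit

variable {Ω : Type*} [MeasurableSpace Ω] [TopologicalSpace Ω] [BorelSpace Ω]

lemma measurePreserving_of_tendsto [HasOuterApproxClosed Ω] {l : Filter ℕ} [NeBot l]
    {μ : ℕ → ProbabilityMeasure Ω} {P : ProbabilityMeasure Ω} (h : Tendsto μ l (𝓝 P)) {S : Ω → Ω}
    (hS : Continuous S)
    (hinv : ∀ φ : BoundedContinuousFunction Ω ℝ,
      Tendsto (fun J => ∫ x, φ (S x) ∂(μ J : Measure Ω) - ∫ x, φ x ∂(μ J : Measure Ω)) l (𝓝 0)) :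
    MeasurePreserving S (P : Measure Ω) P := by
  refine ⟨hS.measurable, ?_⟩
  have : IsProbabilityMeasure ((P : Measure Ω).map S) :=
    Measure.isProbabilityMeasure_map hS.aemeasurable
  refine ext_of_forall_integral_eq_of_IsFiniteMeasure fun φ => ?_
  rw [integral_map hS.aemeasurable φ.continuous.aestronglyMeasurable]
  have h' := ProbabilityMeasure.tendsto_iff_forall_integral_tendsto.1 h
  have h1 := (h' (φ.compContinuous ⟨S, hS⟩)).sub (h' φ)
  have h2 := tendsto_nhds_unique h1 (hinv φ)
  exact sub_eq_zero.1 h2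

lemma exists_tendsto_of_isCompact [T2Space Ω] {K : Set Ω} (hK : IsCompact K)
    (μ : ℕ → ProbabilityMeasure Ω) (hμ : ∀ J, (μ J : Measure Ω) Kᶜ = 0) :
    ∃ P : ProbabilityMeasure Ω, (P : Measure Ω) Kᶜ = 0 ∧ ∃ l : Filter ℕ, NeBot l ∧ l ≤ atTop ∧
      Tendsto μ l (𝓝 P) := by
  have hc := isCompact_setOfPred_probabilityMeasure_mass_eq_compl_isCompact_le (E := Ω)
    (u := fun _ => 0) (K := fun _ => K) tendsto_const_nhds (fun _ => hK) (Or.inr monotone_const)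
  obtain ⟨P, hP, hl⟩ := isCompact_iff_ultrafilter_le_nhds.1 hc ((hyperfilter ℕ).map μ) (by
    rw [Ultrafilter.coe_map]
    refine tendsto_principal.2 ?_
    refine Filter.Eventually.of_forall fun J n => ?_
    rw [le_zero_iff, ← ENNReal.coe_eq_zero, ProbabilityMeasure.ennreal_coeFn_eq_coeFn_toMeasure]
    exact hμ J)
  refine ⟨P, ?_, (hyperfilter ℕ : Filter ℕ), inferInstance, ?_, hl⟩
  · have := hP 0
    rwa [le_zero_iff, ← ENNReal.coe_eq_zero,
      ProbabilityMeasure.ennreal_coeFn_eq_coeFn_toMeasure] at this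
  · rw [← Nat.cofinite_eq_atTop]; exact hyperfilter_le_cofinite

end Limit

section Separation

variable {Y : Type*} [TopologicalSpace Y] [TopologicalSpace.MetrizableSpace Y]

lemma exists_pairwise_disjoint_isOpen {ι : Type*} [Finite ι] {C : ι → Set Y}
    (hC : ∀ i, IsClosed (C i)) (hd : Pairwise (Function.onFun Disjoint C)) :
    ∃ O : ι → Set Y, (∀ i, IsOpen (O i)) ∧ (∀ i, C i ⊆ O i) ∧
      Pairwise (Function.onFun Disjoint O) := by
  let := TopologicalSpace.metrizableSpaceMetric Y
  refine ⟨fun i => {y | ∀ j, j ≠ i → Metric.infEDist y (C i) < Metric.infEDist y (C j)},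
    fun i => ?_, fun i y hy j hj => ?_, fun i j hij => ?_⟩
  · simp only [ofPred_forall]
    exact isOpen_iInter_of_finite fun j => isOpen_iInter_of_finite fun _ =>
      isOpen_lt Metric.continuous_infEDist Metric.continuous_infEDist
  · rw [Metric.infEDist_zero_of_mem hy, pos_iff_ne_zero, Ne,
      ← Metric.mem_iff_infEDist_zero_of_closed (hC j)]
    exact fun h => Set.disjoint_left.1 (hd hj) h hy
  · refine Set.disjoint_left.2 fun y hi hj => ?_
    exact lt_asymm (hi j hij.symm) (hj i hij)

variable [MeasurableSpace Y] [BorelSpace Y]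

lemma isOpen_compl_missSet {O : Fin 4 → Set Y} (hO : ∀ d, IsOpen (O d)) :
    IsOpen (missSet O)ᶜ := by
  have : (missSet O)ᶜ = ⋃ d : Fin 4, (Prod.fst ⁻¹' O d ∩ {ω : Y × Digits | ω.2 0 = d}) := by
    ext ω
    simp [missSet]
  rw [this]
  refine isOpen_iUnion fun d => ((hO d).preimage continuous_fst).inter ?_
  exact (isOpen_discrete {d}).preimage
    ((continuous_apply (A := fun _ : ℕ => Fin 4) 0).comp continuous_snd)

lemma not_predictable_of_tendsto [SecondCountableTopology Y] {l : Filter ℕ} [NeBot l]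
    {μ : ℕ → ProbabilityMeasure (Y × Digits)} {P : ProbabilityMeasure (Y × Digits)}
    (h : Tendsto μ l (𝓝 P)) {η : ℝ≥0∞} (hη : η ≠ 0)
    (hmiss : ∀ O : Fin 4 → Set Y, (∀ d, IsOpen (O d)) → Pairwise (Function.onFun Disjoint O) →
      ∀ᶠ J in l, (μ J : Measure (Y × Digits)) (missSet O)ᶜ ≤ 1 - η) :
    ¬ Predictable (P : Measure (Y × Digits)) := by
  rintro ⟨Q, hQm, hQd, hQ⟩
  have hη8 : min η 1 / 8 ≠ 0 := by simp [hη]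
  have hex : ∀ d, ∃ C ⊆ Q d, IsClosed C ∧ (P : Measure (Y × Digits)).fst (Q d \ C) < min η 1 / 8 :=
    fun d => (hQm d).exists_isClosed_sdiff_lt (measure_ne_top _ _) hη8
  choose C hCQ hCc hCm using hex
  obtain ⟨O, hO, hCO, hOd⟩ := exists_pairwise_disjoint_isOpen hCc
    (fun i j hij => (hQd hij).mono (hCQ i) (hCQ j))
  have hopen := isOpen_compl_missSet hO
  have hle : (P : Measure (Y × Digits)) (missSet O) ≤ min η 1 / 2 := by
    calc (P : Measure (Y × Digits)) (missSet O)
        ≤ (P : Measure (Y × Digits)) (⋃ d, Prod.fst ⁻¹' (Q d \ C d)) := by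
          refine measure_mono_ae ?_
          filter_upwards [hQ] with ω hω hmem
          exact mem_iUnion.2 ⟨ω.2 0, hω, fun hc => hmem (hCO _ hc)⟩
      _ ≤ ∑ d, (P : Measure (Y × Digits)) (Prod.fst ⁻¹' (Q d \ C d)) :=
          measure_iUnion_fintype_le _ _
      _ ≤ ∑ _d : Fin 4, min η 1 / 8 := by
          refine Finset.sum_le_sum fun d _ => ?_
          rw [← Measure.fst_apply ((hQm d).diff (hCc d).measurableSet)]
          exact (hCm d).le
      _ = min η 1 / 2 := by
          rw [Finset.sum_const, Finset.card_univ, Fintype.card_fin, nsmul_eq_mul,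
            ← mul_div_assoc, ENNReal.div_eq_div_iff] <;> norm_num
          rw [← mul_assoc]; norm_num
  have hlim := ProbabilityMeasure.le_liminf_measure_open_of_tendsto h hopen
  have h1 : (P : Measure (Y × Digits)) (missSet O)ᶜ ≤ 1 - min η 1 := by
    refine hlim.trans (liminf_le_of_frequently_le' ?_)
    refine ((hmiss O hO hOd).mono fun J hJ => hJ.trans ?_).frequently
    exact tsub_le_tsub_left (min_le_left _ _) _
  have h2 : (1 : ℝ≥0∞) ≤ min η 1 / 2 + (1 - min η 1) := by
    have := measure_add_measure_compl (μ := (P : Measure (Y × Digits))) hopen.measurableSet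
    rw [compl_compl, measure_univ] at this
    exact this.symm.le.trans ((add_comm _ _).le.trans (add_le_add hle h1))
  have h3 : min η 1 / 2 + (1 - min η 1) < 1 := by
    have hlt : min η 1 / 2 < min η 1 := ENNReal.half_lt_self (by simp [hη])
      (ne_top_of_le_ne_top ENNReal.one_ne_top (min_le_right _ _))
    calc min η 1 / 2 + (1 - min η 1) < min η 1 + (1 - min η 1) :=
          ENNReal.add_lt_add_right (ne_top_of_le_ne_top ENNReal.one_ne_top tsub_le_self) hlt
      _ = 1 := add_tsub_cancel_of_le (min_le_right _ _)
  exact absurd (h2.trans_lt h3) (lt_irrefl _)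

end Separation

section Average

variable {Ω ι : Type*} [MeasurableSpace Ω]

/-- The uniform average of the point masses at `g i`, `i ∈ I`. -/
noncomputable def avgDirac (I : Finset ι) (g : ι → Ω) : Measure Ω :=
  (I.card : ℝ≥0∞)⁻¹ • ∑ i ∈ I, Measure.dirac (g i)

lemma isProbabilityMeasure_avgDirac {I : Finset ι} (hI : I.Nonempty) (g : ι → Ω) :
    IsProbabilityMeasure (avgDirac I g) := by
  refine ⟨?_⟩
  simp only [avgDirac, Measure.smul_apply, Measure.finsetSum_apply, measure_univ,
    Finset.sum_const, smul_eq_mul, nsmul_eq_mul, mul_one]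
  exact ENNReal.inv_mul_cancel (by simpa using hI.ne_empty) (ENNReal.natCast_ne_top _)

lemma avgDirac_apply (I : Finset ι) (g : ι → Ω) {S : Set Ω} (hS : MeasurableSet S) :
    avgDirac I g S = ENNReal.ofReal ((I.card : ℝ)⁻¹ * ∑ i ∈ I, S.indicator 1 (g i)) := by
  rw [avgDirac, Measure.smul_apply, Measure.finsetSum_apply, smul_eq_mul]
  rcases I.eq_empty_or_nonempty with rfl | hI
  · simp
  have hpos : (0 : ℝ) < I.card := by exact_mod_cast hI.card_pos
  rw [ENNReal.ofReal_mul (by positivity), ENNReal.ofReal_inv_of_pos hpos, ENNReal.ofReal_natCast,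
    ENNReal.ofReal_sum_of_nonneg fun i _ => indicator_nonneg (by simp) _]
  congr 1
  refine Finset.sum_congr rfl fun i _ => ?_
  rw [Measure.dirac_apply' _ hS]
  by_cases h : g i ∈ S <;> simp [h]

lemma integral_avgDirac [TopologicalSpace Ω] [OpensMeasurableSpace Ω]
    (I : Finset ι) (g : ι → Ω) (φ : BoundedContinuousFunction Ω ℝ) :
    ∫ x, φ x ∂avgDirac I g = (I.card : ℝ)⁻¹ * ∑ i ∈ I, φ (g i) := by
  rw [avgDirac, integral_smul_measure, integral_finsetSum_measure fun i _ => φ.integrable _]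
  simp only [ENNReal.toReal_inv, ENNReal.toReal_natCast, smul_eq_mul]
  congr 1
  exact Finset.sum_congr rfl fun i _ =>
    integral_dirac' _ _ φ.continuous.measurable.stronglyMeasurable

end Average

end WeakLimits

section InvariantMeasures

variable {Y : Type*}

lemma abs_sum_range_shift_sub_le {φ : ℕ → ℝ} {C : ℝ} (hφ : ∀ t, |φ t| ≤ C) (n : ℕ) :
    |∑ t ∈ Finset.range n, φ (t + 1) - ∑ t ∈ Finset.range n, φ t| ≤ 2 * C := by
  rw [← Finset.sum_sub_distrib, Finset.sum_range_sub]
  calc |φ n - φ 0| ≤ |φ n| + |φ 0| := abs_sub _ _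
    _ ≤ 2 * C := by linarith [hφ n, hφ 0]

/-- The point of an orbit of the action generated by the skew shift and a map of the base. -/
def orbitPoint (e : Fin 4 × Y ≃ Y) (τ : Equiv.Perm Y) (y : Y) (s : ℕ) (i : (ℕ × Digits) × ℕ) :
    Y × Digits :=
  (skew e ^ (s + i.2)) ((τ ^ i.1.1) y, i.1.2)

variable {e : Fin 4 × Y ≃ Y} {τ : Equiv.Perm Y}

lemma skew_orbitPoint (y : Y) (s j t : ℕ) (f : Digits) :
    skew e (orbitPoint e τ y s ((j, f), t)) = orbitPoint e τ y s ((j, f), t + 1) := by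
  rw [orbitPoint, orbitPoint, ← Equiv.Perm.mul_apply, ← pow_succ']
  rfl

lemma base_orbitPoint (hcomm : ∀ d y, e (d, τ y) = τ (e (d, y))) (y : Y) (s j t : ℕ)
    (f : Digits) :
    base τ (orbitPoint e τ y s ((j, f), t)) = orbitPoint e τ y s ((j + 1, f), t) := by
  rw [orbitPoint, orbitPoint, ← Equiv.Perm.mul_apply,
    ← ((commute_skew_base hcomm).pow_left _).eq, Equiv.Perm.mul_apply, base_apply, pow_succ']
  rfl

lemma missCount_le_add (O : Fin 4 → Set Y) (s L : ℕ) (y : Y) (j : ℕ) (f : Digits) :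
    missCount e O (s + L) ((τ ^ j) y, f) ≤
      s + ∑ t ∈ Finset.range L, (missSet O).indicator 1 (orbitPoint e τ y s ((j, f), t)) := by
  rw [missCount, Finset.sum_range_add]
  refine add_le_add ?_ le_rfl
  refine (Finset.sum_le_card_nsmul _ _ 1 fun t _ => ?_).trans_eq (by simp)
  exact indicator_le_self' (by simp) _ |>.trans_eq rfl

variable [TopologicalSpace Y] [TopologicalSpace.MetrizableSpace Y]
  [SecondCountableTopology Y] [MeasurableSpace Y] [BorelSpace Y]

section Average

variable {s L J : ℕ} {F : Finset Digits}

lemma abs_integral_skew_avgDirac_le (he : Continuous e) (y : Y)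
    (φ : BoundedContinuousFunction (Y × Digits) ℝ) (hL : 0 < L) :
    |∫ x, φ (skew e x) ∂avgDirac ((Finset.range J ×ˢ F) ×ˢ Finset.range L)
        (orbitPoint e τ y s) - ∫ x, φ x ∂avgDirac ((Finset.range J ×ˢ F) ×ˢ Finset.range L)
        (orbitPoint e τ y s)| ≤ 2 * ‖φ‖ / L := by
  have hc : Continuous (skew e) :=
    (he.comp (((continuous_apply (A := fun _ : ℕ => Fin 4) 0).comp continuous_snd).prodMk
      continuous_fst)).prodMk (continuous_shift.comp continuous_snd)
  have h1 := integral_avgDirac ((Finset.range J ×ˢ F) ×ˢ Finset.range L) (orbitPoint e τ y s)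
    (φ.compContinuous ⟨skew e, hc⟩)
  simp only [BoundedContinuousFunction.compContinuous_apply, ContinuousMap.coe_mk] at h1
  rw [h1, integral_avgDirac, ← mul_sub,
    Finset.sum_product (Finset.range J ×ˢ F) (Finset.range L),
    Finset.sum_product (Finset.range J ×ˢ F) (Finset.range L),
    ← Finset.sum_sub_distrib, abs_mul, Finset.card_product]
  have hb : |∑ i ∈ Finset.range J ×ˢ F, (∑ t ∈ Finset.range L,
      φ (skew e (orbitPoint e τ y s (i, t))) - ∑ t ∈ Finset.range L,
      φ (orbitPoint e τ y s (i, t)))| ≤ (Finset.range J ×ˢ F).card * (2 * ‖φ‖) := by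
    refine (Finset.abs_sum_le_sum_abs _ _).trans
      ((Finset.sum_le_card_nsmul _ _ (2 * ‖φ‖) fun i _ => ?_).trans_eq (nsmul_eq_mul _ _))
    obtain ⟨j, f⟩ := i
    simp_rw [skew_orbitPoint]
    exact abs_sum_range_shift_sub_le (φ := fun t => φ (orbitPoint e τ y s ((j, f), t)))
      (fun t => φ.norm_coe_le_norm _) L
  have hLpos : (0 : ℝ) < L := by exact_mod_cast hL
  refine (mul_le_mul_of_nonneg_left hb (abs_nonneg _)).trans ?_
  rw [abs_of_nonneg (by positivity), Finset.card_range, Nat.cast_mul, mul_inv]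
  rcases Nat.eq_zero_or_pos (Finset.range J ×ˢ F).card with h0 | h0
  · rw [h0]; simp; positivity
  · have : (0 : ℝ) < (Finset.range J ×ˢ F).card := by exact_mod_cast h0
    apply le_of_eq
    field_simp

lemma abs_integral_base_avgDirac_le (hτ : Continuous τ)
    (hcomm : ∀ d y, e (d, τ y) = τ (e (d, y))) (y : Y)
    (φ : BoundedContinuousFunction (Y × Digits) ℝ) (hJ : 0 < J) :
    |∫ x, φ (base τ x) ∂avgDirac ((Finset.range J ×ˢ F) ×ˢ Finset.range L)
        (orbitPoint e τ y s) - ∫ x, φ x ∂avgDirac ((Finset.range J ×ˢ F) ×ˢ Finset.range L)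
        (orbitPoint e τ y s)| ≤ 2 * ‖φ‖ / J := by
  have hc : Continuous (base τ) := (hτ.comp continuous_fst).prodMk continuous_snd
  have h1 := integral_avgDirac ((Finset.range J ×ˢ F) ×ˢ Finset.range L) (orbitPoint e τ y s)
    (φ.compContinuous ⟨base τ, hc⟩)
  simp only [BoundedContinuousFunction.compContinuous_apply, ContinuousMap.coe_mk] at h1
  rw [h1, integral_avgDirac, ← mul_sub, Finset.sum_product_right, Finset.sum_product_right,
    ← Finset.sum_sub_distrib, abs_mul, Finset.card_product]
  have hb : |∑ t ∈ Finset.range L, (∑ i ∈ Finset.range J ×ˢ F,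
      φ (base τ (orbitPoint e τ y s (i, t))) - ∑ i ∈ Finset.range J ×ˢ F,
      φ (orbitPoint e τ y s (i, t)))| ≤ L * (F.card * (2 * ‖φ‖)) := by
    refine (Finset.abs_sum_le_sum_abs _ _).trans
      ((Finset.sum_le_card_nsmul _ _ (F.card * (2 * ‖φ‖)) fun t _ => ?_).trans_eq (by simp))
    rw [Finset.sum_product_right, Finset.sum_product_right, ← Finset.sum_sub_distrib]
    refine (Finset.abs_sum_le_sum_abs _ _).trans
      ((Finset.sum_le_card_nsmul _ _ (2 * ‖φ‖) fun f _ => ?_).trans_eq (by simp))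
    simp_rw [base_orbitPoint hcomm]
    exact abs_sum_range_shift_sub_le (φ := fun j => φ (orbitPoint e τ y s ((j, f), t)))
      (fun t => φ.norm_coe_le_norm _) J
  have hJpos : (0 : ℝ) < J := by exact_mod_cast hJ
  refine (mul_le_mul_of_nonneg_left hb (abs_nonneg _)).trans ?_
  rw [abs_of_nonneg (by positivity), Finset.card_product, Finset.card_range, Finset.card_range]
  push_cast
  rcases Nat.eq_zero_or_pos (F.card * L) with h0 | h0
  · have : (L : ℝ) * (F.card * (2 * ‖φ‖)) = (F.card * L : ℕ) * (2 * ‖φ‖) := by push_cast; ring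
    rw [this, h0]; simp; positivity
  · have h1 : (0 : ℝ) < F.card := by exact_mod_cast Nat.pos_of_mul_pos_right h0
    have h2 : (0 : ℝ) < L := by exact_mod_cast Nat.pos_of_mul_pos_left h0
    apply le_of_eq
    field_simp

lemma avgDirac_compl_missSet_le {O : Fin 4 → Set Y} (hOo : ∀ d, IsOpen (O d))
    (hO : Pairwise (Function.onFun Disjoint O)) {c h : ℝ} (hc : 0 < c)
    (hch : 3 * Real.exp (-c) ≤ h / 4) (hJ : 0 < J) (y : Y) (hL : 0 < L)
    (hF : InjOn (idx (s + L)) F) (hcard : Real.exp (h * (s + L : ℕ)) ≤ F.card)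
    (hs : s ≤ h / (4 * c) * (s + L)) :
    avgDirac ((Finset.range J ×ˢ F) ×ˢ Finset.range L) (orbitPoint e τ y s) (missSet O)ᶜ ≤
      1 - ENNReal.ofReal (h / (2 * c)) := by
  have hh : 0 < h := by linarith [Real.exp_pos (-c)]
  set I := (Finset.range J ×ˢ F) ×ˢ Finset.range L
  have hFpos : 0 < F.card := by exact_mod_cast (Real.exp_pos _).trans_le hcard
  have hFpos' : (0 : ℝ) < F.card := by exact_mod_cast hFpos
  have hJpos : (0 : ℝ) < J := by exact_mod_cast hJ
  have hLpos : (0 : ℝ) < L := by exact_mod_cast hL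
  have hIne : I.Nonempty := ((Finset.nonempty_range_iff.2 hJ.ne').product
    (Finset.card_pos.1 hFpos)).product (Finset.nonempty_range_iff.2 hL.ne')
  have := isProbabilityMeasure_avgDirac hIne (orbitPoint e τ y s)
  have hopen := isOpen_compl_missSet hOo
  have hmeas : MeasurableSet (missSet O) := by simpa using hopen.measurableSet.compl
  rw [prob_compl_eq_one_sub hmeas]
  refine tsub_le_tsub_left ?_ _
  rw [avgDirac_apply _ _ hmeas]
  refine ENNReal.ofReal_le_ofReal ?_
  have h1 := card_mul_le_sum_missCount e hO hc hch (Finset.nonempty_range_iff.2 hJ.ne')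
    (fun j => (τ ^ j) y) hF hcard
  have h2 : ∑ i ∈ Finset.range J ×ˢ F, missCount e O (s + L) ((τ ^ i.1) y, i.2) ≤
      J * F.card * s + ∑ i ∈ I, (missSet O).indicator 1 (orbitPoint e τ y s i) := by
    refine (Finset.sum_le_sum fun i _ => missCount_le_add O s L y i.1 i.2).trans_eq ?_
    rw [Finset.sum_add_distrib, Finset.sum_product _ (Finset.range L)]
    simp
  rw [Finset.card_range] at h1
  push_cast at h1
  have h3 := h1.trans h2
  rw [inv_mul_eq_div, le_div_iff₀ (by exact_mod_cast hIne.card_pos)]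
  have hIc : (I.card : ℝ) = J * F.card * L := by simp [I, Finset.card_product]
  rw [hIc]
  have h4 : (J : ℝ) * F.card * (h / (2 * c) * L) ≤
      J * F.card * (3 * h / (4 * c) * (s + L) - s) := by
    refine mul_le_mul_of_nonneg_left ?_ (by positivity)
    have e1 : 3 * h / (4 * c) = 3 * (h / (4 * c)) := by ring
    have e2 : h / (2 * c) = 2 * (h / (4 * c)) := by field_simp; norm_num
    rw [e1, e2]
    have : 0 ≤ h / (4 * c) * s := by positivity
    nlinarith
  nlinarith

end Average

/-- A set of digit sequences with exponentially many prefixes whose orbits stay in a compact set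
gives rise to an unpredictable measure on that set, invariant under the skew shift and under the
commuting map of the base. -/
theorem exists_invariant_not_predictable (he : Continuous e) (hτ : Continuous τ)
    (hcomm : ∀ d y, e (d, τ y) = τ (e (d, y))) {K : Set (Y × Digits)} (hK : IsCompact K) (y : Y)
    (A : Set Digits) (S : ℕ → ℕ)
    (hS : ∀ j, ∀ t ≥ S j, ∀ f ∈ A, (skew e ^ t) ((τ ^ j) y, f) ∈ K) {h : ℝ} (hh : 0 < h)
    (hA : ∃ᶠ T in atTop, ∃ F : Finset Digits, ↑F ⊆ A ∧ InjOn (idx T) F ∧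
      Real.exp (h * T) ≤ F.card) :
    ∃ P : Measure (Y × Digits), IsProbabilityMeasure P ∧ MeasurePreserving (skew e) P P ∧
      MeasurePreserving (base τ) P P ∧ P Kᶜ = 0 ∧ ¬ Predictable P := by
  have hex : ∀ J : ℕ, ∃ s L : ℕ, ∃ F : Finset Digits, (∀ j < J + 1, S j ≤ s) ∧ J + 1 ≤ L ∧
      ((J : ℝ) + 1) * s ≤ s + L ∧ ↑F ⊆ A ∧ InjOn (idx (s + L)) F ∧
      Real.exp (h * (s + L : ℕ)) ≤ F.card := by
    intro J
    obtain ⟨T, hT, F, hF⟩ := (frequently_atTop.1 hA)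
      ((J + 1) * ((Finset.range (J + 1)).sup S) + (Finset.range (J + 1)).sup S + J + 1)
    set s := (Finset.range (J + 1)).sup S
    have hsT : s + (T - s) = T := by omega
    refine ⟨s, T - s, F, fun j hj => Finset.le_sup (f := S) (Finset.mem_range.2 hj), ?_, ?_, hF.1,
      by rw [hsT]; exact hF.2.1, by rw [hsT]; exact hF.2.2⟩
    · have : 0 ≤ (J + 1) * s := Nat.zero_le _
      omega
    · have : (J + 1) * s ≤ s + (T - s) := by rw [hsT]; omega
      exact_mod_cast this
  choose s L F hs hJL hsL hFA hFinj hFcard using hex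
  have hFne : ∀ J, (F J).Nonempty := fun J => Finset.card_pos.1 (by
    exact_mod_cast (Real.exp_pos _).trans_le (hFcard J))
  have hne : ∀ J, ((Finset.range (J + 1) ×ˢ F J) ×ˢ Finset.range (L J)).Nonempty := fun J =>
    ((Finset.nonempty_range_iff.2 J.succ_ne_zero).product (hFne J)).product
      (Finset.nonempty_range_iff.2 (by have := hJL J; omega))
  set μ : ℕ → ProbabilityMeasure (Y × Digits) := fun J =>
    ⟨avgDirac ((Finset.range (J + 1) ×ˢ F J) ×ˢ Finset.range (L J)) (orbitPoint e τ y (s J)),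
      isProbabilityMeasure_avgDirac (hne J) _⟩ with hμ
  obtain ⟨P, hPK, l, hl, hlat, hlim⟩ := exists_tendsto_of_isCompact hK μ (fun J => by
    change avgDirac _ _ _ = 0
    rw [avgDirac_apply _ _ hK.isClosed.measurableSet.compl, Finset.sum_eq_zero, mul_zero,
      ENNReal.ofReal_zero]
    rintro ⟨⟨j, f⟩, t⟩ hi
    simp only [Finset.mem_product, Finset.mem_range] at hi
    refine indicator_of_notMem (notMem_compl_iff.2 ?_) _
    exact hS j _ ((hs J j hi.1.1).trans (Nat.le_add_right _ _)) f (hFA J hi.1.2))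
  have hlim0 : ∀ C : ℝ, Tendsto (fun J : ℕ => C / ((J + 1 : ℕ) : ℝ)) l (𝓝 0) := fun C =>
    ((tendsto_const_div_atTop_nhds_zero_nat C).comp (tendsto_add_atTop_nat 1)).mono_left hlat
  have hcs : Continuous (skew e) :=
    (he.comp (((continuous_apply (A := fun _ : ℕ => Fin 4) 0).comp continuous_snd).prodMk
      continuous_fst)).prodMk (continuous_shift.comp continuous_snd)
  have hcb : Continuous (base τ) := (hτ.comp continuous_fst).prodMk continuous_snd
  refine ⟨P, inferInstance, measurePreserving_of_tendsto hlim hcs fun φ => ?_,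
    measurePreserving_of_tendsto hlim hcb fun φ => ?_, hPK, ?_⟩
  · refine squeeze_zero_norm (fun J => ?_) (hlim0 (2 * ‖φ‖))
    refine (abs_integral_skew_avgDirac_le he y φ (by have := hJL J; omega)).trans ?_
    have := hJL J
    gcongr
  · refine squeeze_zero_norm (fun J => ?_) (hlim0 (2 * ‖φ‖))
    exact abs_integral_base_avgDirac_le hτ hcomm y φ J.succ_pos
  · obtain ⟨c, hc, hch⟩ : ∃ c : ℝ, 0 < c ∧ 3 * Real.exp (-c) ≤ h / 4 := by
      have : Tendsto (fun c : ℝ => 3 * Real.exp (-c)) atTop (𝓝 (3 * 0)) :=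
        (Real.tendsto_exp_neg_atTop_nhds_zero).const_mul 3
      rw [mul_zero] at this
      obtain ⟨c, h1, h2⟩ := ((this.eventually
        (ge_mem_nhds (show (0 : ℝ) < h / 4 by positivity))).and
        (eventually_gt_atTop 0)).exists
      exact ⟨c, h2, h1⟩
    refine not_predictable_of_tendsto hlim (η := ENNReal.ofReal (h / (2 * c)))
      (by simpa using by positivity) fun O hOo hO => hlat ?_
    obtain ⟨J₀, hJ₀⟩ := exists_nat_gt (4 * c / h)
    filter_upwards [eventually_ge_atTop J₀] with J hJ
    refine avgDirac_compl_missSet_le hOo hO hc hch J.succ_pos y (by have := hJL J; omega)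
      (hFinj J) (hFcard J) ?_
    have hJ' : 4 * c / h ≤ J + 1 := by
      have : (J₀ : ℝ) ≤ J := by exact_mod_cast hJ
      linarith
    have h1 : 4 * c / h * s J ≤ s J + L J :=
      (mul_le_mul_of_nonneg_right hJ' (Nat.cast_nonneg _)).trans (hsL J)
    have h2 := mul_le_mul_of_nonneg_left h1 (show 0 ≤ h / (4 * c) by positivity)
    refine le_trans (le_of_eq ?_) h2
    field_simp

end InvariantMeasures

section HorocyclicSystems

section Theta

lemma ofDigits_eq_shift (f : Digits) :
    Real.ofDigits f = (f 0 : ℕ) / 4 + Real.ofDigits (shift f) / 4 := by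
  rw [Real.ofDigits_eq_sum_add_ofDigits f 1, show (fun i => f (i + 1)) = shift f from rfl]
  simp [Real.ofDigitsTerm]
  ring

lemma ofDigits_mul_pow (n : ℕ) (f : Digits) :
    Real.ofDigits f * 4 ^ n = idx n f + Real.ofDigits (shift^[n] f) := by
  induction n generalizing f with
  | zero => simp [idx]
  | succ n ih =>
    rw [ofDigits_eq_shift, idx, Function.iterate_succ_apply]
    have := ih (shift f)
    push_cast
    rw [add_assoc, ← this]
    ring

lemma inv_pow_le_abs_ofDigits_sub {n : ℕ} {f g : Digits}
    (h : 2 ≤ |(idx n f : ℤ) - idx n g|) :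
    ((4 : ℝ) ^ n)⁻¹ ≤ |Real.ofDigits f - Real.ofDigits g| := by
  rw [inv_le_iff_one_le_mul₀ (by positivity)]
  have h' : (2 : ℝ) ≤ |(idx n f : ℝ) - idx n g| := by exact_mod_cast h
  have e1 := ofDigits_mul_pow n f
  have e2 := ofDigits_mul_pow n g
  have e3 : |Real.ofDigits f - Real.ofDigits g| * 4 ^ n =
      |(idx n f : ℝ) - idx n g +
        (Real.ofDigits (shift^[n] f) - Real.ofDigits (shift^[n] g))| := by
    have h4 : |(4 : ℝ) ^ n| = 4 ^ n := abs_of_pos (by positivity)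
    rw [← h4, ← abs_mul]
    congr 1
    linear_combination e1 - e2
  rw [e3]
  have b : |Real.ofDigits (shift^[n] f) - Real.ofDigits (shift^[n] g)| ≤ 1 := by
    rw [abs_le]
    constructor <;>
      linarith [Real.ofDigits_nonneg (shift^[n] f), Real.ofDigits_le_one (shift^[n] f),
      Real.ofDigits_nonneg (shift^[n] g), Real.ofDigits_le_one (shift^[n] g)]
  have := abs_sub_abs_le_abs_sub ((idx n f : ℝ) - idx n g)
    (-(Real.ofDigits (shift^[n] f) - Real.ofDigits (shift^[n] g)))
  rw [abs_neg, sub_neg_eq_add] at this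
  linarith

end Theta

/-- Elements of a group acting on a space: a one-parameter group `u`, an element `a` expanding it
by the factor four, and an element `b` commuting with both. -/
structure HoroSystem (G X : Type*) [Group G] [TopologicalSpace X] [MulAction G X] where
  /-- the expanding element -/
  a : G
  /-- the commuting element -/
  b : G
  /-- the expanded one-parameter group -/
  u : ℝ → G
  u_add : ∀ s t, u (s + t) = u s * u t
  a_mul_u : ∀ s, a * u s = u (4 * s) * a
  commute_a_b : Commute a b
  commute_u_b : ∀ s, Commute (u s) b
  continuous_u_smul : Continuous fun q : ℝ × X => u q.1 • q.2
  continuous_smul : ∀ g : G, Continuous fun x : X => g • x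

namespace HoroSystem

variable {G X : Type*} [Group G] [TopologicalSpace X] [MulAction G X] (H : HoroSystem G X)

lemma u_zero : H.u 0 = 1 := by simpa using H.u_add 0 0

lemma u_neg (s : ℝ) : H.u (-s) = (H.u s)⁻¹ :=
  eq_inv_of_mul_eq_one_left (by rw [← H.u_add, neg_add_cancel, H.u_zero])

lemma a_pow_mul_u (n : ℕ) (s : ℝ) : H.a ^ n * H.u s = H.u (4 ^ n * s) * H.a ^ n := by
  induction n generalizing s with
  | zero => simp
  | succ n ih => rw [pow_succ, mul_assoc, H.a_mul_u, ← mul_assoc, ih, mul_assoc]; ring_nf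

/-- The identification used to record the digits of the past. -/
noncomputable def ext : Fin 4 × (X × Digits) ≃ X × Digits where
  toFun q := ((H.a * H.u ((q.1 : ℕ) / 4)) • q.2.1, cons q.1 q.2.2)
  invFun y := (y.2 0, ((H.a * H.u ((y.2 0 : ℕ) / 4))⁻¹ • y.1, shift y.2))
  left_inv q := by
    change (q.1, (H.a * H.u ((q.1 : ℕ) / 4))⁻¹ • (H.a * H.u ((q.1 : ℕ) / 4)) • q.2.1, q.2.2) = q
    rw [inv_smul_smul]
  right_inv y := by
    change ((H.a * H.u ((y.2 0 : ℕ) / 4)) • (H.a * H.u ((y.2 0 : ℕ) / 4))⁻¹ • y.1,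
      cons (y.2 0) (shift y.2)) = y
    rw [smul_inv_smul, cons_shift]

/-- The action of the commuting element on the base of the skew shift. -/
def lift : Equiv.Perm (X × Digits) := (MulAction.toPerm H.b).prodCongr (Equiv.refl _)

lemma lift_pow_apply (k : ℕ) (y : X × Digits) : (H.lift ^ k) y = (H.b ^ k • y.1, y.2) := by
  induction k with
  | zero => simp
  | succ k ih =>
    rw [pow_succ', Equiv.Perm.mul_apply, ih, pow_succ', mul_smul]
    rfl

lemma continuous_ext : Continuous H.ext := by
  refine Continuous.prodMk ?_ (continuous_cons.comp
    (continuous_fst.prodMk (continuous_snd.comp continuous_snd)))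
  exact continuous_prod_of_discrete_left.2 fun d =>
    (H.continuous_smul (H.a * H.u ((d : ℕ) / 4))).comp continuous_fst

lemma continuous_ext_symm : Continuous H.ext.symm := by
  have h0 : Continuous fun y : X × Digits => y.2 0 :=
    (continuous_apply (A := fun _ : ℕ => Fin 4) 0).comp continuous_snd
  refine h0.prodMk (Continuous.prodMk ?_ (continuous_shift.comp continuous_snd))
  have h1 : Continuous fun q : Fin 4 × X => (H.a * H.u ((q.1 : ℕ) / 4))⁻¹ • q.2 :=
    continuous_prod_of_discrete_left.2 fun d =>
      H.continuous_smul (H.a * H.u ((d : ℕ) / 4))⁻¹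
  exact h1.comp (h0.prodMk continuous_fst)

lemma continuous_lift : Continuous H.lift :=
  ((H.continuous_smul H.b).comp continuous_fst).prodMk continuous_snd

lemma continuous_lift_symm : Continuous H.lift.symm :=
  ((H.continuous_smul H.b⁻¹).comp continuous_fst).prodMk continuous_snd

lemma ext_lift (d : Fin 4) (y : X × Digits) : H.ext (d, H.lift y) = H.lift (H.ext (d, y)) := by
  change ((H.a * H.u ((d : ℕ) / 4)) • H.b • y.1, cons d y.2) =
    (H.b • (H.a * H.u ((d : ℕ) / 4)) • y.1, cons d y.2)
  rw [← mul_smul, ← mul_smul, (H.commute_a_b.mul_left (H.commute_u_b _)).eq]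

/-- The point of the original space determined by a base point and a future. -/
noncomputable def pt (ω : (X × Digits) × Digits) : X := H.u (Real.ofDigits ω.2) • ω.1.1

lemma continuous_pt : Continuous H.pt :=
  H.continuous_u_smul.comp ((Real.continuous_ofDigits.comp continuous_snd).prodMk
    (continuous_fst.comp continuous_fst))

lemma pt_skew (ω : (X × Digits) × Digits) : H.pt (skew H.ext ω) = H.a • H.pt ω := by
  obtain ⟨⟨x, q⟩, f⟩ := ω
  change H.u (Real.ofDigits (shift f)) • (H.a * H.u ((f 0 : ℕ) / 4)) • x =
    H.a • H.u (Real.ofDigits f) • x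
  rw [← mul_smul, ← mul_smul, ofDigits_eq_shift f, add_comm, H.u_add, ← mul_assoc, ← mul_assoc,
    H.a_mul_u]
  ring_nf

lemma pt_skew_pow (n : ℕ) (ω : (X × Digits) × Digits) :
    H.pt ((skew H.ext ^ n) ω) = H.a ^ n • H.pt ω := by
  induction n with
  | zero => simp
  | succ n ih => rw [pow_succ', Equiv.Perm.mul_apply, pt_skew, ih, pow_succ', mul_smul]

lemma pt_skew_zpow (n : ℤ) (ω : (X × Digits) × Digits) :
    H.pt ((skew H.ext ^ n) ω) = H.a ^ n • H.pt ω := by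
  obtain ⟨n, rfl | rfl⟩ := n.eq_nat_or_neg
  · simpa using H.pt_skew_pow n ω
  · rw [zpow_neg, zpow_neg, zpow_natCast, zpow_natCast, eq_inv_smul_iff, ← pt_skew_pow,
      ← Equiv.Perm.mul_apply, mul_inv_cancel, Equiv.Perm.one_apply]

lemma pt_base (ω : (X × Digits) × Digits) : H.pt (base H.lift ω) = H.b • H.pt ω := by
  obtain ⟨⟨x, q⟩, f⟩ := ω
  change H.u (Real.ofDigits f) • H.b • x = H.b • H.u (Real.ofDigits f) • x
  rw [← mul_smul, ← mul_smul, (H.commute_u_b _).eq]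

lemma pt_base_pow (n : ℕ) (ω : (X × Digits) × Digits) :
    H.pt ((base H.lift ^ n) ω) = H.b ^ n • H.pt ω := by
  induction n with
  | zero => simp
  | succ n ih => rw [pow_succ', Equiv.Perm.mul_apply, pt_base, ih, pow_succ', mul_smul]

lemma pt_base_zpow (n : ℤ) (ω : (X × Digits) × Digits) :
    H.pt ((base H.lift ^ n) ω) = H.b ^ n • H.pt ω := by
  obtain ⟨n, rfl | rfl⟩ := n.eq_nat_or_neg
  · simpa using H.pt_base_pow n ω
  · rw [zpow_neg, zpow_neg, zpow_natCast, zpow_natCast, eq_inv_smul_iff, ← pt_base_pow,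
      ← Equiv.Perm.mul_apply, mul_inv_cancel, Equiv.Perm.one_apply]

lemma isCompact_pt_preimage {C : Set X} (hC : IsCompact C) : IsCompact (H.pt ⁻¹' C) := by
  have him : H.pt ⁻¹' C = (fun ω : (X × Digits) × Digits =>
      ((H.u (-Real.ofDigits ω.2) • ω.1.1, ω.1.2), ω.2)) ''
      ((C ×ˢ (univ : Set Digits)) ×ˢ (univ : Set Digits)) := by
    ext ⟨⟨x, q⟩, f⟩
    simp only [mem_preimage, mem_image, mem_prod, mem_univ, and_true, Prod.mk.injEq, Prod.exists,
      H.u_neg]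
    constructor
    · exact fun h => ⟨_, q, f, h, ⟨inv_smul_smul _ _, rfl⟩, rfl⟩
    · rintro ⟨x', q', f', h, ⟨rfl, rfl⟩, rfl⟩
      simpa [pt] using h
  rw [him]
  refine ((hC.prod isCompact_univ).prod isCompact_univ).image ?_
  refine Continuous.prodMk (Continuous.prodMk ?_ (continuous_snd.comp continuous_fst))
    continuous_snd
  exact H.continuous_u_smul.comp ((Real.continuous_ofDigits.comp continuous_snd).neg.prodMk
    (continuous_fst.comp continuous_fst))

/-- The displacement along the one-parameter group between the point with an alternative future
branching off `m` steps in the past and the original point. -/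
lemma exists_pt_back (ω : (X × Digits) × Digits) (m : ℕ) :
    ∃ θ ∈ Icc (0 : ℝ) 1, ∀ (k N : ℕ) (f : Digits),
      H.pt ((skew H.ext ^ N) ((H.lift ^ k) ((back H.ext)^[m] ω.1), f)) =
      H.b ^ k • H.a ^ ((N : ℤ) - m) • H.u (4 ^ m * (Real.ofDigits f - θ)) • H.pt ω := by
  set ω' := ((skew H.ext)⁻¹ ^ m) ω with hω'
  have h1 : ω'.1 = (back H.ext)^[m] ω.1 := by rw [hω']; exact fst_skew_inv_pow _ _ _
  refine ⟨Real.ofDigits ω'.2, ⟨Real.ofDigits_nonneg _, Real.ofDigits_le_one _⟩, fun k N f => ?_⟩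
  have hω : H.pt ω = H.a ^ m • H.pt ω' := by
    rw [← pt_skew_pow, hω', ← Equiv.Perm.mul_apply, inv_pow, mul_inv_cancel, Equiv.Perm.one_apply]
  have h2 : H.pt ω' = H.u (Real.ofDigits ω'.2) • ((back H.ext)^[m] ω.1).1 := by
    rw [← h1]; rfl
  have hb : ∀ s, Commute (H.u s) (H.b ^ k) := fun s => (H.commute_u_b s).pow_right k
  have hab : Commute (H.a ^ N) (H.b ^ k) := H.commute_a_b.pow_pow _ _
  rw [pt_skew_pow, lift_pow_apply, hω, h2]
  change H.a ^ N • H.u (Real.ofDigits f) • H.b ^ k • _ = _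
  rw [← mul_smul, ← mul_smul, mul_assoc, (hb _).eq, ← mul_assoc, hab.eq]
  simp only [← mul_smul]
  congr 1
  have h3 := H.a_pow_mul_u m (Real.ofDigits f - Real.ofDigits ω'.2)
  have h4 : H.u (Real.ofDigits f) =
      H.u (Real.ofDigits f - Real.ofDigits ω'.2) * H.u (Real.ofDigits ω'.2) := by
    rw [← H.u_add, sub_add_cancel]
  rw [h4, mul_assoc (H.b ^ k)]
  congr 1
  rw [zpow_sub, zpow_natCast, zpow_natCast]
  calc H.a ^ N * (H.u (Real.ofDigits f - Real.ofDigits ω'.2) * H.u (Real.ofDigits ω'.2))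
      = H.a ^ N * (H.a ^ m)⁻¹ *
        (H.a ^ m * H.u (Real.ofDigits f - Real.ofDigits ω'.2)) * H.u (Real.ofDigits ω'.2) := by
        group
    _ = _ := by rw [h3]; group

end HoroSystem

end HorocyclicSystems

section Rigidity

namespace HoroSystem

variable {G X : Type*} [Group G] [TopologicalSpace X] [MulAction G X] (H : HoroSystem G X)

/-- The points whose orbit under the group generated by `a` and `b` stays in `C`. -/
def stays (C : Set X) : Set X := {x | ∀ i l : ℤ, H.a ^ i • H.b ^ l • x ∈ C}

variable {C : Set X}

lemma isClosed_stays (hC : IsClosed C) : IsClosed (H.stays C) := by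
  simp only [stays, ofPred_forall]
  exact isClosed_iInter fun i => isClosed_iInter fun l =>
    hC.preimage ((H.continuous_smul _).comp (H.continuous_smul _))

lemma stays_subset : H.stays C ⊆ C := fun x hx => by simpa using hx 0 0

lemma b_zpow_smul_mem_stays {x : X} (hx : x ∈ H.stays C) (k : ℤ) : H.b ^ k • x ∈ H.stays C :=
  fun i l => by rw [smul_smul (H.b ^ l), ← zpow_add]; exact hx i (l + k)

lemma b_pow_smul_mem_stays_iff {x : X} (k : ℕ) : H.b ^ k • x ∈ H.stays C ↔ x ∈ H.stays C := by
  constructor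
  · intro h
    have := H.b_zpow_smul_mem_stays h (-(k : ℤ))
    rwa [zpow_neg, zpow_natCast, inv_smul_smul] at this
  · intro h
    have := H.b_zpow_smul_mem_stays h k
    rwa [zpow_natCast] at this

/-- The points that are moved into `stays C` by the one-parameter group with a parameter in `I`. -/
def hits (C : Set X) (I : Set ℝ) : Set X := {x | ∃ s ∈ I, H.u s • x ∈ H.stays C}

lemma isClosed_hits (hC : IsClosed C) {I : Set ℝ} (hI : IsCompact I) :
    IsClosed (H.hits C I) := by
  have : CompactSpace I := isCompact_iff_compactSpace.1 hI
  have hcl : IsClosed {q : I × X | H.u q.1 • q.2 ∈ H.stays C} :=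
    (H.isClosed_stays hC).preimage (H.continuous_u_smul.comp
      ((continuous_subtype_val.comp continuous_fst).prodMk continuous_snd))
  convert! isClosedMap_snd_of_compactSpace _ hcl using 1
  ext x
  simp [hits]

lemma b_pow_smul_mem_hits_iff {x : X} {I : Set ℝ} (k : ℕ) :
    H.b ^ k • x ∈ H.hits C I ↔ x ∈ H.hits C I := by
  have : ∀ s, H.u s • H.b ^ k • x = H.b ^ k • H.u s • x := fun s => by
    rw [← mul_smul, ← mul_smul, ((H.commute_u_b s).pow_right k).eq]
  simp only [hits, mem_ofPred_eq, this, b_pow_smul_mem_stays_iff]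

/-- A set of points on which the return set `{s | u s • x ∈ stays C}` varies continuously enough to
be determined in the limit. -/
def IsRigid (C Y₀ : Set X) : Prop :=
  ∀ (x : ℕ → X) (k : ℕ → ℕ) (z z' : X), (∀ i, x i ∈ Y₀) → (∀ i, H.b ^ k i • x i ∈ Y₀) →
    Tendsto x atTop (𝓝 z) → Tendsto (fun i => H.b ^ k i • x i) atTop (𝓝 z') →
    ∀ s, H.u s • z ∈ H.stays C ↔ H.u s • z' ∈ H.stays C

lemma mem_hits_of_tendsto {B F : Set X} (hB : IsClosed B) (hF : IsClosed F) (hd : Disjoint B F)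
    {x x' : ℕ → X} {z z' : X} (hx : ∀ i, x i ∈ B ∪ F) (hxx' : ∀ i, x i ∈ B → x' i ∈ B)
    (hz : Tendsto x atTop (𝓝 z)) (hz' : Tendsto x' atTop (𝓝 z')) (hzB : z ∈ B) : z' ∈ B := by
  have h1 : ∀ᶠ i in atTop, x i ∈ Fᶜ :=
    hz.eventually (hF.isOpen_compl.mem_nhds (Set.disjoint_left.1 hd hzB))
  exact hB.mem_of_tendsto hz' (h1.mono fun i hi => hxx' i ((hx i).resolve_right hi))

lemma u_smul_mem_stays_of_forall_hits (hC : IsClosed C) {z : X} {s : ℝ}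
    (h : ∀ p q : ℚ, (p : ℝ) < s → s < q → z ∈ H.hits C (Icc p q)) : H.u s • z ∈ H.stays C := by
  have hcl : IsClosed {r : ℝ | H.u r • z ∈ H.stays C} :=
    (H.isClosed_stays hC).preimage (H.continuous_u_smul.comp
      (continuous_id.prodMk continuous_const))
  change s ∈ {r : ℝ | H.u r • z ∈ H.stays C}
  rw [← hcl.closure_eq, Metric.mem_closure_iff]
  intro ε hε
  obtain ⟨p, hp1, hp2⟩ := exists_rat_btwn (show s - ε < s by linarith)
  obtain ⟨q, hq1, hq2⟩ := exists_rat_btwn (show s < s + ε by linarith)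
  obtain ⟨r, hr, hrz⟩ := h p q hp2 hq1
  refine ⟨r, hrz, ?_⟩
  rw [Real.dist_eq, abs_sub_lt_iff]
  constructor <;> linarith [hr.1, hr.2]

variable [TopologicalSpace.MetrizableSpace X] [MeasurableSpace X] [BorelSpace X]

lemma exists_isRigid (hC : IsClosed C) (ν : Measure X) [IsFiniteMeasure ν]
    (hν : ν (H.stays C)ᶜ = 0) {η : ℝ≥0∞} (hη : η ≠ 0) :
    ∃ Y₀ ⊆ H.stays C, MeasurableSet Y₀ ∧ ν Y₀ᶜ ≤ η ∧ H.IsRigid C Y₀ := by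
  obtain ⟨ε, hε, hsum⟩ := ENNReal.exists_pos_sum_of_countable' hη (ℚ × ℚ)
  set B : ℚ × ℚ → Set X := fun q => H.hits C (Icc (q.1 : ℝ) q.2) with hB
  have hBc : ∀ q, IsClosed (B q) := fun q => H.isClosed_hits hC isCompact_Icc
  have hex : ∀ q, ∃ F ⊆ (B q)ᶜ, IsClosed F ∧ ν ((B q)ᶜ \ F) < ε q := fun q =>
    (hBc q).measurableSet.compl.exists_isClosed_sdiff_lt (measure_ne_top _ _) (hε q).ne'
  choose F hFB hFc hFm using hex
  refine ⟨H.stays C ∩ ⋂ q, (B q ∪ F q), inter_subset_left,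
    (H.isClosed_stays hC).measurableSet.inter
      (MeasurableSet.iInter fun q => (hBc q).measurableSet.union (hFc q).measurableSet), ?_, ?_⟩
  · rw [compl_inter, compl_iInter]
    refine (measure_union_le _ _).trans ?_
    rw [hν, zero_add]
    refine (measure_iUnion_le _).trans (le_trans (ENNReal.tsum_le_tsum fun q => ?_) hsum.le)
    rw [compl_union]
    exact (hFm q).le
  · intro x k z z' hx hbx hz hz' s
    have hd : ∀ q, Disjoint (B q) (F q) := fun q =>
      Set.disjoint_right.2 fun y hy => hFB q hy
    constructor
    · intro hs
      refine H.u_smul_mem_stays_of_forall_hits hC fun p q hp hq => ?_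
      exact mem_hits_of_tendsto (hBc (p, q)) (hFc (p, q)) (hd _)
        (fun i => mem_iInter.1 (hx i).2 (p, q))
        (fun i hi => (H.b_pow_smul_mem_hits_iff (k i)).2 hi) hz hz' ⟨s, ⟨hp.le, hq.le⟩, hs⟩
    · intro hs
      refine H.u_smul_mem_stays_of_forall_hits hC fun p q hp hq => ?_
      exact mem_hits_of_tendsto (hBc (p, q)) (hFc (p, q)) (hd _)
        (fun i => mem_iInter.1 (hbx i).2 (p, q))
        (fun i hi => (H.b_pow_smul_mem_hits_iff (k i)).1 hi) hz' hz ⟨s, ⟨hp.le, hq.le⟩, hs⟩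

/-- At a point `x`, for a return time `k` of `b`: for every admissible choice of renormalization
times there are three separated parameters that are good simultaneously. -/
def HasBranches (Y₀ : Set X) (n k : ℕ) (x : X) : Prop :=
  ∀ (m₀ t₀ : ℕ) (t : ℕ → ℤ), 1 ≤ t₀ → InjOn t (Icc m₀ (2 * m₀ + t₀ / 2)) →
    (∀ m ∈ Icc m₀ (2 * m₀ + t₀ / 2), -(2 * m₀ : ℤ) ≤ t m ∧ t m ≤ t₀ ∧ 0 ≤ t m + m) →
    ∃ m ∈ Icc m₀ (2 * m₀ + t₀ / 2), ∃ s : Fin 3 → ℝ, (∀ j, |s j| ≤ 4 ^ m) ∧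
      (∀ i j, i ≠ j → (4 : ℝ) ^ m / 4 ^ n ≤ |s i - s j|) ∧
      ∀ j, H.a ^ t m • H.u (s j) • x ∈ Y₀ ∧ H.b ^ k • H.a ^ t m • H.u (s j) • x ∈ Y₀

lemma _root_.MeasureTheory.MeasurePreserving.exists_tendsto_mem {Ω : Type*} [MeasurableSpace Ω]
    [TopologicalSpace Ω] [SecondCountableTopology Ω] [OpensMeasurableSpace Ω] {P : Measure Ω}
    [IsFiniteMeasure P] {S : Ω → Ω} (hS : MeasurePreserving S P P) {W : Set Ω}
    (hW : MeasurableSet W) (hW0 : P W ≠ 0) {q : Ω → Prop} (hq : ∀ᵐ ω ∂P, q ω) :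
    ∃ ω ∈ W, q ω ∧ ∃ k : ℕ → ℕ, (∀ i, 1 ≤ k i) ∧ (∀ i, S^[k i] ω ∈ W) ∧
      Tendsto (fun i => S^[k i] ω) atTop (𝓝 ω) := by
  have hrec : ∀ᵐ ω ∂P, ∀ U ∈ TopologicalSpace.countableBasis Ω, ω ∈ W ∩ U →
      ∃ᶠ n in atTop, S^[n] ω ∈ W ∩ U :=
    (ae_ball_iff (TopologicalSpace.countable_countableBasis Ω)).2 fun U hU =>
      hS.conservative.ae_mem_imp_frequently_image_mem (hW.inter
        (TopologicalSpace.isOpen_of_mem_countableBasis hU).measurableSet).nullMeasurableSet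
  obtain ⟨ω, hωW, hω, hωq⟩ := ((frequently_ae_mem_iff.2 hW0).and_eventually
    (hrec.and hq)).exists
  obtain ⟨V, hV⟩ := (𝓝 ω).exists_antitone_basis
  have hex : ∀ i, ∃ k, 1 ≤ k ∧ S^[k] ω ∈ W ∧ S^[k] ω ∈ V i := fun i => by
    obtain ⟨U, hU, hωU, hUV⟩ := (TopologicalSpace.isBasis_countableBasis Ω).mem_nhds_iff.1
      (hV.toHasBasis.mem_of_mem (i := i) trivial)
    obtain ⟨k, hk, hk'⟩ := frequently_atTop.1 (hω U hU ⟨hωW, hωU⟩) 1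
    exact ⟨k, hk, hk'.1, hUV hk'.2⟩
  choose k hk1 hkW hkV using hex
  exact ⟨ω, hωW, hωq, k, hk1, hkW, hV.tendsto hkV⟩

lemma measurePreserving_zpow {Ω : Type*} [MeasurableSpace Ω] {P : Measure Ω} {T : Equiv.Perm Ω}
    (hT : MeasurePreserving T P P) (hTi : Measurable (T⁻¹ : Equiv.Perm Ω)) (i : ℤ) :
    MeasurePreserving (T ^ i : Equiv.Perm Ω) P P := by
  have hinv : MeasurePreserving (T⁻¹ : Equiv.Perm Ω) P P :=
    hT.symm ⟨T, hT.measurable, hTi⟩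
  obtain ⟨n, rfl | rfl⟩ := i.eq_nat_or_neg
  · rw [zpow_natCast, ← Equiv.Perm.iterate_eq_pow]
    exact hT.iterate n
  · rw [zpow_neg, zpow_natCast, ← inv_pow, ← Equiv.Perm.iterate_eq_pow]
    exact hinv.iterate n

theorem exists_recurrent_hasBranches [SecondCountableTopology X] (hC : IsCompact C) (x₀ : X)
    (A : Set Digits) (S : ℕ → ℕ)
    (hS : ∀ j, ∀ t ≥ S j, ∀ f ∈ A, H.a ^ t • H.b ^ j • H.u (Real.ofDigits f) • x₀ ∈ C)
    {h : ℝ} (hh : 0 < h)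
    (hA : ∃ᶠ T in atTop, ∃ F : Finset Digits, ↑F ⊆ A ∧ InjOn (idx T) F ∧
      Real.exp (h * T) ≤ F.card) :
    ∃ Y₀ ⊆ H.stays C, H.IsRigid C Y₀ ∧ ∃ x ∈ H.stays C, ∃ n : ℕ, ∃ k : ℕ → ℕ,
      (∀ i, 1 ≤ k i) ∧ Tendsto (fun i => H.b ^ k i • x) atTop (𝓝 x) ∧
      ∀ i, H.HasBranches Y₀ n (k i) x := by
  obtain ⟨P, hPp, hT, hTp, hPK, hpred⟩ := exists_invariant_not_predictable H.continuous_ext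
    H.continuous_lift H.ext_lift (H.isCompact_pt_preimage hC) (x₀, 0) A S (fun j t ht f hf => by
      rw [mem_preimage, pt_skew_pow, lift_pow_apply]
      change H.a ^ t • H.u (Real.ofDigits f) • H.b ^ j • x₀ ∈ C
      rw [smul_smul (H.u _), ((H.commute_u_b _).pow_right j).eq, mul_smul]
      exact hS j t ht f hf) hh hA
  obtain ⟨η, hη, n, hZ⟩ := exists_hasSeparatedFutures H.continuous_ext.measurable
    H.continuous_ext_symm.measurable H.continuous_lift.measurable
    H.continuous_lift_symm.measurable H.ext_lift hT hTp hpred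
  have hpt := H.continuous_pt.measurable
  have hTz : ∀ i : ℤ, MeasurePreserving (skew H.ext ^ i : Equiv.Perm _) P P := fun i =>
    measurePreserving_zpow hT (measurable_skew_inv H.continuous_ext_symm.measurable) i
  have hTpz : ∀ i : ℤ, MeasurePreserving (base H.lift ^ i : Equiv.Perm _) P P := fun i =>
    measurePreserving_zpow hTp (measurable_base (τ := H.lift⁻¹)
      H.continuous_lift_symm.measurable) i
  have hstays : ∀ᵐ ω ∂P, H.pt ω ∈ H.stays C := by
    simp only [stays, mem_ofPred_eq]
    refine ae_all_iff.2 fun i => ae_all_iff.2 fun l => ?_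
    have h0 : ∀ᵐ ω ∂P, H.pt ω ∈ C := hPK
    filter_upwards [(hTpz l).quasiMeasurePreserving.ae ((hTz i).quasiMeasurePreserving.ae h0)]
      with ω hω
    rwa [pt_skew_zpow, pt_base_zpow] at hω
  have : IsProbabilityMeasure (P.map H.pt) := Measure.isProbabilityMeasure_map hpt.aemeasurable
  have hcl := H.isClosed_stays hC.isClosed
  obtain ⟨Y₀, hY₀, hY₀m, hY₀η, hrigid⟩ := H.exists_isRigid hC.isClosed (P.map H.pt) (by
    rw [Measure.map_apply hpt hcl.measurableSet.compl]; exact hstays)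
    (η := ENNReal.ofReal η) (by simpa using hη)
  obtain ⟨W, hWm, hW0, hW⟩ := hZ (H.pt ⁻¹' Y₀) (hpt hY₀m) (by
    rw [← preimage_compl, measureReal_def, ← Measure.map_apply hpt hY₀m.compl]
    exact ENNReal.toReal_le_of_le_ofReal hη.le hY₀η)
  obtain ⟨ω, hωW, hωs, k, hk1, hkW, hkt⟩ := hTp.exists_tendsto_mem hWm hW0 hstays
  refine ⟨Y₀, hY₀, hrigid, H.pt ω, hωs, n, k, hk1, ?_, fun i m₀ t₀ t ht₀ hinj ht => ?_⟩
  · have := (H.continuous_pt.tendsto ω).comp hkt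
    refine this.congr fun i => ?_
    rw [Function.comp_apply, Equiv.Perm.iterate_eq_pow, pt_base_pow]
  · have hki := hkW i
    rw [Equiv.Perm.iterate_eq_pow] at hki
    obtain ⟨m, hm, f, hf, hfZ⟩ := hW ω hωW (k i) hki m₀ t₀ t ht₀ hinj ht
    obtain ⟨θ, hθ, hback⟩ := H.exists_pt_back ω m
    have hN : (((t m + m).toNat : ℤ) - m) = t m := by
      rw [Int.toNat_of_nonneg (ht m hm).2.2]; ring
    refine ⟨m, hm, fun j => 4 ^ m * (Real.ofDigits (f j) - θ), fun j => ?_, fun i j hij => ?_,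
      fun j => ?_⟩
    · rw [abs_mul, abs_of_pos (by positivity)]
      refine mul_le_of_le_one_right (by positivity) (abs_le.2 ?_)
      constructor <;> linarith [Real.ofDigits_nonneg (f j), Real.ofDigits_le_one (f j), hθ.1, hθ.2]
    · rw [← mul_sub, sub_sub_sub_cancel_right, abs_mul, abs_of_pos (by positivity), div_eq_mul_inv]
      exact mul_le_mul_of_nonneg_left (inv_pow_le_abs_ofDigits_sub (hf i j hij)) (by positivity)
    · have h1 := (hfZ j).1
      have h2 := (hfZ j).2
      rw [mem_preimage, hback, hN] at h2
      have h3 := hback 0 (t m + m).toNat (f j)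
      rw [pow_zero, Equiv.Perm.one_apply, pow_zero, one_smul, hN] at h3
      rw [mem_preimage, h3] at h1
      exact ⟨h1, h2⟩

end HoroSystem

end Rigidity

section Lattice

variable (p : ℕ) [hp : Fact p.Prime]

/-- The group `SL₂(ℝ) × SL₂(ℚ_p)`. -/
abbrev Amb := Matrix.SpecialLinearGroup (Fin 2) ℝ × Matrix.SpecialLinearGroup (Fin 2) ℚ_[p]

instance : SecondCountableTopology (Matrix.SpecialLinearGroup (Fin 2) ℝ) :=
  haveI : SecondCountableTopology (Matrix (Fin 2) (Fin 2) ℝ) :=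
    inferInstanceAs (SecondCountableTopology (Fin 2 → Fin 2 → ℝ))
  Matrix.SpecialLinearGroup.isClosedEmbedding_val.isEmbedding.secondCountableTopology

instance : SecondCountableTopology (Matrix.SpecialLinearGroup (Fin 2) ℚ_[p]) :=
  haveI : SecondCountableTopology (Matrix (Fin 2) (Fin 2) ℚ_[p]) :=
    inferInstanceAs (SecondCountableTopology (Fin 2 → Fin 2 → ℚ_[p]))
  Matrix.SpecialLinearGroup.isClosedEmbedding_val.isEmbedding.secondCountableTopology

instance : LocallyCompactSpace (Matrix.SpecialLinearGroup (Fin 2) ℝ) :=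
  haveI : LocallyCompactSpace (Matrix (Fin 2) (Fin 2) ℝ) :=
    inferInstanceAs (LocallyCompactSpace (Fin 2 → Fin 2 → ℝ))
  Matrix.SpecialLinearGroup.isClosedEmbedding_val.locallyCompactSpace

instance : LocallyCompactSpace (Matrix.SpecialLinearGroup (Fin 2) ℚ_[p]) :=
  haveI : LocallyCompactSpace (Matrix (Fin 2) (Fin 2) ℚ_[p]) :=
    inferInstanceAs (LocallyCompactSpace (Fin 2 → Fin 2 → ℚ_[p]))
  Matrix.SpecialLinearGroup.isClosedEmbedding_val.locallyCompactSpace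

/-- The ring `ℤ[1/p]`, embedded diagonally in `ℝ × ℚ_p`. -/
def diag : Subring (ℝ × ℚ_[p]) where
  carrier := {x | ∃ (n : ℕ) (z : ℤ), x.1 * p ^ n = z ∧ x.2 * p ^ n = z}
  mul_mem' := by
    rintro x y ⟨n, z, h₁, h₂⟩ ⟨m, w, k₁, k₂⟩
    refine ⟨n + m, z * w, ?_, ?_⟩
    · push_cast; rw [← h₁, ← k₁, Prod.fst_mul]; ring
    · push_cast; rw [← h₂, ← k₂, Prod.snd_mul]; ring
  one_mem' := ⟨0, 1, by simp, by simp⟩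
  add_mem' := by
    rintro x y ⟨n, z, h₁, h₂⟩ ⟨m, w, k₁, k₂⟩
    refine ⟨n + m, z * p ^ m + w * p ^ n, ?_, ?_⟩
    · push_cast; rw [← h₁, ← k₁, Prod.fst_add]; ring
    · push_cast; rw [← h₂, ← k₂, Prod.snd_add]; ring
  zero_mem' := ⟨0, 0, by simp, by simp⟩
  neg_mem' := by
    rintro x ⟨n, z, h₁, h₂⟩
    refine ⟨n, -z, ?_, ?_⟩
    · push_cast; rw [← h₁, Prod.fst_neg]; ring
    · push_cast; rw [← h₂, Prod.snd_neg]; ring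

variable {p}

theorem intCast_mem_diag (z : ℤ) : ((z : ℝ), (z : ℚ_[p])) ∈ diag p := ⟨0, z, by simp, by simp⟩

theorem prime_zpow_mem_diag (k : ℤ) : ((p : ℝ) ^ k, (p : ℚ_[p]) ^ k) ∈ diag p := by
  have h₁ : (p : ℝ) ≠ 0 := by exact_mod_cast hp.out.ne_zero
  have h₂ : (p : ℚ_[p]) ≠ 0 := by exact_mod_cast hp.out.ne_zero
  obtain ⟨n, rfl | rfl⟩ := k.eq_nat_or_neg
  · exact ⟨0, (p : ℤ) ^ n, by simp, by simp⟩
  · exact ⟨n, 1, by simp [h₁], by simp [h₂]⟩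

theorem fst_eq_zero_iff {x : ℝ × ℚ_[p]} (hx : x ∈ diag p) : x.1 = 0 ↔ x.2 = 0 := by
  have h₁ : (p : ℝ) ≠ 0 := by exact_mod_cast hp.out.ne_zero
  have h₂ : (p : ℚ_[p]) ≠ 0 := by exact_mod_cast hp.out.ne_zero
  obtain ⟨n, z, h, h'⟩ := hx
  have e₁ : x.1 = 0 ↔ z = 0 := by
    rw [← Int.cast_eq_zero (α := ℝ), ← h]; simp [h₁]
  have e₂ : x.2 = 0 ↔ z = 0 := by
    rw [← Int.cast_eq_zero (α := ℚ_[p]), ← h']; simp [h₂]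
  rw [e₁, e₂]

theorem exists_int_of_norm_le_one {x : ℝ × ℚ_[p]} (hx : x ∈ diag p) (h : ‖x.2‖ ≤ 1) :
    ∃ z : ℤ, x = ((z : ℝ), (z : ℚ_[p])) := by
  have h₁ : (p : ℝ) ≠ 0 := by exact_mod_cast hp.out.ne_zero
  have h₂ : (p : ℚ_[p]) ≠ 0 := by exact_mod_cast hp.out.ne_zero
  obtain ⟨n, z, hn, hn'⟩ := hx
  have hz : ‖(z : ℚ_[p])‖ ≤ (p : ℝ) ^ (-n : ℤ) := by
    rw [← hn', norm_mul, norm_pow, Padic.norm_p, zpow_neg, zpow_natCast, inv_pow]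
    exact mul_le_of_le_one_left (by positivity) h
  obtain ⟨w, rfl⟩ := (Padic.norm_int_le_pow_iff_dvd z n).1 hz
  refine ⟨w, Prod.ext ?_ ?_⟩
  · have : x.1 * (p : ℝ) ^ n = w * p ^ n := by rw [hn]; push_cast; ring
    exact mul_right_cancel₀ (pow_ne_zero _ h₁) this
  · have : x.2 * (p : ℚ_[p]) ^ n = w * p ^ n := by rw [hn']; push_cast; ring
    exact mul_right_cancel₀ (pow_ne_zero _ h₂) this

theorem isClosed_diag : IsClosed (diag p : Set (ℝ × ℚ_[p])) := by
  have : DiscreteTopology (diag p).toAddSubgroup := by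
    refine discreteTopology_of_isOpen_singleton_zero ?_
    have ho : IsOpen (Metric.ball (0 : ℝ × ℚ_[p]) 1) := Metric.isOpen_ball
    convert! ho.preimage (continuous_subtype_val (p := fun x => x ∈ (diag p).toAddSubgroup))
    ext ⟨x, hx⟩
    constructor
    · intro h
      have : x = 0 := congrArg Subtype.val h
      subst this; simp
    · intro h
      have h' : ‖x‖ < 1 := by simpa using h
      obtain ⟨z, rfl⟩ := exists_int_of_norm_le_one hx ((norm_snd_le x).trans h'.le)
      have hz : ‖(z : ℝ)‖ < 1 := lt_of_le_of_lt (norm_fst_le ((z : ℝ), (z : ℚ_[p]))) h'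
      have : z = 0 := by
        rw [Real.norm_eq_abs] at hz
        have : |z| < 1 := by exact_mod_cast hz
        exact Int.abs_lt_one_iff.1 this
      subst this
      apply Subtype.ext; simp
  exact AddSubgroup.isClosed_of_discrete (H := (diag p).toAddSubgroup)

theorem exists_diag_norm_sub_lt (y : ℚ_[p]) {ε : ℝ} (hε : 0 < ε) :
    ∃ x ∈ diag p, ‖y - x.2‖ < ε := by
  have h₁ : (p : ℝ) ≠ 0 := by exact_mod_cast hp.out.ne_zero
  have h₂ : (p : ℚ_[p]) ≠ 0 := by exact_mod_cast hp.out.ne_zero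
  have hp1 : (1 : ℝ) < p := by exact_mod_cast hp.out.one_lt
  obtain ⟨n, hn⟩ := pow_unbounded_of_one_lt ‖y‖ hp1
  have hy : ‖y * p ^ n‖ ≤ 1 := by
    rw [norm_mul, norm_pow, Padic.norm_p, inv_pow, mul_inv_le_iff₀ (by positivity), one_mul]
    exact hn.le
  obtain ⟨z, hz⟩ := PadicInt.denseRange_natCast.exists_dist_lt (⟨y * p ^ n, hy⟩ : ℤ_[p])
    (show 0 < ε * ((p : ℝ) ^ n)⁻¹ by positivity)
  refine ⟨((z : ℝ) * (p : ℝ) ^ (-n : ℤ), (z : ℚ_[p]) * (p : ℚ_[p]) ^ (-n : ℤ)), ?_, ?_⟩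
  · exact (diag p).mul_mem (by exact_mod_cast intCast_mem_diag (p := p) z)
      (prime_zpow_mem_diag (-n))
  · have e : y - (z : ℚ_[p]) * (p : ℚ_[p]) ^ (-n : ℤ) = (y * p ^ n - z) * ((p : ℚ_[p]) ^ n)⁻¹ := by
      rw [zpow_neg, zpow_natCast]; field_simp
    have hz' : ‖y * p ^ n - z‖ < ε * ((p : ℝ) ^ n)⁻¹ := by
      exact hz
    rw [e, norm_mul, norm_inv, norm_pow, Padic.norm_p, inv_pow, inv_inv]
    have := mul_lt_mul_of_pos_right hz' (show (0 : ℝ) < p ^ n by positivity)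
    rwa [mul_assoc, inv_mul_cancel₀ (by positivity), mul_one] at this

variable (p)

/-- The diagonally embedded lattice `SL₂(ℤ[1/p])`. -/
def lattice : Subgroup (Amb p) where
  carrier := {g | ∀ i j, (g.1 i j, g.2 i j) ∈ diag p}
  mul_mem' := by
    intro g h hg hh i j
    have : ((g * h).1 i j, (g * h).2 i j) =
        (g.1 i 0, g.2 i 0) * (h.1 0 j, h.2 0 j) + (g.1 i 1, g.2 i 1) * (h.1 1 j, h.2 1 j) := by
      simp [Matrix.mul_apply, Fin.sum_univ_two]
    rw [this]
    exact (diag p).add_mem ((diag p).mul_mem (hg _ _) (hh _ _))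
      ((diag p).mul_mem (hg _ _) (hh _ _))
  one_mem' := by
    intro i j
    by_cases h : i = j
    · subst h; simp; exact (diag p).one_mem
    · simp [h]; exact (diag p).zero_mem
  inv_mem' := by
    intro g hg i j
    have h : ((g⁻¹).1 i j, (g⁻¹).2 i j) = (g.1⁻¹ i j, g.2⁻¹ i j) := rfl
    rw [h, Matrix.SpecialLinearGroup.SL2_inv_expl g.1, Matrix.SpecialLinearGroup.SL2_inv_expl g.2]
    fin_cases i <;> fin_cases j
    · simpa using hg 1 1
    · simpa using (diag p).neg_mem (hg 0 1)
    · simpa using (diag p).neg_mem (hg 1 0)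
    · simpa using hg 0 0

instance : IsClosed (lattice p : Set (Amb p)) := by
  have : (lattice p : Set (Amb p)) =
      ⋂ i, ⋂ j, (fun g : Amb p => (g.1 i j, g.2 i j)) ⁻¹' (diag p : Set (ℝ × ℚ_[p])) := by
    ext g; simp [lattice]
  rw [this]
  refine isClosed_iInter fun i => isClosed_iInter fun j => isClosed_diag.preimage ?_
  fun_prop

end Lattice

section Reduction

section Matrices

variable {R : Type*} [CommRing R]

/-- The matrix with rows `(a, b)` and `(c, d)`, as an element of `SL₂`. -/
def sl (a b c d : R) (h : a * d - b * c = 1) : Matrix.SpecialLinearGroup (Fin 2) R :=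
  ⟨!![a, b; c, d], by rw [Matrix.det_fin_two_of, h]⟩

variable {a b c d : R} (h : a * d - b * c = 1)

@[simp] theorem sl_zero_zero : sl a b c d h 0 0 = a := rfl

@[simp] theorem sl_zero_one : sl a b c d h 0 1 = b := rfl

@[simp] theorem sl_one_zero : sl a b c d h 1 0 = c := rfl

@[simp] theorem sl_one_one : sl a b c d h 1 1 = d := rfl

theorem sl_mul_apply (g k : Matrix.SpecialLinearGroup (Fin 2) R) (i j : Fin 2) :
    (g * k) i j = g i 0 * k 0 j + g i 1 * k 1 j := by
  rw [Matrix.SpecialLinearGroup.coe_mul, Matrix.mul_apply, Fin.sum_univ_two]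

theorem sl_ext {g k : Matrix.SpecialLinearGroup (Fin 2) R} (h₀₀ : g 0 0 = k 0 0)
    (h₀₁ : g 0 1 = k 0 1) (h₁₀ : g 1 0 = k 1 0) (h₁₁ : g 1 1 = k 1 1) : g = k := by
  ext i j
  fin_cases i <;> fin_cases j <;> assumption

theorem sl_det (g : Matrix.SpecialLinearGroup (Fin 2) R) : g 0 0 * g 1 1 - g 0 1 * g 1 0 = 1 := by
  have := g.det_coe; rwa [Matrix.det_fin_two] at this

theorem forall_fin_two_two {P : Fin 2 → Fin 2 → Prop} :
    (∀ i j, P i j) ↔ P 0 0 ∧ P 0 1 ∧ P 1 0 ∧ P 1 1 := by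
  simp only [Fin.forall_fin_two, and_assoc]

end Matrices

theorem exists_slInt_abs_le (g : Matrix.SpecialLinearGroup (Fin 2) ℝ) {ε : ℝ} (hε : 0 < ε)
    (hg : ∀ γ : Matrix.SpecialLinearGroup (Fin 2) ℤ,
      ε ^ 2 ≤ (g * γ) 0 0 ^ 2 + (g * γ) 1 0 ^ 2) :
    ∃ γ : Matrix.SpecialLinearGroup (Fin 2) ℤ, ∀ i j, |(g * γ) i j| ≤ 3 + 2 / ε ^ 4 := by
  obtain ⟨γ, hγ⟩ := ModularGroup.exists_smul_mem_fd (g⁻¹ • UpperHalfPlane.I)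
  have hτ : γ • (g⁻¹ • UpperHalfPlane.I) =
      ((γ : Matrix.SpecialLinearGroup (Fin 2) ℝ) * g⁻¹) • UpperHalfPlane.I := by
    rw [mul_smul]; rfl
  rw [hτ] at hγ
  have hk : g * (γ⁻¹ : Matrix.SpecialLinearGroup (Fin 2) ℤ) =
      ((γ : Matrix.SpecialLinearGroup (Fin 2) ℝ) * g⁻¹)⁻¹ := by simp
  have hg' := hg γ⁻¹
  refine ⟨γ⁻¹, ?_⟩
  rw [hk] at hg' ⊢
  generalize (γ : Matrix.SpecialLinearGroup (Fin 2) ℝ) * g⁻¹ = k at hγ hg' ⊢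
  rw [Matrix.SpecialLinearGroup.SL2_inv_expl] at hg' ⊢
  simp only [Matrix.cons_val', Matrix.cons_val_zero, Matrix.cons_val_one,
    Matrix.cons_val_fin_one] at hg'
  have h3 := ModularGroup.three_le_four_mul_im_sq_of_mem_fd hγ
  have hre : |(k • UpperHalfPlane.I : UpperHalfPlane).re| ≤ 1 / 2 := hγ.2
  have hdet : k 0 0 * k 1 1 - k 0 1 * k 1 0 = 1 := by
    have := k.det_coe; rwa [Matrix.det_fin_two] at this
  have hN : 0 < k 1 0 ^ 2 + k 1 1 ^ 2 := by
    have := pow_pos hε 2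
    nlinarith
  have hcoe : ((k • UpperHalfPlane.I : UpperHalfPlane) : ℂ) =
      (k 0 0 * Complex.I + k 0 1) / (k 1 0 * Complex.I + k 1 1) := by
    simpa using UpperHalfPlane.coe_specialLinearGroup_apply k UpperHalfPlane.I
  have hns₀ : ∀ x y : ℝ, Complex.normSq (x * Complex.I + y) = x ^ 2 + y ^ 2 := by
    intro x y; simp [Complex.normSq_apply]; ring
  have him : (k • UpperHalfPlane.I : UpperHalfPlane).im = 1 / (k 1 0 ^ 2 + k 1 1 ^ 2) := by
    rw [← UpperHalfPlane.coe_im, hcoe, Complex.div_im, hns₀]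
    simp
    field_simp
    linarith
  have hns : (k • UpperHalfPlane.I : UpperHalfPlane).re ^ 2 +
      (k • UpperHalfPlane.I : UpperHalfPlane).im ^ 2 =
      (k 0 0 ^ 2 + k 0 1 ^ 2) / (k 1 0 ^ 2 + k 1 1 ^ 2) := by
    rw [← hns₀ (k 0 0), ← hns₀ (k 1 0), ← Complex.normSq_div, ← hcoe, Complex.normSq_apply]
    simp [sq]
  generalize (k • UpperHalfPlane.I : UpperHalfPlane).re = r at hre hns
  generalize (k • UpperHalfPlane.I : UpperHalfPlane).im = y at h3 him hns
  have hN2 : k 1 0 ^ 2 + k 1 1 ^ 2 ≤ 2 := by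
    by_contra! h
    have : y < 1 / 2 := by rw [him]; exact one_div_lt_one_div_of_lt (by norm_num) h
    have : 0 < y := by rw [him]; positivity
    nlinarith
  have hy : y ≤ 1 / ε ^ 2 := by
    rw [him]; exact one_div_le_one_div_of_le (by positivity) (by linarith)
  have hy0 : 0 < y := by rw [him]; positivity
  have hy2 : y ^ 2 ≤ 1 / ε ^ 4 := by
    calc y ^ 2 ≤ (1 / ε ^ 2) ^ 2 := by gcongr
      _ = _ := by rw [div_pow, ← pow_mul]; simp
  have hr : r ^ 2 ≤ 1 / 4 := by
    have := sq_le_sq' (abs_le.1 hre).1 (abs_le.1 hre).2; linarith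
  have hM : k 0 0 ^ 2 + k 0 1 ^ 2 ≤ 2 * (1 / 4 + 1 / ε ^ 4) := by
    rw [eq_div_iff hN.ne'] at hns
    rw [← hns, mul_comm]
    gcongr
  have hE : 2 / ε ^ 4 = 2 * (1 / ε ^ 4) := by ring
  have hE0 : 0 < 1 / ε ^ 4 := by positivity
  have key : ∀ x : ℝ, x ^ 2 ≤ 3 + 2 / ε ^ 4 → |x| ≤ 3 + 2 / ε ^ 4 := by
    intro x hx
    refine abs_le_of_sq_le_sq (hx.trans ?_) (by positivity)
    nlinarith
  intro i j
  fin_cases i <;> fin_cases j <;> simp <;> apply key <;>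
    nlinarith [sq_nonneg (k 0 0), sq_nonneg (k 0 1), sq_nonneg (k 1 0), sq_nonneg (k 1 1)]

section Arithmetic

variable {p : ℕ} [hp : Fact p.Prime]

/-- The upper unipotent lattice element attached to an element of `ℤ[1/p]`. -/
theorem upper_mem_lattice {x : ℝ × ℚ_[p]} (hx : x ∈ diag p) :
    ((sl 1 x.1 0 1 (by simp), sl 1 x.2 0 1 (by simp)) : Amb p) ∈ lattice p := by
  intro i j
  fin_cases i <;> fin_cases j
  · exact (diag p).one_mem
  · exact hx
  · exact (diag p).zero_mem
  · exact (diag p).one_mem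

theorem lower_mem_lattice {x : ℝ × ℚ_[p]} (hx : x ∈ diag p) :
    ((sl 1 0 x.1 1 (by simp), sl 1 0 x.2 1 (by simp)) : Amb p) ∈ lattice p := by
  intro i j
  fin_cases i <;> fin_cases j
  · exact (diag p).one_mem
  · exact (diag p).zero_mem
  · exact hx
  · exact (diag p).one_mem

theorem weyl_mem_lattice :
    ((sl 0 1 (-1) 0 (by simp), sl 0 1 (-1) 0 (by simp)) : Amb p) ∈ lattice p := by
  intro i j
  fin_cases i <;> fin_cases j
  · exact (diag p).zero_mem
  · exact (diag p).one_mem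
  · exact (diag p).neg_mem (diag p).one_mem
  · exact (diag p).zero_mem

theorem prime_ne_zero_real : (p : ℝ) ≠ 0 := by exact_mod_cast hp.out.ne_zero

theorem prime_ne_zero_padic : (p : ℚ_[p]) ≠ 0 := by exact_mod_cast hp.out.ne_zero

theorem diagonal_mem_lattice (k : ℤ) :
    ((sl ((p : ℝ) ^ k) 0 0 ((p : ℝ) ^ (-k)) (by
        rw [← zpow_add₀ prime_ne_zero_real]; simp),
      sl ((p : ℚ_[p]) ^ k) 0 0 ((p : ℚ_[p]) ^ (-k)) (by
        rw [← zpow_add₀ prime_ne_zero_padic]; simp)) : Amb p) ∈ lattice p := by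
  intro i j
  fin_cases i <;> fin_cases j
  · exact prime_zpow_mem_diag k
  · exact (diag p).zero_mem
  · exact (diag p).zero_mem
  · exact prime_zpow_mem_diag (-k)

/-- The class of `h` modulo the lattice contains a `p`-adically integral matrix. -/
def HasIntegralRep (h : Matrix.SpecialLinearGroup (Fin 2) ℚ_[p]) : Prop :=
  ∃ γ ∈ lattice p, ∀ i j, ‖(h * γ.2) i j‖ ≤ 1

theorem HasIntegralRep.of_mul {h : Matrix.SpecialLinearGroup (Fin 2) ℚ_[p]} {γ : Amb p}
    (hγ : γ ∈ lattice p) (hh : HasIntegralRep (h * γ.2)) : HasIntegralRep h := by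
  obtain ⟨δ, hδ, H⟩ := hh
  refine ⟨γ * δ, (lattice p).mul_mem hγ hδ, ?_⟩
  rwa [Prod.snd_mul, ← mul_assoc]

theorem hasIntegralRep_of_small {h : Matrix.SpecialLinearGroup (Fin 2) ℚ_[p]}
    (hd : ‖h 1 1‖ = 1) (hc : ‖h 1 0‖ ≤ 1) (hbc : ‖h 0 1‖ * ‖h 1 0‖ < 1) : HasIntegralRep h := by
  have hdet : h 0 0 * h 1 1 - h 0 1 * h 1 0 = 1 := sl_det h
  have ha : ‖h 0 0‖ = 1 := by
    have e : h 0 0 * h 1 1 = 1 + h 0 1 * h 1 0 := by linear_combination hdet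
    have : ‖h 0 0 * h 1 1‖ = 1 := by
      rw [e, Padic.add_eq_max_of_ne (by rw [norm_one, norm_mul]; exact hbc.ne'), norm_one, norm_mul,
        max_eq_left hbc.le]
    rwa [norm_mul, hd, mul_one] at this
  obtain ⟨x, hx, hxy⟩ := exists_diag_norm_sub_lt (h 0 1 / h 0 0) one_pos
  have ha0 : h 0 0 ≠ 0 := by rw [← norm_ne_zero_iff, ha]; exact one_ne_zero
  have hx2 : ‖x.2‖ ≤ max 1 ‖h 0 1‖ := by
    have e : x.2 = -(h 0 1 / h 0 0 - x.2) + h 0 1 / h 0 0 := by ring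
    rw [e]
    refine (Padic.nonarchimedean _ _).trans (max_le_max (by rw [norm_neg]; exact hxy.le) ?_)
    rw [norm_div, ha, div_one]
  refine ⟨_, upper_mem_lattice ((diag p).neg_mem hx), ?_⟩
  rw [forall_fin_two_two]
  simp only [sl_mul_apply, sl_zero_zero, sl_zero_one, sl_one_zero, sl_one_one, Prod.snd_neg,
    mul_neg, mul_one, mul_zero, add_zero]
  refine ⟨?_, ?_, ?_, ?_⟩
  · exact ha.le
  · have e : -(h 0 0 * x.2) + h 0 1 = h 0 0 * (h 0 1 / h 0 0 - x.2) := by field_simp; ring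
    rw [e, norm_mul, ha, one_mul]; exact hxy.le
  · exact hc
  · refine (Padic.nonarchimedean _ _).trans (max_le ?_ hd.le)
    rw [norm_neg, norm_mul]
    calc ‖h 1 0‖ * ‖x.2‖ ≤ ‖h 1 0‖ * max 1 ‖h 0 1‖ := by gcongr
      _ ≤ 1 := by
        rcases max_choice 1 ‖h 0 1‖ with h' | h' <;> rw [h']
        · simpa using hc
        · rw [mul_comm]; exact hbc.le

theorem hasIntegralRep_of_norm_eq_one {h : Matrix.SpecialLinearGroup (Fin 2) ℚ_[p]}
    (hd : ‖h 1 1‖ = 1) : HasIntegralRep h := by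
  have hd0 : h 1 1 ≠ 0 := by rw [← norm_ne_zero_iff, hd]; exact one_ne_zero
  obtain ⟨x, hx, hxy⟩ := exists_diag_norm_sub_lt (h 1 0 / h 1 1)
    (show 0 < 1 / (1 + ‖h 0 1‖) by positivity)
  have e : h 1 0 + -(h 1 1 * x.2) = h 1 1 * (h 1 0 / h 1 1 - x.2) := by field_simp; ring
  have hlt : ‖h 1 0 + -(h 1 1 * x.2)‖ * (1 + ‖h 0 1‖) < 1 := by
    rw [e, norm_mul, hd, one_mul]; rwa [lt_div_iff₀ (by positivity)] at hxy
  have h0 := norm_nonneg (h 1 0 + -(h 1 1 * x.2))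
  have h1 := norm_nonneg (h 0 1)
  refine HasIntegralRep.of_mul (lower_mem_lattice ((diag p).neg_mem hx))
    (hasIntegralRep_of_small ?_ ?_ ?_) <;> simp [sl_mul_apply]
  · exact hd
  · nlinarith
  · nlinarith

theorem hasIntegralRep_of_ne_zero {h : Matrix.SpecialLinearGroup (Fin 2) ℚ_[p]}
    (hd : h 1 1 ≠ 0) : HasIntegralRep h := by
  refine HasIntegralRep.of_mul (diagonal_mem_lattice (h 1 1).valuation)
    (hasIntegralRep_of_norm_eq_one ?_)
  simp only [sl_mul_apply, sl_zero_one, sl_one_one, mul_zero, zero_add]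
  rw [norm_mul, Padic.norm_p_zpow, Padic.norm_eq_zpow_neg_valuation hd, neg_neg,
    ← zpow_add₀ prime_ne_zero_real, neg_add_cancel, zpow_zero]

theorem hasIntegralRep (h : Matrix.SpecialLinearGroup (Fin 2) ℚ_[p]) : HasIntegralRep h := by
  by_cases hd : h 1 1 = 0
  · have hdet : h 0 0 * h 1 1 - h 0 1 * h 1 0 = 1 := sl_det h
    refine HasIntegralRep.of_mul weyl_mem_lattice (hasIntegralRep_of_ne_zero ?_)
    simp [sl_mul_apply]
    rintro hc
    rw [hd, hc] at hdet
    simp at hdet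
  · exact hasIntegralRep_of_ne_zero hd

end Arithmetic

end Reduction

section ThickPart

open Matrix

variable {p : ℕ} [hp : Fact p.Prime]

/-- The product of the real and the `p`-adic norm of the image of a vector. -/
noncomputable def size (g : Amb p) (w : Fin 2 → ℝ × ℚ_[p]) : ℝ :=
  ‖g.1.1 *ᵥ fun i => (w i).1‖ * ‖g.2.1 *ᵥ fun i => (w i).2‖

/-- The matrices that do not shrink nonzero vectors of `ℤ[1/p]²` below size `ε`. -/
def thick (p : ℕ) [Fact p.Prime] (ε : ℝ) : Set (Amb p) :=
  {g | ∀ w : Fin 2 → ℝ × ℚ_[p], (∀ i, w i ∈ diag p) → w ≠ 0 → ε ≤ size g w}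

theorem norm_fin_two {E : Type*} [SeminormedAddGroup E] (v : Fin 2 → E) :
    ‖v‖ = max ‖v 0‖ ‖v 1‖ := by
  apply le_antisymm
  · rw [pi_norm_le_iff_of_nonneg (by positivity), Fin.forall_fin_two]
    exact ⟨le_max_left _ _, le_max_right _ _⟩
  · exact max_le (norm_le_pi_norm v 0) (norm_le_pi_norm v 1)

theorem size_eq (g : Amb p) (w : Fin 2 → ℝ × ℚ_[p]) :
    size g w = max |g.1 0 0 * (w 0).1 + g.1 0 1 * (w 1).1| |g.1 1 0 * (w 0).1 + g.1 1 1 * (w 1).1| *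
      max ‖g.2 0 0 * (w 0).2 + g.2 0 1 * (w 1).2‖ ‖g.2 1 0 * (w 0).2 + g.2 1 1 * (w 1).2‖ := by
  rw [size, norm_fin_two, norm_fin_two]
  simp [Matrix.mulVec, dotProduct, Fin.sum_univ_two]

theorem continuous_size (w : Fin 2 → ℝ × ℚ_[p]) : Continuous fun g : Amb p => size g w := by
  simp_rw [size_eq]
  fun_prop

theorem isClosed_thick (ε : ℝ) : IsClosed (thick p ε) := by
  have : thick p ε = ⋂ w : Fin 2 → ℝ × ℚ_[p], ⋂ (_ : ∀ i, w i ∈ diag p), ⋂ (_ : w ≠ 0),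
      {g | ε ≤ size g w} := by
    ext g; simp [thick]
  rw [this]
  exact isClosed_iInter fun w => isClosed_iInter fun _ => isClosed_iInter fun _ =>
    isClosed_le continuous_const (continuous_size w)

/-- The action of a pair of matrices on a pair of vectors. -/
noncomputable def act (γ : Amb p) (w : Fin 2 → ℝ × ℚ_[p]) (i : Fin 2) : ℝ × ℚ_[p] :=
  ((γ.1.1 *ᵥ fun i => (w i).1) i, (γ.2.1 *ᵥ fun i => (w i).2) i)

theorem size_mul (g γ : Amb p) (w : Fin 2 → ℝ × ℚ_[p]) : size (g * γ) w = size g (act γ w) := by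
  simp only [size, act, Matrix.mulVec_mulVec]
  rfl

theorem act_mul (g γ : Amb p) (w : Fin 2 → ℝ × ℚ_[p]) : act (g * γ) w = act g (act γ w) := by
  funext i
  simp only [act, Matrix.mulVec_mulVec]
  rfl

theorem act_one (w : Fin 2 → ℝ × ℚ_[p]) : act 1 w = w := by
  funext i
  simp [act]

theorem act_zero (g : Amb p) : act g 0 = 0 := by
  funext i
  simp [act, Matrix.mulVec, dotProduct]

theorem act_apply (g : Amb p) (w : Fin 2 → ℝ × ℚ_[p]) (i : Fin 2) :
    act g w i = (g.1 i 0, g.2 i 0) * w 0 + (g.1 i 1, g.2 i 1) * w 1 := by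
  ext <;> simp [act, Matrix.mulVec, dotProduct, Fin.sum_univ_two]

theorem act_mem_diag {γ : Amb p} (hγ : γ ∈ lattice p) {w : Fin 2 → ℝ × ℚ_[p]}
    (hw : ∀ i, w i ∈ diag p) (i : Fin 2) : act γ w i ∈ diag p := by
  rw [act_apply]
  exact (diag p).add_mem ((diag p).mul_mem (hγ _ _) (hw _)) ((diag p).mul_mem (hγ _ _) (hw _))

theorem act_ne_zero (γ : Amb p) {w : Fin 2 → ℝ × ℚ_[p]} (hw : w ≠ 0) : act γ w ≠ 0 := by
  intro h
  apply hw
  rw [← act_one w, ← inv_mul_cancel γ, act_mul, h, act_zero]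

theorem mul_mem_thick {ε : ℝ} {g γ : Amb p} (hg : g ∈ thick p ε) (hγ : γ ∈ lattice p) :
    g * γ ∈ thick p ε := by
  intro w hw hw0
  rw [size_mul]
  exact hg _ (act_mem_diag hγ hw) (act_ne_zero γ hw0)

/-- The image of `thick` in the quotient by the lattice. -/
def thickQ (p : ℕ) [Fact p.Prime] (ε : ℝ) : Set (Amb p ⧸ lattice p) :=
  (QuotientGroup.mk : Amb p → Amb p ⧸ lattice p) '' thick p ε

theorem mk_mem_thickQ {ε : ℝ} {g : Amb p} :
    (QuotientGroup.mk g : Amb p ⧸ lattice p) ∈ thickQ p ε ↔ g ∈ thick p ε := by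
  constructor
  · rintro ⟨h, hh, e⟩
    rw [QuotientGroup.eq] at e
    simpa using mul_mem_thick hh e
  · exact fun h => ⟨g, h, rfl⟩

theorem isClosed_thickQ (ε : ℝ) : IsClosed (thickQ p ε) := by
  rw [← (QuotientGroup.isQuotientMap_mk (lattice p)).isClosed_preimage]
  convert! isClosed_thick (p := p) ε
  ext g
  exact mk_mem_thickQ

theorem isCompact_setOf_entries_le (M : ℝ) :
    IsCompact {g : Amb p | (∀ i j, |g.1 i j| ≤ M) ∧ ∀ i j, ‖g.2 i j‖ ≤ 1} := by
  have h₁ : IsCompact {A : Matrix (Fin 2) (Fin 2) ℝ | ∀ i j, |A i j| ≤ M} := by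
    have := isCompact_univ_pi fun _ : Fin 2 => isCompact_univ_pi fun _ : Fin 2 =>
      isCompact_closedBall (0 : ℝ) M
    convert! this
    ext A
    change _ ↔ ∀ i ∈ univ, ∀ j ∈ univ, A i j ∈ Metric.closedBall _ _
    simp
  have h₂ : IsCompact {A : Matrix (Fin 2) (Fin 2) ℚ_[p] | ∀ i j, ‖A i j‖ ≤ 1} := by
    have := isCompact_univ_pi fun _ : Fin 2 => isCompact_univ_pi fun _ : Fin 2 =>
      isCompact_closedBall (0 : ℚ_[p]) 1
    convert! this
    ext A
    change _ ↔ ∀ i ∈ univ, ∀ j ∈ univ, A i j ∈ Metric.closedBall _ _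
    simp
  exact (Matrix.SpecialLinearGroup.isClosedEmbedding_val.isCompact_preimage h₁).prod
    (Matrix.SpecialLinearGroup.isClosedEmbedding_val.isCompact_preimage h₂)

theorem slInt_mem_lattice (γ : Matrix.SpecialLinearGroup (Fin 2) ℤ) :
    ((γ : Matrix.SpecialLinearGroup (Fin 2) ℝ), (γ : Matrix.SpecialLinearGroup (Fin 2) ℚ_[p])) ∈
      lattice p := by
  intro i j
  exact intCast_mem_diag (γ i j)

theorem norm_mul_le_one {g k : Matrix.SpecialLinearGroup (Fin 2) ℚ_[p]} (hg : ∀ i j, ‖g i j‖ ≤ 1)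
    (hk : ∀ i j, ‖k i j‖ ≤ 1) (i j : Fin 2) : ‖(g * k) i j‖ ≤ 1 := by
  rw [sl_mul_apply]
  refine (Padic.nonarchimedean _ _).trans (max_le ?_ ?_) <;> rw [norm_mul] <;>
    exact mul_le_one₀ (hg _ _) (norm_nonneg _) (hk _ _)

theorem exists_mul_mem_of_mem_thick {ε : ℝ} (hε : 0 < ε) {g : Amb p} (hg : g ∈ thick p ε) :
    ∃ γ ∈ lattice p, g * γ ∈
      {g : Amb p | (∀ i j, |g.1 i j| ≤ 3 + 2 / ε ^ 4) ∧ ∀ i j, ‖g.2 i j‖ ≤ 1} := by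
  obtain ⟨γ, hγ, hrep⟩ := hasIntegralRep g.2
  have hi : ∀ (δ : Matrix.SpecialLinearGroup (Fin 2) ℤ) (i j : Fin 2),
      ‖(g.2 * γ.2 * (δ : Matrix.SpecialLinearGroup (Fin 2) ℚ_[p])) i j‖ ≤ 1 := fun δ =>
    norm_mul_le_one hrep fun i j => Padic.norm_int_le_one (δ i j)
  obtain ⟨δ, hδ⟩ := exists_slInt_abs_le (g.1 * γ.1) hε (by
    intro δ
    have hm := mul_mem_thick hg ((lattice p).mul_mem hγ (slInt_mem_lattice δ))
    have h := hm ![1, 0] (by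
      rw [Fin.forall_fin_two]
      exact ⟨(diag p).one_mem, (diag p).zero_mem⟩) (by
      intro h
      simpa using congrFun h 0)
    rw [size_eq] at h
    simp only [Matrix.cons_val_zero, Matrix.cons_val_one, Prod.fst_one, Prod.snd_one,
      Prod.fst_zero, Prod.snd_zero, mul_one, mul_zero, add_zero, Prod.fst_mul, Prod.snd_mul,
      ← mul_assoc] at h
    have h' : ε ≤ max |(g.1 * γ.1 * (δ : Matrix.SpecialLinearGroup (Fin 2) ℝ)) 0 0|
        |(g.1 * γ.1 * (δ : Matrix.SpecialLinearGroup (Fin 2) ℝ)) 1 0| :=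
      h.trans (mul_le_of_le_one_right (by positivity) (max_le (hi δ 0 0) (hi δ 1 0)))
    generalize g.1 * γ.1 * (δ : Matrix.SpecialLinearGroup (Fin 2) ℝ) = k at h' ⊢
    rcases le_max_iff.1 h' with h' | h'
    · have := pow_le_pow_left₀ hε.le h' 2
      rw [sq_abs] at this
      nlinarith [sq_nonneg (k 1 0)]
    · have := pow_le_pow_left₀ hε.le h' 2
      rw [sq_abs] at this
      nlinarith [sq_nonneg (k 0 0)])
  refine ⟨_, (lattice p).mul_mem hγ (slInt_mem_lattice δ), ?_, ?_⟩
  · simpa only [Prod.fst_mul, ← mul_assoc] using hδ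
  · simpa only [Prod.snd_mul, ← mul_assoc] using hi δ

theorem isCompact_thickQ {ε : ℝ} (hε : 0 < ε) : IsCompact (thickQ p ε) := by
  refine ((isCompact_setOf_entries_le (p := p) (3 + 2 / ε ^ 4)).image
    (QuotientGroup.continuous_mk (N := lattice p))).of_isClosed_subset (isClosed_thickQ ε) ?_
  rintro _ ⟨g, hg, rfl⟩
  obtain ⟨γ, hγ, h⟩ := exists_mul_mem_of_mem_thick hε hg
  exact ⟨g * γ, h, QuotientGroup.mk_mul_of_mem g hγ⟩

end ThickPart

section Flows

variable (p : ℕ) [hp : Fact p.Prime]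

theorem zpow_of_map_add {G : Type*} [Group G] (f : ℤ → G) (hf : ∀ s t, f (s + t) = f s * f t)
    (t : ℤ) : f 1 ^ t = f t := by
  let F : Multiplicative ℤ →* G :=
    MonoidHom.mk' (fun s => f s.toAdd) fun s t => hf s.toAdd t.toAdd
  have := map_zpow F (Multiplicative.ofAdd 1) t
  rw [← ofAdd_zsmul, smul_eq_mul, mul_one] at this
  exact this.symm

/-- The real diagonal matrix with entries `2 ^ t` and `2 ^ (-t)`. -/
noncomputable def realDiag (t : ℤ) : Amb p :=
  (sl ((2 : ℝ) ^ t) 0 0 ((2 : ℝ) ^ (-t)) (by rw [← zpow_add₀ two_ne_zero]; simp), 1)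

/-- The `p`-adic diagonal matrix with entries `p ^ (-l)` and `p ^ l`. -/
noncomputable def padicDiag (l : ℤ) : Amb p :=
  (1, sl ((p : ℚ_[p]) ^ (-l)) 0 0 ((p : ℚ_[p]) ^ l) (by
    rw [← zpow_add₀ prime_ne_zero_padic]; simp))

/-- The real upper unipotent matrix with entry `s`. -/
noncomputable def unip (s : ℝ) : Amb p := (sl 1 s 0 1 (by simp), 1)

theorem realDiag_add (s t : ℤ) : realDiag p (s + t) = realDiag p s * realDiag p t := by
  refine Prod.ext (sl_ext ?_ ?_ ?_ ?_) (by simp [realDiag]) <;>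
    simp [realDiag, sl_mul_apply, zpow_add₀, mul_comm]

theorem padicDiag_add (s t : ℤ) : padicDiag p (s + t) = padicDiag p s * padicDiag p t := by
  refine Prod.ext (by simp [padicDiag]) (sl_ext ?_ ?_ ?_ ?_) <;>
    simp [padicDiag, sl_mul_apply, zpow_add₀ prime_ne_zero_padic, mul_comm]

theorem unip_add (s t : ℝ) : unip p (s + t) = unip p s * unip p t := by
  refine Prod.ext (sl_ext ?_ ?_ ?_ ?_) (by simp [unip]) <;>
    simp [unip, sl_mul_apply, add_comm]

theorem continuous_unip : Continuous (unip p) := by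
  refine Continuous.prodMk ?_ continuous_const
  refine continuous_induced_rng.2 (continuous_matrix ?_)
  rw [forall_fin_two_two]
  exact ⟨continuous_const, continuous_id, continuous_const, continuous_const⟩

/-- The system of the diagonal flows and the real horocyclic flow on
`(SL₂(ℝ) × SL₂(ℚ_p)) / SL₂(ℤ[1/p])`. -/
noncomputable def flow : HoroSystem (Amb p) (Amb p ⧸ lattice p) where
  a := realDiag p 1
  b := padicDiag p 1
  u := unip p
  u_add := unip_add p
  a_mul_u := by
    intro s
    refine Prod.ext (sl_ext ?_ ?_ ?_ ?_) (by simp [unip, realDiag]) <;>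
      simp [unip, realDiag, sl_mul_apply]
    ring
  commute_a_b := by
    change _ = _
    ext1 <;> simp [realDiag, padicDiag]
  commute_u_b := by
    intro s
    change _ = _
    ext1 <;> simp [unip, padicDiag]
  continuous_u_smul := ((continuous_unip p).comp continuous_fst).smul continuous_snd
  continuous_smul := fun g => continuous_const_smul g

theorem flow_a_zpow (t : ℤ) : (flow p).a ^ t = realDiag p t :=
  zpow_of_map_add (realDiag p) (realDiag_add p) t

theorem flow_b_zpow (l : ℤ) : (flow p).b ^ l = padicDiag p l :=
  zpow_of_map_add (padicDiag p) (padicDiag_add p) l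

variable {p}

theorem mk_mem_stays {ε : ℝ} {h : Amb p} :
    (QuotientGroup.mk h : Amb p ⧸ lattice p) ∈ (flow p).stays (thickQ p ε) ↔
      ∀ i l : ℤ, realDiag p i * (padicDiag p l * h) ∈ thick p ε := by
  simp only [HoroSystem.stays, mem_ofPred_eq, flow_a_zpow, flow_b_zpow, ← mk_mem_thickQ]
  rfl

theorem snd_ne_zero_of_mem_stays {ε : ℝ} (hε : 0 < ε) {h : Amb p}
    (hh : (QuotientGroup.mk h : Amb p ⧸ lattice p) ∈ (flow p).stays (thickQ p ε))
    {w : Fin 2 → ℝ × ℚ_[p]} (hw : ∀ i, w i ∈ diag p) (hw0 : w ≠ 0) :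
    h.1 1 0 * (w 0).1 + h.1 1 1 * (w 1).1 ≠ 0 := by
  intro h0
  rw [mk_mem_stays] at hh
  have key : ∀ n : ℕ, ε ≤ (1 / 2) ^ n * size h w := by
    intro n
    have := hh (-n) 0 w hw hw0
    rw [size_eq] at this ⊢
    have e : padicDiag p 0 = 1 := by
      refine Prod.ext rfl (sl_ext ?_ ?_ ?_ ?_) <;> simp [padicDiag]
    rw [e, one_mul] at this
    simp only [realDiag, Prod.fst_mul, Prod.snd_mul, sl_mul_apply, sl_zero_zero, sl_zero_one,
      sl_one_zero, sl_one_one, zero_mul, add_zero, zero_add, one_mul, mul_assoc, ← mul_add, h0,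
      mul_zero, abs_zero] at this ⊢
    rw [max_eq_left (abs_nonneg _)] at this ⊢
    rw [abs_mul, abs_of_pos (by positivity), zpow_neg, zpow_natCast, mul_assoc] at this
    simpa using this
  have hlim : Tendsto (fun n : ℕ => (1 / 2 : ℝ) ^ n * size h w) atTop (𝓝 (0 * size h w)) :=
    (tendsto_pow_atTop_nhds_zero_of_lt_one (by norm_num) (by norm_num)).mul_const _
  rw [zero_mul] at hlim
  exact absurd (ge_of_tendsto' hlim key) (not_le.2 hε)

theorem not_scalar_of_return {ε : ℝ} (hε : 0 < ε) {h g : Amb p} {k : ℕ} (hk : 1 ≤ k)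
    (hh : (QuotientGroup.mk h : Amb p ⧸ lattice p) ∈ (flow p).stays (thickQ p ε))
    (hg : (flow p).b ^ k • (QuotientGroup.mk h : Amb p ⧸ lattice p) = g • QuotientGroup.mk h)
    (h₁ : |g.1 0 0 - 1| < 1) (h₂ : ‖g.2 0 0 - 1‖ < 1) :
    g.1 1 1 - g.1 0 0 ≠ 0 ∨ g.1 1 0 ≠ 0 := by
  by_contra! hcon
  obtain ⟨he, hC⟩ := hcon
  have hA : g.1 0 0 = 1 := by
    have hd := sl_det g.1
    rw [hC, mul_zero, sub_zero, show g.1 1 1 = g.1 0 0 by linarith] at hd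
    have := (abs_lt.1 h₁).1
    nlinarith
  have hD : g.1 1 1 = 1 := by linarith
  have hb : (flow p).b ^ k = padicDiag p k := by rw [← flow_b_zpow, zpow_natCast]
  obtain ⟨γ, hγ, e⟩ : ∃ γ ∈ lattice p, padicDiag p k * h * γ = g * h := by
    rw [hb] at hg
    have : (QuotientGroup.mk (padicDiag p k * h) : Amb p ⧸ lattice p) =
      QuotientGroup.mk (g * h) := hg
    rw [QuotientGroup.eq] at this
    exact ⟨_, this, mul_inv_cancel_left _ _⟩
  have e1 : ∀ j, h.1 1 0 * γ.1 0 j + h.1 1 1 * γ.1 1 j = h.1 1 j := by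
    intro j
    have := congrArg (fun q : Amb p => q.1 1 j) e
    simpa [padicDiag, sl_mul_apply, hC, hD] using this
  have col : ∀ j, act γ (Pi.single j 1) = Pi.single j 1 := by
    intro j
    by_contra hne
    have hm : ∀ i, (Pi.single j 1 : Fin 2 → ℝ × ℚ_[p]) i ∈ diag p := by
      intro i
      by_cases hij : i = j
      · subst hij; rw [Pi.single_eq_same]; exact (diag p).one_mem
      · rw [Pi.single_eq_of_ne hij]; exact (diag p).zero_mem
    refine snd_ne_zero_of_mem_stays hε hh
      (w := act γ (Pi.single j 1) - Pi.single j 1)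
      (fun i => (diag p).sub_mem (act_mem_diag hγ hm i) (hm i)) (sub_ne_zero.2 hne) ?_
    have := e1 j
    simp only [Pi.sub_apply, act_apply]
    fin_cases j
    · simp at this ⊢; linarith
    · simp at this ⊢; linarith
  have hγ1 : γ = 1 := by
    have c0 := fun i => congrFun (col 0) i
    have c1 := fun i => congrFun (col 1) i
    simp only [act_apply, Fin.forall_fin_two, Prod.ext_iff] at c0 c1
    refine Prod.ext (sl_ext ?_ ?_ ?_ ?_) (sl_ext ?_ ?_ ?_ ?_) <;> simp at c0 c1 ⊢ <;> tauto
  rw [hγ1, mul_one, mul_left_inj] at e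
  have hn : ‖g.2 0 0‖ ≤ 1 := by
    have : g.2 0 0 = (g.2 0 0 - 1) + 1 := by ring
    rw [this]
    exact (Padic.nonarchimedean _ _).trans (max_le h₂.le (by simp))
  rw [← e] at hn
  simp only [padicDiag, sl_zero_zero, Padic.norm_p_zpow, neg_neg, zpow_natCast] at hn
  have hp1 : (1 : ℝ) < p := by exact_mod_cast hp.out.one_lt
  exact absurd hn (not_le.2 (one_lt_pow₀ hp1 (by omega)))

end Flows

section Scales

/-- One of the values of a quadratic polynomial at three separated points is comparable to its
nonconstant coefficients. -/
theorem exists_large_value (B E F : ℝ) {δ : ℝ} (hδ : 0 < δ) (hδ1 : δ ≤ 1) (σ : Fin 3 → ℝ)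
    (hσ : ∀ j, |σ j| ≤ 1) (hsep : ∀ i j, i ≠ j → δ ≤ |σ i - σ j|) :
    ∃ j, δ ^ 2 / 20 * max |E| |F| ≤ |B + E * σ j - F * σ j ^ 2| := by
  by_contra! hcon
  set τ := δ ^ 2 / 20 * max |E| |F| with hτ
  have slope : ∀ i j, i ≠ j → |E - F * (σ i + σ j)| * δ ≤ 2 * τ := by
    intro i j hij
    calc |E - F * (σ i + σ j)| * δ ≤ |E - F * (σ i + σ j)| * |σ i - σ j| := by
          gcongr; exact hsep i j hij
      _ = |(B + E * σ i - F * σ i ^ 2) - (B + E * σ j - F * σ j ^ 2)| := by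
          rw [← abs_mul]; congr 1; ring
      _ ≤ |B + E * σ i - F * σ i ^ 2| + |B + E * σ j - F * σ j ^ 2| := abs_sub _ _
      _ ≤ 2 * τ := by linarith [hcon i, hcon j]
  have h01 := slope 0 1 (by decide)
  have h12 := slope 1 2 (by decide)
  have hF : |F| * δ ^ 2 ≤ 4 * τ := by
    calc |F| * δ ^ 2 = |F| * δ * δ := by ring
      _ ≤ |F| * |σ 2 - σ 0| * δ := by gcongr; exact hsep 2 0 (by decide)
      _ = |(E - F * (σ 0 + σ 1)) - (E - F * (σ 1 + σ 2))| * δ := by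
          rw [← abs_mul]; congr 2; ring
      _ ≤ (|E - F * (σ 0 + σ 1)| + |E - F * (σ 1 + σ 2)|) * δ := by gcongr; exact abs_sub _ _
      _ ≤ 4 * τ := by linarith
  have hτ0 : 0 ≤ τ := by positivity
  have hE : |E| * δ ^ 2 ≤ 10 * τ := by
    have h1 : |E| ≤ |E - F * (σ 0 + σ 1)| + |F| * 2 := by
      calc |E| = |(E - F * (σ 0 + σ 1)) + F * (σ 0 + σ 1)| := by congr 1; ring
        _ ≤ |E - F * (σ 0 + σ 1)| + |F * (σ 0 + σ 1)| := abs_add_le _ _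
        _ ≤ _ := by
          rw [abs_mul]
          gcongr
          exact (abs_add_le _ _).trans (by linarith [hσ 0, hσ 1])
    have h2 : |E - F * (σ 0 + σ 1)| * δ ^ 2 ≤ 2 * τ := by
      calc |E - F * (σ 0 + σ 1)| * δ ^ 2 = |E - F * (σ 0 + σ 1)| * δ * δ := by ring
        _ ≤ 2 * τ * 1 := by gcongr
        _ = _ := by ring
    calc |E| * δ ^ 2 ≤ (|E - F * (σ 0 + σ 1)| + |F| * 2) * δ ^ 2 := by gcongr
      _ ≤ _ := by linarith
  have hmax : max |E| |F| * δ ^ 2 ≤ 10 * τ := by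
    rcases max_choice |E| |F| with h | h <;> rw [h] <;> linarith
  have hτp : 0 < τ := (abs_nonneg _).trans_lt (hcon 0)
  have : max |E| |F| * δ ^ 2 = 20 * τ := by rw [hτ]; ring
  linarith

/-- The size of the nonconstant part of the polynomial `B + e s - C s²` for `|s| ≤ 4 ^ m`. -/
noncomputable def polySize (e C : ℝ) (m : ℕ) : ℝ := max (|e| * 4 ^ m) (|C| * 16 ^ m)

theorem polySize_pos {e C : ℝ} (h : e ≠ 0 ∨ C ≠ 0) (m : ℕ) : 0 < polySize e C m := by
  rcases h with h | h
  · exact lt_max_of_lt_left (by positivity)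
  · exact lt_max_of_lt_right (by positivity)

theorem four_mul_polySize_le (e C : ℝ) (m : ℕ) : 4 * polySize e C m ≤ polySize e C (m + 1) := by
  rw [polySize, polySize, mul_max_of_nonneg _ _ (by norm_num)]
  refine max_le_max (le_of_eq (by ring)) ?_
  rw [pow_succ]
  nlinarith [show 0 ≤ |C| * 16 ^ m by positivity]

theorem polySize_succ_le (e C : ℝ) (m : ℕ) : polySize e C (m + 1) ≤ 16 * polySize e C m := by
  rw [polySize, polySize, mul_max_of_nonneg _ _ (by norm_num)]
  refine max_le_max ?_ (le_of_eq (by ring))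
  rw [pow_succ]
  nlinarith [show 0 ≤ |e| * 4 ^ m by positivity]

theorem exists_scales {B e C : ℝ} (h : e ≠ 0 ∨ C ≠ 0) (K : ℕ)
    (hB : |B| ≤ ((4 : ℝ) ^ (K + 2))⁻¹) (he : |e| ≤ ((4 : ℝ) ^ (K + 2))⁻¹)
    (hC : |C| ≤ ((4 : ℝ) ^ (K + 2))⁻¹) :
    ∃ (m₀ t₀ : ℕ) (t : ℕ → ℤ), K ≤ t₀ ∧ InjOn t (Icc m₀ (2 * m₀ + t₀ / 2)) ∧
      (∀ m ∈ Icc m₀ (2 * m₀ + t₀ / 2), -(2 * m₀ : ℤ) ≤ t m ∧ t m ≤ t₀ ∧ 0 ≤ t m + m) ∧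
      ∀ m ∈ Icc m₀ (2 * m₀ + t₀ / 2), (K : ℤ) ≤ 2 * (t m + m) ∧ |B| ≤ polySize e C m ∧
        1 ≤ (4 : ℝ) ^ t m * polySize e C m ∧ (4 : ℝ) ^ t m * polySize e C m ≤ 4 := by
  have h41 : (1 : ℝ) < 4 := by norm_num
  set t : ℕ → ℤ := fun m => -Int.log 4 (polySize e C m) with ht
  have hlow : ∀ m, (4 : ℝ) ^ (-t m) ≤ polySize e C m := by
    intro m
    have := Int.zpow_log_le_self (b := 4) (by norm_num) (polySize_pos h m)
    simpa [ht] using this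
  have hup : ∀ m, polySize e C m < (4 : ℝ) ^ (1 - t m) := by
    intro m
    have := Int.lt_zpow_succ_log_self (b := 4) (by norm_num) (polySize e C m)
    simpa [ht, add_comm] using this
  have hdec : ∀ m, t (m + 1) ≤ t m - 1 := by
    intro m
    have : (4 : ℝ) ^ (1 - t m) < 4 ^ (1 - t (m + 1)) := by
      calc (4 : ℝ) ^ (1 - t m) = 4 * 4 ^ (-t m) := by
            rw [sub_eq_add_neg, zpow_add₀ (by norm_num), zpow_one]
        _ ≤ 4 * polySize e C m := by gcongr; exact hlow m
        _ ≤ polySize e C (m + 1) := four_mul_polySize_le e C m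
        _ < _ := hup _
    have := (zpow_lt_zpow_iff_right₀ h41).1 this
    omega
  have hinc : ∀ m, t m - 2 ≤ t (m + 1) := by
    intro m
    have : (4 : ℝ) ^ (-t (m + 1)) < 4 ^ (3 - t m) := by
      calc (4 : ℝ) ^ (-t (m + 1)) ≤ polySize e C (m + 1) := hlow _
        _ ≤ 16 * polySize e C m := polySize_succ_le e C m
        _ < 16 * 4 ^ (1 - t m) := by gcongr; exact hup m
        _ = 4 ^ (3 - t m) := by
          rw [show (3 : ℤ) - t m = 2 + (1 - t m) by ring, zpow_add₀ (by norm_num) 2]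
          norm_num
    have := (zpow_lt_zpow_iff_right₀ h41).1 this
    omega
  have hanti : StrictAnti t := strictAnti_nat_of_succ_lt fun m => by have := hdec m; omega
  have hlin : ∀ m₀ d : ℕ, t m₀ - 2 * d ≤ t (m₀ + d) := by
    intro m₀ d
    induction d with
    | zero => simp
    | succ d ih => have := hinc (m₀ + d); push_cast; rw [← add_assoc]; omega
  have hex : ∃ m, |B| ≤ polySize e C m := by
    have hgrow : ∀ m : ℕ, (4 : ℝ) ^ m * polySize e C 0 ≤ polySize e C m := by
      intro m
      induction m with
      | zero => simp
      | succ m ih =>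
        have := four_mul_polySize_le e C m
        rw [pow_succ]; linarith
    obtain ⟨m, hm⟩ := pow_unbounded_of_one_lt (|B| / polySize e C 0) h41
    rw [div_lt_iff₀ (polySize_pos h 0)] at hm
    exact ⟨m, hm.le.trans (hgrow m)⟩
  classical
  set m₀ := Nat.find hex with hm₀
  have hm₀le : |B| ≤ polySize e C m₀ := Nat.find_spec hex
  have hsmall : polySize e C m₀ ≤ ((4 : ℝ) ^ K)⁻¹ := by
    have e16 : 16 * ((4 : ℝ) ^ (K + 2))⁻¹ = ((4 : ℝ) ^ K)⁻¹ := by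
      rw [pow_add, mul_inv]; norm_num; ring
    rw [← e16]
    rcases Nat.eq_zero_or_pos m₀ with h0 | h0
    · rw [h0, polySize]
      have : (0 : ℝ) ≤ ((4 : ℝ) ^ (K + 2))⁻¹ := by positivity
      refine max_le ?_ ?_ <;> rw [pow_zero] <;> linarith
    · obtain ⟨n, hn⟩ : ∃ n, m₀ = n + 1 := ⟨m₀ - 1, by omega⟩
      have hlt : polySize e C n < |B| := not_le.1 (Nat.find_min hex (m := n) (by omega))
      rw [hn]
      have := polySize_succ_le e C n
      linarith
  have htK : (K : ℤ) ≤ t m₀ := by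
    have : (4 : ℝ) ^ (-t m₀) ≤ 4 ^ (-(K : ℤ)) := by
      rw [zpow_neg _ (K : ℤ), zpow_natCast]; exact (hlow m₀).trans hsmall
    have := (zpow_le_zpow_iff_right₀ h41).1 this
    omega
  have hmono : Monotone (polySize e C) := monotone_nat_of_le_succ fun m => by
    have := four_mul_polySize_le e C m
    have := polySize_pos h m
    linarith
  refine ⟨m₀, (t m₀).toNat, t, by omega, hanti.injective.injOn, ?_, ?_⟩
  · rintro m ⟨hm, hm'⟩
    obtain ⟨d, rfl⟩ := Nat.exists_eq_add_of_le hm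
    have h1 := hlin m₀ d
    have h2 := hanti.antitone hm
    push_cast
    refine ⟨?_, ?_, ?_⟩ <;> omega
  · rintro m ⟨hm, hm'⟩
    have h1 : (K : ℤ) ≤ 2 * (t m + m) := by
      obtain ⟨d, rfl⟩ := Nat.exists_eq_add_of_le hm
      have h1 := hlin m₀ d
      push_cast
      omega
    refine ⟨h1, hm₀le.trans (hmono hm), ?_, ?_⟩
    · calc (1 : ℝ) = 4 ^ t m * 4 ^ (-t m) := by rw [← zpow_add₀ (by norm_num)]; simp
        _ ≤ _ := by gcongr; exact hlow m
    · calc (4 : ℝ) ^ t m * polySize e C m ≤ 4 ^ t m * 4 ^ (1 - t m) := by gcongr; exact (hup m).le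
        _ = 4 := by rw [← zpow_add₀ (by norm_num)]; simp

end Scales

section ReturnMatrices

variable {p : ℕ} [hp : Fact p.Prime]

/-- The conjugate of `g` by the product of a diagonal and a unipotent real matrix. -/
noncomputable def conjMat (g : Amb p) (t : ℤ) (s : ℝ) : Amb p :=
  realDiag p t * unip p s * g * (unip p (-s) * realDiag p (-t))

theorem conjMat_snd (g : Amb p) (t : ℤ) (s : ℝ) : (conjMat g t s).2 = g.2 := by
  simp [conjMat, realDiag, unip]

theorem two_zpow_mul_self (t : ℤ) : (2 : ℝ) ^ t * 2 ^ t = 4 ^ t := by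
  rw [← mul_zpow]; norm_num

theorem conjMat_zero_zero (g : Amb p) (t : ℤ) (s : ℝ) :
    (conjMat g t s).1 0 0 = g.1 0 0 + s * g.1 1 0 := by
  simp [conjMat, realDiag, unip, sl_mul_apply]
  field_simp

theorem conjMat_one_one (g : Amb p) (t : ℤ) (s : ℝ) :
    (conjMat g t s).1 1 1 = g.1 1 1 - s * g.1 1 0 := by
  simp [conjMat, realDiag, unip, sl_mul_apply]
  field_simp
  ring

theorem conjMat_one_zero (g : Amb p) (t : ℤ) (s : ℝ) :
    (conjMat g t s).1 1 0 = 4 ^ (-t) * g.1 1 0 := by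
  rw [← two_zpow_mul_self]
  simp [conjMat, realDiag, unip, sl_mul_apply]
  ring

theorem conjMat_zero_one (g : Amb p) (t : ℤ) (s : ℝ) :
    (conjMat g t s).1 0 1 =
      4 ^ t * (g.1 0 1 + (g.1 1 1 - g.1 0 0) * s - g.1 1 0 * s ^ 2) := by
  rw [← two_zpow_mul_self]
  simp [conjMat, realDiag, unip, sl_mul_apply]
  ring

theorem conjMat_smul {k : ℕ} {g : Amb p} {x : Amb p ⧸ lattice p} (t : ℤ) (s : ℝ)
    (hg : (flow p).b ^ k • x = g • x) :
    (flow p).b ^ k • (flow p).a ^ t • (flow p).u s • x =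
      conjMat g t s • (flow p).a ^ t • (flow p).u s • x := by
  have hc : Commute ((flow p).b ^ k) ((flow p).a ^ t * (flow p).u s) :=
    (((flow p).commute_a_b.zpow_left t).mul_left ((flow p).commute_u_b s)).symm.pow_left k
  have e : unip p (-s) * realDiag p (-t) = ((flow p).a ^ t * (flow p).u s)⁻¹ := by
    rw [mul_inv_rev, ← zpow_neg, flow_a_zpow, ← (flow p).u_neg]
    rfl
  have e' : realDiag p t * unip p s = (flow p).a ^ t * (flow p).u s := by
    rw [flow_a_zpow]; rfl
  rw [conjMat, e, e', ← mul_smul ((flow p).a ^ t), ← mul_smul, hc.eq, mul_smul, hg, ← mul_smul,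
    ← mul_smul]
  congr 1
  group

theorem exists_return_matrix {g : Amb p} {x : Amb p ⧸ lattice p} {Y₀ : Set (Amb p ⧸ lattice p)}
    {n k K : ℕ} (hbr : (flow p).HasBranches Y₀ n k x) (hg : (flow p).b ^ k • x = g • x)
    (hne : g.1 1 1 - g.1 0 0 ≠ 0 ∨ g.1 1 0 ≠ 0) (hK : 1 ≤ K)
    (h₀₀ : |g.1 0 0 - 1| ≤ ((4 : ℝ) ^ (K + 3))⁻¹) (h₁₁ : |g.1 1 1 - 1| ≤ ((4 : ℝ) ^ (K + 3))⁻¹)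
    (h₀₁ : |g.1 0 1| ≤ ((4 : ℝ) ^ (K + 3))⁻¹) (h₁₀ : |g.1 1 0| ≤ ((4 : ℝ) ^ (K + 3))⁻¹) :
    ∃ (y : Amb p ⧸ lattice p) (M : Amb p), y ∈ Y₀ ∧ (flow p).b ^ k • y ∈ Y₀ ∧
      (flow p).b ^ k • y = M • y ∧ M.2 = g.2 ∧ |M.1 0 0 - 1| ≤ 5 * (1 / 2) ^ K ∧
      |M.1 1 1 - 1| ≤ 5 * (1 / 2) ^ K ∧ |M.1 1 0| ≤ 4 * (1 / 2) ^ K ∧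
      ((4 : ℝ) ^ n)⁻¹ ^ 2 / 20 ≤ |M.1 0 1| ∧ |M.1 0 1| ≤ 12 := by
  set A := g.1 0 0
  set B := g.1 0 1
  set C := g.1 1 0
  set D := g.1 1 1
  have h4 : 4 * ((4 : ℝ) ^ (K + 3))⁻¹ = ((4 : ℝ) ^ (K + 2))⁻¹ := by
    rw [pow_succ _ (K + 2), mul_inv]; ring
  have hpos : (0 : ℝ) < ((4 : ℝ) ^ (K + 3))⁻¹ := by positivity
  have he : |D - A| ≤ ((4 : ℝ) ^ (K + 2))⁻¹ := by
    have : D - A = (D - 1) - (A - 1) := by ring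
    rw [this]
    exact (abs_sub _ _).trans (by linarith)
  obtain ⟨m₀, t₀, t, ht₀, hinj, hrange, hscale⟩ := exists_scales (B := B) hne K (by linarith) he
    (by linarith)
  obtain ⟨m, hm, s, hs, hsep, hY⟩ := hbr m₀ t₀ t (by omega) hinj hrange
  obtain ⟨hKm, hBm, hlow, hup⟩ := hscale m hm
  set φ := polySize (D - A) C m with hφ
  have h4m : (0 : ℝ) < 4 ^ m := by positivity
  obtain ⟨j, hj⟩ := exists_large_value B ((D - A) * 4 ^ m) (C * 16 ^ m)
    (show (0 : ℝ) < ((4 : ℝ) ^ n)⁻¹ by positivity)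
    (inv_le_one_of_one_le₀ (one_le_pow₀ (by norm_num))) (fun j => s j / 4 ^ m)
    (fun j => by rw [abs_div, abs_of_pos h4m, div_le_one h4m]; exact hs j)
    (fun i j hij => by
      rw [← sub_div, abs_div, abs_of_pos h4m, le_div_iff₀ h4m]
      have := hsep i j hij
      rwa [div_eq_inv_mul] at this)
  have h16 : (16 : ℝ) ^ m = 4 ^ m * 4 ^ m := by rw [← mul_pow]; norm_num
  have hQ : B + (D - A) * 4 ^ m * (s j / 4 ^ m) - C * 16 ^ m * (s j / 4 ^ m) ^ 2 =
      B + (D - A) * s j - C * s j ^ 2 := by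
    rw [h16]; field_simp
  rw [hQ] at hj
  have hmax : max |(D - A) * 4 ^ m| |C * 16 ^ m| = φ := by
    rw [hφ, polySize, abs_mul, abs_mul, abs_of_pos h4m, abs_of_pos (by positivity : (0:ℝ) < 16 ^ m)]
  rw [hmax] at hj
  have hQup : |B + (D - A) * s j - C * s j ^ 2| ≤ 3 * φ := by
    have h1 : |(D - A) * s j| ≤ φ := by
      rw [abs_mul]
      exact (mul_le_mul_of_nonneg_left (hs j) (abs_nonneg _)).trans (le_max_left _ _)
    have h2 : |C * s j ^ 2| ≤ φ := by
      rw [abs_mul, abs_pow]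
      refine le_trans ?_ (le_max_right _ _)
      rw [h16, ← sq]
      gcongr
      exact hs j
    have := abs_sub (B + (D - A) * s j) (C * s j ^ 2)
    have := abs_add_le B ((D - A) * s j)
    linarith
  have h4t : (0 : ℝ) < 4 ^ t m := by positivity
  have hθ : (4 : ℝ) ^ (-(t m + m)) ≤ (1 / 2) ^ K := by
    calc (4 : ℝ) ^ (-(t m + m)) = 2 ^ (-(2 * (t m + m))) := by
          rw [← two_zpow_mul_self, ← zpow_add₀ two_ne_zero]; congr 1; ring
      _ ≤ 2 ^ (-(K : ℤ)) := zpow_le_zpow_right₀ (by norm_num) (by omega)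
      _ = _ := by rw [zpow_neg, zpow_natCast, one_div, inv_pow]
  have hθ0 : (0 : ℝ) < 4 ^ (-(t m + m)) := by positivity
  have hC1 : |C| * 4 ^ m ≤ 4 * 4 ^ (-(t m + m)) := by
    have h1 : |C| * 16 ^ m ≤ φ := le_max_right _ _
    have h2 : 4 ^ t m * (|C| * 16 ^ m) ≤ 4 := (mul_le_mul_of_nonneg_left h1 h4t.le).trans hup
    have h3 : |C| * 4 ^ m = 4 ^ t m * (|C| * 16 ^ m) * 4 ^ (-(t m + m)) := by
      rw [h16, neg_add, zpow_add₀ (by norm_num), zpow_neg, zpow_neg, zpow_natCast]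
      field_simp
    rw [h3]
    gcongr
  have hθ1 : ((1 : ℝ) / 2) ^ K ≤ 1 := pow_le_one₀ (by norm_num) (by norm_num)
  have hθK : (0 : ℝ) < (1 / 2) ^ K := by positivity
  have hsC : |s j * C| ≤ 4 * (1 / 2) ^ K := by
    rw [abs_mul, mul_comm]
    calc |C| * |s j| ≤ |C| * 4 ^ m := by gcongr; exact hs j
      _ ≤ _ := hC1.trans (by gcongr)
  have h4K : ((4 : ℝ) ^ (K + 3))⁻¹ ≤ (1 / 2) ^ K := by
    rw [one_div, inv_pow]
    refine inv_anti₀ (by positivity) ?_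
    calc (2 : ℝ) ^ K ≤ 4 ^ K := pow_le_pow_left₀ (by norm_num) (by norm_num) _
      _ ≤ 4 ^ (K + 3) := pow_le_pow_right₀ (by norm_num) (by omega)
  refine ⟨(flow p).a ^ t m • (flow p).u (s j) • x, conjMat g (t m) (s j), (hY j).1, (hY j).2,
    conjMat_smul _ _ hg, conjMat_snd _ _ _, ?_, ?_, ?_, ?_, ?_⟩
  · rw [conjMat_zero_zero, add_sub_right_comm]
    exact (abs_add_le _ _).trans (by linarith)
  · rw [conjMat_one_one, sub_right_comm]
    exact (abs_sub _ _).trans (by linarith)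
  · rw [conjMat_one_zero, abs_mul, abs_of_pos (by positivity)]
    have : (4 : ℝ) ^ (-t m) * |C| = |C| * 4 ^ m * 4 ^ (-(t m + m)) := by
      rw [neg_add, zpow_add₀ (by norm_num), zpow_neg, zpow_neg, zpow_natCast]
      field_simp
    rw [this]
    calc |C| * 4 ^ m * 4 ^ (-(t m + m)) ≤ 4 * 4 ^ (-(t m + m)) * 1 := by
          gcongr; exact hθ.trans hθ1
      _ ≤ _ := by linarith
  · rw [conjMat_zero_one, abs_mul, abs_of_pos h4t]
    calc ((4 : ℝ) ^ n)⁻¹ ^ 2 / 20 ≤ ((4 : ℝ) ^ n)⁻¹ ^ 2 / 20 * (4 ^ t m * φ) :=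
          le_mul_of_one_le_right (by positivity) hlow
      _ = 4 ^ t m * (((4 : ℝ) ^ n)⁻¹ ^ 2 / 20 * φ) := by ring
      _ ≤ _ := by gcongr
  · rw [conjMat_zero_one, abs_mul, abs_of_pos h4t]
    calc 4 ^ t m * |B + (D - A) * s j - C * s j ^ 2| ≤ 4 ^ t m * (3 * φ) := by gcongr
      _ ≤ 12 := by linarith

end ReturnMatrices

section Recurrence

variable {p : ℕ} [hp : Fact p.Prime]

theorem not_forall_unip_mem_stays {ε : ℝ} (hε : 0 < ε) {r : ℝ} (hr : r ≠ 0)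
    (z : Amb p ⧸ lattice p) :
    ¬ ∀ k : ℤ, (flow p).u (k * r) • z ∈ (flow p).stays (thickQ p ε) := by
  intro hz
  obtain ⟨h, rfl⟩ := QuotientGroup.mk_surjective z
  have h0 : (QuotientGroup.mk h : Amb p ⧸ lattice p) ∈ (flow p).stays (thickQ p ε) := by
    simpa [(flow p).u_zero] using hz 0
  have key : ∀ w : Fin 2 → ℝ × ℚ_[p], (∀ i, w i ∈ diag p) → w ≠ 0 →
      ε ≤ (1 + |r|) * |h.1 1 0 * (w 0).1 + h.1 1 1 * (w 1).1| *
        max ‖h.2 0 0 * (w 0).2 + h.2 0 1 * (w 1).2‖ ‖h.2 1 0 * (w 0).2 + h.2 1 1 * (w 1).2‖ := by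
    intro w hw hw0
    have hsnd := snd_ne_zero_of_mem_stays hε h0 hw hw0
    set f := h.1 0 0 * (w 0).1 + h.1 0 1 * (w 1).1
    set c := h.1 1 0 * (w 0).1 + h.1 1 1 * (w 1).1
    set k : ℤ := -round (f / (r * c))
    have hmem : unip p (k * r) * h ∈ thick p ε :=
      mk_mem_thickQ.1 ((flow p).stays_subset (hz k))
    have := hmem w hw hw0
    rw [size_eq] at this
    have e₁ : (unip p (k * r) * h).1 0 0 * (w 0).1 + (unip p (k * r) * h).1 0 1 * (w 1).1 =
        f + k * (r * c) := by
      simp [unip, sl_mul_apply, f, c]; ring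
    have e₂ : (unip p (k * r) * h).1 1 0 * (w 0).1 + (unip p (k * r) * h).1 1 1 * (w 1).1 = c := by
      simp [unip, sl_mul_apply, c]
    have e₃ : (unip p (k * r) * h).2 = h.2 := by simp [unip]
    rw [e₁, e₂, e₃] at this
    refine this.trans (mul_le_mul_of_nonneg_right ?_ (by positivity))
    have hrc : r * c ≠ 0 := mul_ne_zero hr hsnd
    refine max_le ?_ (by nlinarith [abs_nonneg r, abs_nonneg c])
    have : f + k * (r * c) = (f / (r * c) - round (f / (r * c))) * (r * c) := by
      simp only [k]; push_cast; field_simp; ring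
    rw [this, abs_mul, abs_mul]
    have := abs_sub_round (f / (r * c))
    calc |f / (r * c) - round (f / (r * c))| * (|r| * |c|) ≤ 1 * (|r| * |c|) := by
          gcongr; linarith
      _ ≤ _ := by nlinarith [abs_nonneg r, abs_nonneg c]
  by_cases hd : h.1 1 1 = 0
  · refine snd_ne_zero_of_mem_stays hε h0 (w := ![0, 1]) ?_ ?_ (by simp [hd])
    · rw [Fin.forall_fin_two]
      exact ⟨(diag p).zero_mem, (diag p).one_mem⟩
    · intro h'
      simpa using congrFun h' 1
  set H := max (max ‖h.2 0 0‖ ‖h.2 0 1‖) (max ‖h.2 1 0‖ ‖h.2 1 1‖)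
  have hbound : ∀ n : ℕ, ε ≤ (1 + |r|) * |h.1 1 1| * H * (1 / ((n : ℝ) + 1)) := by
    intro n
    obtain ⟨j, k, hk, -, hjk⟩ := Real.exists_int_int_abs_mul_sub_le (h.1 1 0 / h.1 1 1)
      (n := n + 1) (by omega)
    have hle : (1 : ℝ) / ((n + 1 : ℕ) + 1) ≤ 1 / ((n : ℝ) + 1) := by
      push_cast
      exact one_div_le_one_div_of_le (by positivity) (by linarith)
    refine (key ![((k : ℝ), (k : ℚ_[p])), (((-j : ℤ) : ℝ), ((-j : ℤ) : ℚ_[p]))] ?_ ?_).trans ?_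
    · rw [Fin.forall_fin_two]
      exact ⟨intCast_mem_diag k, intCast_mem_diag (-j)⟩
    · intro h'
      have := congrArg Prod.fst (congrFun h' 0)
      simp at this
      omega
    · simp only [Matrix.cons_val_zero, Matrix.cons_val_one]
      have e₁ : h.1 1 0 * (k : ℝ) + h.1 1 1 * ((-j : ℤ) : ℝ) =
          h.1 1 1 * (k * (h.1 1 0 / h.1 1 1) - j) := by
        push_cast; field_simp; ring
      have hn : ∀ x y : ℚ_[p], ‖x * (k : ℚ_[p]) + y * ((-j : ℤ) : ℚ_[p])‖ ≤ max ‖x‖ ‖y‖ := by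
        intro x y
        refine (Padic.nonarchimedean _ _).trans (max_le_max ?_ ?_) <;> rw [norm_mul] <;>
          exact mul_le_of_le_one_right (norm_nonneg _) (Padic.norm_int_le_one _)
      rw [e₁, abs_mul]
      calc (1 + |r|) * (|h.1 1 1| * |k * (h.1 1 0 / h.1 1 1) - j|) * max _ _
          ≤ (1 + |r|) * (|h.1 1 1| * (1 / ((n : ℝ) + 1))) * H := by
            gcongr
            · exact hjk.trans hle
            · exact max_le_max (hn _ _) (hn _ _)
        _ = _ := by ring
  have hlim := (tendsto_one_div_add_atTop_nhds_zero_nat (𝕜 := ℝ)).const_mul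
    ((1 + |r|) * |h.1 1 1| * H)
  rw [mul_zero] at hlim
  exact absurd (ge_of_tendsto' hlim hbound) (not_le.2 hε)

theorem tendsto_sl {ι R : Type*} [CommRing R] [TopologicalSpace R] {l : Filter ι}
    {f : ι → Matrix.SpecialLinearGroup (Fin 2) R} {g : Matrix.SpecialLinearGroup (Fin 2) R}
    (h : ∀ i j, Tendsto (fun n => f n i j) l (𝓝 (g i j))) : Tendsto f l (𝓝 g) := by
  refine (IsInducing.induced (Subtype.val : Matrix.SpecialLinearGroup (Fin 2) R →
    Matrix (Fin 2) (Fin 2) R)).tendsto_nhds_iff.2 ?_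
  exact tendsto_pi_nhds.2 fun i => tendsto_pi_nhds.2 fun j => h i j

theorem exists_near_one_smul_eq {x : Amb p ⧸ lattice p} {k : ℕ → ℕ}
    (hx : Tendsto (fun i => (flow p).b ^ k i • x) atTop (𝓝 x)) {U : Set (Amb p)}
    (hU : U ∈ 𝓝 1) : ∃ i, ∃ g ∈ U, (flow p).b ^ k i • x = g • x := by
  obtain ⟨h, rfl⟩ := QuotientGroup.mk_surjective x
  have hopen : IsOpenMap fun g : Amb p => (QuotientGroup.mk (g * h) : Amb p ⧸ lattice p) :=
    QuotientGroup.isOpenMap_coe.comp (isOpenMap_mul_right h)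
  have := hopen.image_mem_nhds hU
  simp only [one_mul] at this
  obtain ⟨i, g, hg, e⟩ := (hx.eventually this).exists
  exact ⟨i, g, hg, e.symm⟩

theorem not_recurrent_hasBranches {ε : ℝ} (hε : 0 < ε) {Y₀ : Set (Amb p ⧸ lattice p)}
    (hY₀ : Y₀ ⊆ (flow p).stays (thickQ p ε)) (hrigid : (flow p).IsRigid (thickQ p ε) Y₀)
    {x : Amb p ⧸ lattice p} (hx : x ∈ (flow p).stays (thickQ p ε)) {n : ℕ} {k : ℕ → ℕ}
    (hk : ∀ i, 1 ≤ k i) (hlim : Tendsto (fun i => (flow p).b ^ k i • x) atTop (𝓝 x)) :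
    ¬ ∀ i, (flow p).HasBranches Y₀ n (k i) x := by
  intro hbr
  have step : ∀ K : ℕ, ∃ (κ : ℕ) (y : Amb p ⧸ lattice p) (M : Amb p), y ∈ Y₀ ∧
      (flow p).b ^ κ • y ∈ Y₀ ∧ (flow p).b ^ κ • y = M • y ∧
      (∀ i j, ‖M.2 i j - (1 : Matrix.SpecialLinearGroup (Fin 2) ℚ_[p]) i j‖ ≤ (1 / 2) ^ K) ∧
      |M.1 0 0 - 1| ≤ 5 * (1 / 2) ^ K ∧ |M.1 1 1 - 1| ≤ 5 * (1 / 2) ^ K ∧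
      |M.1 1 0| ≤ 4 * (1 / 2) ^ K ∧ ((4 : ℝ) ^ n)⁻¹ ^ 2 / 20 ≤ |M.1 0 1| ∧ |M.1 0 1| ≤ 12 := by
    intro K
    have hη : (0 : ℝ) < ((4 : ℝ) ^ ((K + 1) + 3))⁻¹ := by positivity
    have hη1 : ((4 : ℝ) ^ ((K + 1) + 3))⁻¹ < 1 :=
      inv_lt_one_of_one_lt₀ (one_lt_pow₀ (by norm_num) (by omega))
    have hθ : (0 : ℝ) < (1 / 2) ^ (K + 1) := by positivity
    have hU₁ : ∀ i j, ∀ᶠ g : Amb p in 𝓝 1,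
        |g.1 i j - (1 : Matrix.SpecialLinearGroup (Fin 2) ℝ) i j| <
          ((4 : ℝ) ^ ((K + 1) + 3))⁻¹ := by
      intro i j
      have hc : Continuous fun g : Amb p => g.1 i j := by fun_prop
      exact Metric.tendsto_nhds.1 (hc.tendsto 1) _ hη
    have hU₂ : ∀ i j, ∀ᶠ g : Amb p in 𝓝 1,
        ‖g.2 i j - (1 : Matrix.SpecialLinearGroup (Fin 2) ℚ_[p]) i j‖ < (1 / 2) ^ (K + 1) := by
      intro i j
      have hc : Continuous fun g : Amb p => g.2 i j := by fun_prop
      have := Metric.tendsto_nhds.1 (hc.tendsto 1) _ hθ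
      simp only [dist_eq_norm_sub] at this
      exact this
    have hU := (eventually_all.2 fun i => eventually_all.2 (hU₁ i)).and
      (eventually_all.2 fun i => eventually_all.2 (hU₂ i))
    obtain ⟨i, g, ⟨hg₁, hg₂⟩, hg⟩ := exists_near_one_smul_eq hlim hU
    have h2lt : ((1 : ℝ) / 2) ^ (K + 1) ≤ 1 := pow_le_one₀ (by norm_num) (by norm_num)
    have hne : g.1 1 1 - g.1 0 0 ≠ 0 ∨ g.1 1 0 ≠ 0 := by
      obtain ⟨h, rfl⟩ := QuotientGroup.mk_surjective x
      exact not_scalar_of_return hε (hk i) hx hg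
        (by simpa using (hg₁ 0 0).trans hη1) (by simpa using (hg₂ 0 0).trans_le h2lt)
    obtain ⟨y, M, h₁, h₂, h₃, h₄, h₅, h₆, h₇, h₈, h₉⟩ := exists_return_matrix (hbr i) hg hne
      (K := K + 1) (by omega) (by simpa using (hg₁ 0 0).le) (by simpa using (hg₁ 1 1).le)
      (by simpa using (hg₁ 0 1).le) (by simpa using (hg₁ 1 0).le)
    have hhalf : ((1 : ℝ) / 2) ^ (K + 1) ≤ (1 / 2) ^ K :=
      pow_le_pow_of_le_one (by norm_num) (by norm_num) (by omega)
    refine ⟨k i, y, M, h₁, h₂, h₃, fun i j => ?_, ?_, ?_, ?_, h₈, h₉⟩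
    · rw [h₄]; exact (hg₂ i j).le.trans hhalf
    · linarith
    · linarith
    · linarith
  choose κ y M hy hby hM hpad h00 h11 h10 hlow hup using step
  have hC : IsCompact (thickQ p ε ×ˢ Icc (-12 : ℝ) 12) := (isCompact_thickQ hε).prod isCompact_Icc
  obtain ⟨⟨z, r⟩, -, θ, hθ, hθlim⟩ := hC.tendsto_subseq (x := fun K => (y K, (M K).1 0 1))
    (fun K => ⟨(flow p).stays_subset (hY₀ (hy K)), abs_le.1 (hup K)⟩)
  have hz : Tendsto (fun K => y (θ K)) atTop (𝓝 z) := (continuous_fst.tendsto _).comp hθlim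
  have hr : Tendsto (fun K => (M (θ K)).1 0 1) atTop (𝓝 r) := (continuous_snd.tendsto _).comp hθlim
  have hr0 : r ≠ 0 := by
    have : ((4 : ℝ) ^ n)⁻¹ ^ 2 / 20 ≤ |r| := ge_of_tendsto' hr.abs fun K => hlow (θ K)
    have h0 : (0 : ℝ) < ((4 : ℝ) ^ n)⁻¹ ^ 2 / 20 := by positivity
    exact abs_pos.1 (h0.trans_le this)
  have hpow : Tendsto (fun K => ((1 : ℝ) / 2) ^ θ K) atTop (𝓝 0) :=
    (tendsto_pow_atTop_nhds_zero_of_lt_one (by norm_num) (by norm_num)).comp hθ.tendsto_atTop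
  have hpow' : ∀ c : ℝ, Tendsto (fun K => c * ((1 : ℝ) / 2) ^ θ K) atTop (𝓝 0) := by
    intro c; simpa using hpow.const_mul c
  have hMlim : Tendsto (fun K => M (θ K)) atTop (𝓝 ((flow p).u r)) := by
    refine Tendsto.prodMk_nhds (tendsto_sl ?_) (tendsto_sl ?_)
    · rw [forall_fin_two_two]
      refine ⟨?_, hr, ?_, ?_⟩
      · exact tendsto_iff_norm_sub_tendsto_zero.2
          (squeeze_zero (fun _ => norm_nonneg _) (fun K => h00 (θ K)) (hpow' 5))
      · exact squeeze_zero_norm (fun K => h10 (θ K)) (hpow' 4)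
      · exact tendsto_iff_norm_sub_tendsto_zero.2
          (squeeze_zero (fun _ => norm_nonneg _) (fun K => h11 (θ K)) (hpow' 5))
    · intro i j
      exact tendsto_iff_norm_sub_tendsto_zero.2
        (squeeze_zero (fun _ => norm_nonneg _) (fun K => hpad (θ K) i j) hpow)
  have hz' : Tendsto (fun K => (flow p).b ^ κ (θ K) • y (θ K)) atTop (𝓝 ((flow p).u r • z)) := by
    simp_rw [hM]
    exact hMlim.smul hz
  have hinv := hrigid (fun K => y (θ K)) (fun K => κ (θ K)) z ((flow p).u r • z)
    (fun K => hy _) (fun K => hby _) hz hz'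
  have hz0 : z ∈ (flow p).stays (thickQ p ε) :=
    ((flow p).isClosed_stays (isClosed_thickQ ε)).mem_of_tendsto hz
      (Eventually.of_forall fun K => hY₀ (hy _))
  refine not_forall_unip_mem_stays hε hr0 z fun j => ?_
  have hstep : ∀ j : ℤ, (flow p).u (j * r) • z ∈ (flow p).stays (thickQ p ε) ↔
      (flow p).u ((j + 1 : ℤ) * r) • z ∈ (flow p).stays (thickQ p ε) := by
    intro j
    rw [hinv, ← mul_smul, ← (flow p).u_add]
    push_cast
    rw [add_mul, one_mul]
  induction j using Int.induction_on with
  | zero => simpa [(flow p).u_zero] using hz0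
  | succ j ih => exact (hstep _).1 ih
  | pred j ih => rw [hstep]; simpa using ih

end Recurrence

section Approximation

variable {p : ℕ} [hp : Fact p.Prime]

/-- The numbers `u` for which `|q| |q u - q₀| |q v - q₀|_p` is bounded below by `ε` for large `q`
and `q₀`, and `|u - q₀ / q|` is bounded below by `ε` for the other `q` and `q₀`. -/
def badSet (v : ℚ_[p]) (ε : ℝ) (N : ℕ) : Set ℝ :=
  {u | (∀ q q₀ : ℤ, (N : ℤ) ≤ |q| → (N : ℤ) ≤ |q₀| →
      ε ≤ (|q| : ℝ) * |(q : ℝ) * u - (q₀ : ℝ)| * ‖(q : ℚ_[p]) * v - (q₀ : ℚ_[p])‖) ∧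
    ∀ q q₀ : ℤ, q ≠ 0 → (|q| < N ∨ |q₀| < N) → ε * |(q : ℝ)| ≤ |(q : ℝ) * u - q₀|}

theorem badSet_anti {v : ℚ_[p]} {ε ε' : ℝ} {N : ℕ} (h : ε' ≤ ε) :
    badSet v ε N ⊆ badSet v ε' N := fun _ hu =>
  ⟨fun q q₀ hq hq₀ => h.trans (hu.1 q q₀ hq hq₀), fun q q₀ hq hN =>
    (mul_le_mul_of_nonneg_right h (abs_nonneg _)).trans (hu.2 q q₀ hq hN)⟩

theorem exists_pos_mul_abs_le {u : ℝ} (hu : Irrational u) (N : ℕ) :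
    ∃ ε > 0, ∀ q q₀ : ℤ, q ≠ 0 → (|q| < N ∨ |q₀| < N) → ε * |(q : ℝ)| ≤ |(q : ℝ) * u - q₀| := by
  have hu0 : 0 < |u| := abs_pos.2 hu.ne_zero
  obtain ⟨Q, hQ⟩ := exists_nat_ge (max (N : ℝ) (2 * N / |u|))
  have hQN : (N : ℝ) ≤ Q := (le_max_left _ _).trans hQ
  have hQu : 2 * N ≤ Q * |u| := by
    have := (le_max_right _ _).trans hQ
    rwa [div_le_iff₀ hu0] at this
  have small : ∃ δ > 0, ∀ q ∈ (Finset.Icc (-(Q : ℤ)) Q).filter (· ≠ 0), ∀ q₀ : ℤ,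
      δ ≤ |(q : ℝ) * u - q₀| := by
    have hpos : ∀ q ∈ (Finset.Icc (-(Q : ℤ)) Q).filter (· ≠ 0),
        0 < |(q : ℝ) * u - round ((q : ℝ) * u)| := by
      intro q hq
      have : Irrational ((q : ℝ) * u) := hu.intCast_mul (Finset.mem_filter.1 hq).2
      exact abs_pos.2 (sub_ne_zero.2 (this.ne_int _))
    rcases ((Finset.Icc (-(Q : ℤ)) Q).filter (· ≠ 0)).eq_empty_or_nonempty with he | hne
    · exact ⟨1, one_pos, by simp [he]⟩
    · obtain ⟨m, hm, hmin⟩ := Finset.exists_min_image _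
        (fun q : ℤ => |(q : ℝ) * u - round ((q : ℝ) * u)|) hne
      exact ⟨_, hpos m hm, fun q hq q₀ => (hmin q hq).trans (round_le _ _)⟩
  obtain ⟨δ, hδ, hsmall⟩ := small
  refine ⟨min (δ / (Q + 1)) (|u| / 2), by positivity, fun q q₀ hq hN => ?_⟩
  by_cases hqQ : |q| ≤ Q
  · have h1 : |(q : ℝ)| ≤ Q := by exact_mod_cast hqQ
    calc _ ≤ δ / (Q + 1) * (Q + 1) := by
          gcongr
          · exact min_le_left _ _
          · linarith
      _ = δ := by field_simp
      _ ≤ _ := hsmall q (by simp [hq, ← abs_le, hqQ]) q₀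
  · have h1 : (Q : ℝ) ≤ |(q : ℝ)| := by exact_mod_cast (not_le.1 hqQ).le
    have hq₀ : |(q₀ : ℝ)| ≤ N := by
      have h2 : ¬ |q| < N := by
        have : (N : ℤ) ≤ Q := by exact_mod_cast hQN
        omega
      exact_mod_cast (hN.resolve_left h2).le
    have h3 : |(q : ℝ) * u| - |(q₀ : ℝ)| ≤ |(q : ℝ) * u - q₀| := abs_sub_abs_le_abs_sub _ _
    have h4 : Q * |u| ≤ |(q : ℝ)| * |u| := by gcongr
    have h5 : min (δ / (Q + 1)) (|u| / 2) * |(q : ℝ)| ≤ |u| / 2 * |(q : ℝ)| := by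
      gcongr; exact min_le_right _ _
    rw [abs_mul] at h3
    nlinarith

theorem exists_primitive {w : Fin 2 → ℝ × ℚ_[p]} (hw : ∀ i, w i ∈ diag p) (hw0 : w ≠ 0) :
    ∃ (k : ℤ) (z : Fin 2 → ℤ), (∀ i, w i = ((p : ℝ) ^ k * z i, (p : ℚ_[p]) ^ k * z i)) ∧
      ∃ i, ‖(z i : ℚ_[p])‖ = 1 := by
  obtain ⟨i, hi⟩ := Finite.exists_max fun i => ‖(w i).2‖
  have hi0 : (w i).2 ≠ 0 := by
    intro h0
    apply hw0
    funext j
    have hj : (w j).2 = 0 := norm_le_zero_iff.1 (by simpa [h0] using hi j)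
    exact Prod.ext ((fst_eq_zero_iff (hw j)).2 hj) hj
  obtain ⟨k, hk⟩ : ∃ k : ℤ, ‖(w i).2‖ = (p : ℝ) ^ (-k) :=
    ⟨_, Padic.norm_eq_zpow_neg_valuation hi0⟩
  have hp0 : (0 : ℝ) < p := by exact_mod_cast hp.out.pos
  have hnorm : ∀ j, ‖(p : ℚ_[p]) ^ (-k) * (w j).2‖ = ‖(w j).2‖ / ‖(w i).2‖ := by
    intro j
    rw [norm_mul, Padic.norm_p_zpow, hk, neg_neg, zpow_neg, div_inv_eq_mul, mul_comm]
  have hz : ∀ j, ∃ z : ℤ, ((p : ℝ) ^ (-k), (p : ℚ_[p]) ^ (-k)) * w j = ((z : ℝ), (z : ℚ_[p])) := by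
    intro j
    have := exists_int_of_norm_le_one ((diag p).mul_mem (prime_zpow_mem_diag (-k)) (hw j)) (by
      rw [Prod.snd_mul]
      dsimp only
      rw [hnorm]
      exact div_le_one_of_le₀ (hi j) (norm_nonneg _))
    obtain ⟨z, hz⟩ := this
    exact ⟨z, by simpa using hz⟩
  choose z hz using hz
  refine ⟨k, z, fun j => ?_, i, ?_⟩
  · have h1 := congrArg Prod.fst (hz j)
    have h2 := congrArg Prod.snd (hz j)
    simp only [Prod.fst_mul, Prod.snd_mul] at h1 h2
    refine Prod.ext ?_ ?_
    · rw [← h1, ← mul_assoc, ← zpow_add₀ hp0.ne']; simp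
    · rw [← h2, ← mul_assoc, ← zpow_add₀ prime_ne_zero_padic]; simp
  · have h2 := congrArg Prod.snd (hz i)
    simp only [Prod.snd_mul] at h2
    rw [← h2, hnorm, div_self (norm_ne_zero_iff.2 hi0)]

/-- The pair of matrices sending `(q, q₀)` to `(q u - q₀, q)` and `(q v - q₀, q)`. -/
noncomputable def basePoint (u : ℝ) (v : ℚ_[p]) : Amb p :=
  (sl u (-1) 1 0 (by simp), sl v (-1) 1 0 (by simp))

theorem unip_mul_basePoint (s u : ℝ) (v : ℚ_[p]) :
    unip p s * basePoint u v = basePoint (u + s) v := by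
  refine Prod.ext (sl_ext ?_ ?_ ?_ ?_) (by simp [unip, basePoint]) <;>
    simp [unip, basePoint, sl_mul_apply]

theorem size_basePoint (t j : ℕ) (u : ℝ) (v : ℚ_[p]) {w : Fin 2 → ℝ × ℚ_[p]} {k : ℤ}
    {z : Fin 2 → ℤ} (hw : ∀ i, w i = ((p : ℝ) ^ k * z i, (p : ℚ_[p]) ^ k * z i)) :
    size (realDiag p t * (padicDiag p j * basePoint u v)) w =
      max (2 ^ t * |z 0 * u - z 1|) ((2 ^ t)⁻¹ * |(z 0 : ℝ)|) *
      max ((p : ℝ) ^ j * ‖(z 0 : ℚ_[p]) * v - z 1‖) (((p : ℝ) ^ j)⁻¹ * ‖(z 0 : ℚ_[p])‖) := by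
  have hp0 : (0 : ℝ) < p := by exact_mod_cast hp.out.pos
  have e₁ : ∀ x : ℝ, |(p : ℝ) ^ k * x| = (p : ℝ) ^ k * |x| := fun x => by
    rw [abs_mul, abs_of_pos (by positivity)]
  have e₂ : ∀ x : ℚ_[p], ‖(p : ℚ_[p]) ^ k * x‖ = ((p : ℝ) ^ k)⁻¹ * ‖x‖ := fun x => by
    rw [norm_mul, Padic.norm_p_zpow, zpow_neg]
  have a₁ : (realDiag p t * (padicDiag p j * basePoint u v)).1 0 0 * (w 0).1 +
      (realDiag p t * (padicDiag p j * basePoint u v)).1 0 1 * (w 1).1 =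
      (p : ℝ) ^ k * (2 ^ t * (z 0 * u - z 1)) := by
    simp [realDiag, padicDiag, basePoint, sl_mul_apply, hw]; ring
  have a₂ : (realDiag p t * (padicDiag p j * basePoint u v)).1 1 0 * (w 0).1 +
      (realDiag p t * (padicDiag p j * basePoint u v)).1 1 1 * (w 1).1 =
      (p : ℝ) ^ k * ((2 ^ t)⁻¹ * z 0) := by
    simp [realDiag, padicDiag, basePoint, sl_mul_apply, hw]; ring
  have a₃ : (realDiag p t * (padicDiag p j * basePoint u v)).2 0 0 * (w 0).2 +
      (realDiag p t * (padicDiag p j * basePoint u v)).2 0 1 * (w 1).2 =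
      (p : ℚ_[p]) ^ k * (((p : ℚ_[p]) ^ j)⁻¹ * (z 0 * v - z 1)) := by
    simp [realDiag, padicDiag, basePoint, sl_mul_apply, hw]; ring
  have a₄ : (realDiag p t * (padicDiag p j * basePoint u v)).2 1 0 * (w 0).2 +
      (realDiag p t * (padicDiag p j * basePoint u v)).2 1 1 * (w 1).2 =
      (p : ℚ_[p]) ^ k * (p ^ j * z 0) := by
    simp [realDiag, padicDiag, basePoint, sl_mul_apply, hw]; ring
  rw [size_eq, a₁, a₂, a₃, a₄, e₁, e₁, e₂, e₂, ← mul_max_of_nonneg _ _ (by positivity),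
    ← mul_max_of_nonneg _ _ (by positivity), mul_mul_mul_comm, mul_inv_cancel₀ (by positivity),
    one_mul, abs_mul, abs_mul, norm_mul, norm_mul, norm_inv, norm_pow, Padic.norm_p, inv_pow,
    inv_inv, abs_of_pos (by positivity : (0 : ℝ) < 2 ^ t),
    abs_of_pos (by positivity : (0 : ℝ) < (2 ^ t)⁻¹)]

theorem one_le_abs_mul_norm_int {q : ℤ} (hq : q ≠ 0) : 1 ≤ |(q : ℝ)| * ‖(q : ℚ_[p])‖ := by
  obtain ⟨k, hk⟩ : ∃ k : ℕ, ‖(q : ℚ_[p])‖ = (p : ℝ) ^ (-k : ℤ) := by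
    have h0 : (q : ℚ_[p]) ≠ 0 := by exact_mod_cast hq
    refine ⟨(q : ℚ_[p]).valuation.toNat, ?_⟩
    rw [Padic.norm_eq_zpow_neg_valuation h0, Int.toNat_of_nonneg]
    exact (Padic.norm_le_one_iff_val_nonneg _).1 (Padic.norm_int_le_one q)
  have hp0 : (0 : ℝ) < p := by exact_mod_cast hp.out.pos
  have hdvd := (Padic.norm_int_le_pow_iff_dvd q k).1 hk.le
  have hle : ((p ^ k : ℕ) : ℤ) ≤ |q| := 
    Int.le_of_dvd (abs_pos.2 hq) ((dvd_abs _ _).2 (by exact_mod_cast hdvd))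
  have hle' : (p : ℝ) ^ k ≤ |(q : ℝ)| := by exact_mod_cast hle
  rw [hk, zpow_neg, zpow_natCast, ← div_eq_mul_inv, one_le_div (by positivity)]
  exact hle'

theorem mul_basePoint_mem_thick {u : ℝ} {v : ℚ_[p]} {ε : ℝ} {N : ℕ} (hε : 0 < ε) (hε1 : ε ≤ 1)
    (hεv : ε * ‖v‖ ≤ 1) (hu : u ∈ badSet v ε N) {t j : ℕ} (htj : (p : ℝ) ^ j ≤ 2 ^ t) :
    realDiag p t * (padicDiag p j * basePoint u v) ∈ thick p ε := by
  intro w hw hw0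
  obtain ⟨k, z, hz, hz1⟩ := exists_primitive hw hw0
  rw [size_basePoint t j u v hz]
  rw [Fin.exists_fin_two] at hz1
  set q := z 0
  set q₀ := z 1
  have hp1 : (1 : ℝ) ≤ p := by exact_mod_cast hp.out.one_le
  have hpj : (1 : ℝ) ≤ (p : ℝ) ^ j := one_le_pow₀ hp1
  have h2t : (1 : ℝ) ≤ 2 ^ t := one_le_pow₀ (by norm_num)
  by_cases hq : q = 0
  · have hq₀ : q₀ ≠ 0 := by
      rintro h0
      simp [hq, h0] at hz1
    have h1 := one_le_abs_mul_norm_int (p := p) hq₀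
    calc ε ≤ 1 := hε1
      _ ≤ |(q₀ : ℝ)| * ‖(q₀ : ℚ_[p])‖ := h1
      _ ≤ (2 ^ t * |(q : ℝ) * u - q₀|) * ((p : ℝ) ^ j * ‖(q : ℚ_[p]) * v - q₀‖) := by
          simp only [hq, Int.cast_zero, zero_mul, zero_sub, abs_neg, norm_neg]
          gcongr
          · exact le_mul_of_one_le_left (abs_nonneg _) h2t
          · exact le_mul_of_one_le_left (norm_nonneg _) hpj
      _ ≤ _ := by gcongr <;> exact le_max_left _ _
  by_cases hN : |q| < N ∨ |q₀| < N
  · have h1 := one_le_abs_mul_norm_int (p := p) hq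
    have h2 := hu.2 q q₀ hq hN
    have h3 : 1 ≤ (2 : ℝ) ^ t * ((p : ℝ) ^ j)⁻¹ := by
      rw [← div_eq_mul_inv, one_le_div (by positivity)]; exact htj
    calc ε = ε * 1 * 1 := by ring
      _ ≤ ε * (|(q : ℝ)| * ‖(q : ℚ_[p])‖) * ((2 : ℝ) ^ t * ((p : ℝ) ^ j)⁻¹) := by gcongr
      _ = (2 ^ t * (ε * |(q : ℝ)|)) * (((p : ℝ) ^ j)⁻¹ * ‖(q : ℚ_[p])‖) := by ring
      _ ≤ (2 ^ t * |(q : ℝ) * u - q₀|) * (((p : ℝ) ^ j)⁻¹ * ‖(q : ℚ_[p])‖) := by gcongr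
      _ ≤ _ := by
          gcongr
          · exact le_max_left _ _
          · exact le_max_right _ _
  push Not at hN
  have h1 := hu.1 q q₀ hN.1 hN.2
  set R := max (2 ^ t * |(q : ℝ) * u - q₀|) ((2 ^ t)⁻¹ * |(q : ℝ)|)
  set P := max ((p : ℝ) ^ j * ‖(q : ℚ_[p]) * v - q₀‖) (((p : ℝ) ^ j)⁻¹ * ‖(q : ℚ_[p])‖)
  have hR0 : 0 ≤ R := le_max_of_le_right (by positivity)
  have hP0 : 0 ≤ P := le_max_of_le_right (by positivity)
  have hR : |(q : ℝ)| * |(q : ℝ) * u - q₀| ≤ R * R := by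
    calc _ = (2 ^ t * |(q : ℝ) * u - q₀|) * ((2 ^ t)⁻¹ * |(q : ℝ)|) := by field_simp
      _ ≤ _ := by
          gcongr
          · exact le_max_left _ _
          · exact le_max_right _ _
  have hP : ‖(q : ℚ_[p]) * v - q₀‖ * ‖(q : ℚ_[p])‖ ≤ P * P := by
    calc _ = ((p : ℝ) ^ j * ‖(q : ℚ_[p]) * v - q₀‖) * (((p : ℝ) ^ j)⁻¹ * ‖(q : ℚ_[p])‖) := by
          field_simp
      _ ≤ _ := by
          gcongr
          · exact le_max_left _ _
          · exact le_max_right _ _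
  have key : ε * ε ≤ (R * P) * (R * P) := by
    by_cases hqε : ε ≤ ‖(q : ℚ_[p])‖
    · calc ε * ε ≤ (|(q : ℝ)| * |(q : ℝ) * u - q₀| * ‖(q : ℚ_[p]) * v - q₀‖) * ‖(q : ℚ_[p])‖ := by
            gcongr
        _ = (|(q : ℝ)| * |(q : ℝ) * u - q₀|) * (‖(q : ℚ_[p]) * v - q₀‖ * ‖(q : ℚ_[p])‖) := by ring
        _ ≤ (R * R) * (P * P) := by gcongr
        _ = _ := by ring
    · push Not at hqε
      have hq₀1 : ‖(q₀ : ℚ_[p])‖ = 1 := hz1.resolve_left (by linarith)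
      have hqv : ‖(q : ℚ_[p]) * v‖ < 1 := by
        rw [norm_mul]
        rcases eq_or_ne v 0 with rfl | hv
        · simp
        · have : 0 < ‖v‖ := norm_pos_iff.2 hv
          nlinarith
      have hone : ‖(q : ℚ_[p]) * v - q₀‖ = 1 := by
        rw [sub_eq_add_neg, Padic.add_eq_max_of_ne (by rw [norm_neg, hq₀1]; exact hqv.ne),
          norm_neg, hq₀1, max_eq_right hqv.le]
      have hP1 : 1 ≤ P := by
        refine le_trans ?_ (le_max_left _ _)
        rw [hone, mul_one]; exact hpj
      rw [hone, mul_one] at h1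
      calc ε * ε ≤ ε * 1 := by gcongr
        _ ≤ (R * R) * (1 * 1) := by linarith [h1.trans hR]
        _ ≤ (R * R) * (P * P) := by gcongr
        _ = _ := by ring
  exact abs_le_of_sq_le_sq' (by nlinarith) (by positivity) |>.2

end Approximation

section BoxDimension

variable {p : ℕ} [hp : Fact p.Prime]

theorem eventually_card_lt_exp {v : ℚ_[p]} {ε : ℝ} {N : ℕ} (hε : 0 < ε) (r : ℝ) {h : ℝ}
    (hh : 0 < h) : ∀ᶠ T : ℕ in atTop, ∀ F : Finset Digits,
      (∀ f ∈ F, r + Real.ofDigits f ∈ badSet v ε N) → InjOn (idx T) F →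
      (F.card : ℝ) < Real.exp (h * T) := by
  by_contra hcon
  let _ : MeasurableSpace (Amb p ⧸ lattice p) := borel _
  have _ : BorelSpace (Amb p ⧸ lattice p) := ⟨rfl⟩
  let ε' := min (min ε 1) (1 / (1 + ‖v‖))
  have hv1 : 0 < 1 + ‖v‖ := by positivity
  have hε' : 0 < ε' := by positivity
  have hε'1 : ε' ≤ 1 := (min_le_left _ _).trans (min_le_right _ _)
  have hε'v : ε' * ‖v‖ ≤ 1 := by
    have h1 : ε' ≤ 1 / (1 + ‖v‖) := min_le_right _ _
    rw [le_div_iff₀ hv1] at h1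
    nlinarith
  have hS : ∀ j : ℕ, ∃ S : ℕ, ∀ t ≥ S, (p : ℝ) ^ j ≤ 2 ^ t := by
    intro j
    obtain ⟨S, hS⟩ := pow_unbounded_of_one_lt ((p : ℝ) ^ j) (one_lt_two : (1 : ℝ) < 2)
    exact ⟨S, fun t ht => hS.le.trans (pow_le_pow_right₀ one_le_two ht)⟩
  choose S hS using hS
  obtain ⟨Y₀, hY₀, hrigid, x, hx, n, k, hk, hlim, hbr⟩ :=
    (flow p).exists_recurrent_hasBranches (isCompact_thickQ hε')
      (QuotientGroup.mk (basePoint r v)) {f | r + Real.ofDigits f ∈ badSet v ε N} S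
      (by
        intro j t ht f hf
        rw [← zpow_natCast, ← zpow_natCast, flow_a_zpow, flow_b_zpow]
        change QuotientGroup.mk (realDiag p t * (padicDiag p j *
          (unip p (Real.ofDigits f) * basePoint r v))) ∈ _
        rw [mk_mem_thickQ, unip_mul_basePoint]
        exact mul_basePoint_mem_thick hε' hε'1 hε'v
          (badSet_anti ((min_le_left _ _).trans (min_le_left _ _)) hf) (hS j t ht))
      hh (by
        rw [not_eventually] at hcon
        refine hcon.mono fun T hT => ?_
        push Not at hT
        exact hT)
  exact not_recurrent_hasBranches hε' hY₀ hrigid hx hk hlim hbr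

theorem upperBoxDim_eq_zero {E : Set ℝ}
    (hE : ∀ h : ℝ, 0 < h → ∀ᶠ T : ℕ in atTop, ∀ F : Finset ℝ, ↑F ⊆ E →
      IsSepIn dist ((4 : ℝ) ^ T)⁻¹ F → (F.card : ℝ) ≤ Real.exp (h * T)) :
    upperBoxDim dist E = 0 := by
  have hlog4 : 1 ≤ Real.log 4 := by
    rw [Real.le_log_iff_exp_le (by norm_num)]
    linarith [Real.exp_one_lt_d9]
  have habs : Tendsto (fun δ : ℝ => |Real.log δ|) (𝓝[>] 0) atTop :=
    tendsto_abs_atBot_atTop.comp Real.tendsto_log_nhdsGT_zero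
  have hceil : Tendsto (fun δ : ℝ => ⌈|Real.log δ| / Real.log 4⌉₊) (𝓝[>] 0) atTop :=
    tendsto_nat_ceil_atTop.comp (habs.atTop_div_const (by linarith))
  refine Tendsto.limsup_eq (Metric.tendsto_nhds.2 fun η hη => ?_)
  filter_upwards [hceil.eventually (hE (η / 3) (by positivity)), habs.eventually_ge_atTop 1,
    self_mem_nhdsWithin] with δ hδ hδ1 hδ0
  rw [mem_Ioi] at hδ0
  set T := ⌈|Real.log δ| / Real.log 4⌉₊
  have hT : (T : ℝ) ≤ 2 * |Real.log δ| := by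
    have h1 : (T : ℝ) < |Real.log δ| / Real.log 4 + 1 := Nat.ceil_lt_add_one (by positivity)
    have h2 : |Real.log δ| / Real.log 4 ≤ |Real.log δ| := div_le_self (abs_nonneg _) hlog4
    linarith
  have hTδ : ((4 : ℝ) ^ T)⁻¹ ≤ δ := by
    have h1 : |Real.log δ| / Real.log 4 ≤ T := Nat.le_ceil _
    rw [div_le_iff₀ (by linarith)] at h1
    rw [← Real.log_le_log_iff (by positivity) hδ0, Real.log_inv, Real.log_pow]
    linarith [neg_abs_le (Real.log δ)]
  have hle : (sepNum dist δ E : ℝ) ≤ Real.exp (η / 3 * T) := by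
    have : sepNum dist δ E ≤ ⌊Real.exp (η / 3 * T)⌋₊ := by
      refine csSup_le ⟨0, ∅, by simp, by simp [IsSepIn], rfl⟩ ?_
      rintro _ ⟨F, hF, hsep, rfl⟩
      exact Nat.le_floor (hδ F hF fun x hx y hy hxy => hTδ.trans_lt (hsep x hx y hy hxy))
    exact (Nat.cast_le.2 this).trans (Nat.floor_le (Real.exp_pos _).le)
  have hlog : Real.log (sepNum dist δ E) ≤ η / 3 * T := by
    rcases (sepNum dist δ E).eq_zero_or_pos with h0 | h0
    · rw [h0]; simp; positivity
    · exact (Real.log_le_iff_le_exp (by exact_mod_cast h0)).2 hle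
  have hlog0 : 0 ≤ Real.log (sepNum dist δ E) := Real.log_natCast_nonneg _
  have hpos : 0 < |Real.log δ| := by linarith
  rw [Real.dist_eq, sub_zero, abs_of_nonneg (by positivity), div_lt_iff₀ hpos]
  nlinarith

theorem upperBoxDim_eq_zero_of_subsingleton {E : Set ℝ} (hE : E.Subsingleton) :
    upperBoxDim dist E = 0 := by
  refine upperBoxDim_eq_zero fun h hh => Eventually.of_forall fun T F hF _ => ?_
  have h1 : F.card ≤ 1 := Finset.card_le_one.2 fun x hx y hy => hE (hF hx) (hF hy)
  calc (F.card : ℝ) ≤ 1 := by exact_mod_cast h1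
    _ ≤ _ := Real.one_le_exp (by positivity)

theorem abs_ofDigits_sub_le_of_idx_eq {n : ℕ} {f g : Digits} (h : idx n f = idx n g) :
    |Real.ofDigits f - Real.ofDigits g| ≤ ((4 : ℝ) ^ n)⁻¹ := by
  have e₁ := ofDigits_mul_pow n f
  have e₂ := ofDigits_mul_pow n g
  have f₀ := Real.ofDigits_nonneg (shift^[n] f)
  have f₁ := Real.ofDigits_le_one (shift^[n] f)
  have g₀ := Real.ofDigits_nonneg (shift^[n] g)
  have g₁ := Real.ofDigits_le_one (shift^[n] g)
  have h4 : (0 : ℝ) < 4 ^ n := by positivity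
  rw [← one_div, le_div_iff₀ h4, ← abs_of_pos h4, ← abs_mul, sub_mul, e₁, e₂, h,
    abs_le]
  constructor <;> linarith

theorem upperBoxDim_badSet_inter_Ico {v : ℚ_[p]} {ε : ℝ} (hε : 0 < ε) (N : ℕ) (r : ℝ) :
    upperBoxDim dist (badSet v ε N ∩ Ico r (r + 1)) = 0 := by
  classical
  refine upperBoxDim_eq_zero fun h hh => ?_
  filter_upwards [eventually_card_lt_exp (v := v) (N := N) hε r hh] with T hT F hF hsep
  let d : ℝ → Digits := fun x => Real.digits (x - r) 4
  have hd : ∀ x ∈ F, Real.ofDigits (d x) = x - r := by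
    intro x hx
    have := (hF hx).2
    exact Real.ofDigits_digits (by norm_num) ⟨by linarith [this.1], by linarith [this.2]⟩
  have hinj : ∀ x ∈ F, ∀ y ∈ F, idx T (d x) = idx T (d y) → x = y := by
    intro x hx y hy hxy
    by_contra hne
    have h1 := abs_ofDigits_sub_le_of_idx_eq hxy
    rw [hd x hx, hd y hy, sub_sub_sub_cancel_right, ← Real.dist_eq] at h1
    exact absurd (hsep x hx y hy hne) (not_lt.2 h1)
  have hcard : (F.image d).card = F.card :=
    Finset.card_image_of_injOn fun x hx y hy hxy => hinj x hx y hy (congrArg _ hxy)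
  rw [← hcard]
  refine (hT (F.image d) ?_ ?_).le
  · intro f hf
    obtain ⟨x, hx, rfl⟩ := Finset.mem_image.1 hf
    rw [hd x hx, add_sub_cancel]
    exact (hF hx).1
  · intro f hf g hg hfg
    rw [Finset.mem_coe] at hf hg
    obtain ⟨x, hx, rfl⟩ := Finset.mem_image.1 hf
    obtain ⟨y, hy, rfl⟩ := Finset.mem_image.1 hg
    rw [hinj x hx y hy hfg]

theorem not_cond12_of_mem_badSet {u : ℝ} {v : ℚ_[p]} {ε : ℝ} {N : ℕ} (hε : 0 < ε)
    (hu : u ∈ badSet v ε N) : ¬ Cond12 p u v := by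
  intro h
  obtain ⟨q, q₀, h₁, h₂, h₃⟩ := h ε hε N
  exact absurd h₃ (not_lt.2 (hu.1 q q₀ h₁ h₂))

theorem exists_mem_badSet {u : ℝ} {v : ℚ_[p]} (hu : Irrational u) (h : ¬ Cond12 p u v) :
    ∃ k N : ℕ, u ∈ badSet v (1 / ((k : ℝ) + 1)) N := by
  unfold Cond12 at h
  push Not at h
  obtain ⟨ε, hε, N, hN⟩ := h
  obtain ⟨ε', hε', hN'⟩ := exists_pos_mul_abs_le hu N
  obtain ⟨k, hk⟩ := exists_nat_one_div_lt (lt_min hε hε')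
  have hmem : u ∈ badSet v (min ε ε') N :=
    ⟨fun q q₀ hq hq₀ => (min_le_left _ _).trans (hN q q₀ hq hq₀), fun q q₀ hq hq₀ =>
      (mul_le_mul_of_nonneg_right (min_le_right _ _) (abs_nonneg _)).trans (hN' q q₀ hq hq₀)⟩
  exact ⟨k, N, badSet_anti hk.le hmem⟩

/-- The pieces of the exceptional set: bounded pieces of the sets `badSet`, and the rational
points. -/
def piece (v : ℚ_[p]) : (ℕ × ℕ × ℤ) ⊕ ℚ → Set ℝ
  | Sum.inl (k, N, i) => badSet v (1 / ((k : ℝ) + 1)) N ∩ Ico (i : ℝ) (i + 1)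
  | Sum.inr c => {u | u = c ∧ ¬ Cond12 p u v}

theorem iUnion_piece (v : ℚ_[p]) : ⋃ i, piece v i = {u : ℝ | ¬ Cond12 p u v} := by
  ext u
  rw [mem_iUnion, mem_ofPred_eq]
  constructor
  · rintro ⟨⟨k, N, i⟩ | c, hu⟩
    · exact not_cond12_of_mem_badSet (by positivity) hu.1
    · exact hu.2
  · intro hu
    by_cases hirr : Irrational u
    · obtain ⟨k, N, hkN⟩ := exists_mem_badSet hirr hu
      exact ⟨Sum.inl (k, N, ⌊u⌋), hkN, Int.floor_le u, Int.lt_floor_add_one u⟩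
    · obtain ⟨c, rfl⟩ := not_not.1 hirr
      exact ⟨Sum.inr c, rfl, hu⟩

theorem totallyBounded_piece (v : ℚ_[p]) (i : (ℕ × ℕ × ℤ) ⊕ ℚ) : TotallyBounded (piece v i) := by
  rcases i with ⟨k, N, i⟩ | c
  · exact (totallyBounded_Ico _ _).subset inter_subset_right
  · exact (finite_singleton (c : ℝ)).totallyBounded.subset fun u hu => hu.1

theorem upperBoxDim_piece (v : ℚ_[p]) (i : (ℕ × ℕ × ℤ) ⊕ ℚ) :
    upperBoxDim dist (piece v i) = 0 := by
  rcases i with ⟨k, N, i⟩ | c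
  · exact upperBoxDim_badSet_inter_Ico (by positivity) N i
  · exact upperBoxDim_eq_zero_of_subsingleton fun x hx y hy => hx.1.trans hy.1.symm

end BoxDimension

end PadicLittlewood

/-- For every prime `p` and every `v ∈ ℚ_p`, the set of `u ∈ ℝ` such that `(u,v)` does not
satisfy condition (1.2) is a countable union of (totally bounded) sets of upper box
dimension zero. -/
theorem not_cond12_countable_union_of_boxDim_zero (p : ℕ) [Fact p.Prime] (v : ℚ_[p]) :
    ∃ s : ℕ → Set ℝ, ({u : ℝ | ¬ Cond12 p u v} = ⋃ n, s n) ∧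
      ∀ n, TotallyBounded (s n) ∧ upperBoxDim dist (s n) = 0 := by
  obtain ⟨f, hf⟩ := exists_surjective_nat ((ℕ × ℕ × ℤ) ⊕ ℚ)
  refine ⟨fun n => PadicLittlewood.piece v (f n), ?_, fun n =>
    ⟨PadicLittlewood.totallyBounded_piece v (f n), PadicLittlewood.upperBoxDim_piece v (f n)⟩⟩
  rw [hf.iUnion_comp fun i => PadicLittlewood.piece v i, PadicLittlewood.iUnion_piece]
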